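/- arXiv:1803.02360 — 3 statements merged into one kernel-verified Lean document; each statement's English description precedes it below -/
import Mathlib

section
/- Entropy Power Inequality: let (Ω, F, P) be a probability space and let X, Y : Ω → ℝ^n be independent random vectors whose laws are absolutely continuous with respect to Lebesgue measure, with densities f and g respectively; let h be a density of the law of X + Y. Assume that f ln f, g ln g and h ln h are Lebesgue-integrable, and set S(X) = −∫ f ln f, S(Y) = −∫ g ln g, S(X+Y) = −∫ h ln h. Then exp(2·S(X+Y)/n) ≥ exp(2·S(X)/n) + exp(2·S(Y)/n). -/
open MeasureTheory ProbabilityTheory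

namespace EntropyPower

open Set Filter Topology

/-- The measure on `ℝ` with density `f` with respect to Lebesgue measure. -/
noncomputable abbrev densityMeasure (f : ℝ → ℝ) : Measure ℝ :=
  volume.withDensity fun x => ENNReal.ofReal (f x)

section Transport

variable {f p : ℝ → ℝ}

lemma integrable_of_densityMeasure (hf : Measurable f) (hf0 : ∀ x, 0 ≤ f x)
    [IsProbabilityMeasure (densityMeasure f)] : Integrable f := by
  refine ⟨hf.aestronglyMeasurable, ?_⟩
  rw [hasFiniteIntegral_iff_ofReal (ae_of_all _ hf0)]
  have h := measure_univ (μ := densityMeasure f)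
  rw [withDensity_apply _ MeasurableSet.univ, setLIntegral_univ] at h
  simp [h]

lemma cdf_densityMeasure (hf : Measurable f) (hf0 : ∀ x, 0 ≤ f x)
    [IsProbabilityMeasure (densityMeasure f)] (x : ℝ) :
    cdf (densityMeasure f) x = ∫ t in Iic x, f t := by
  rw [cdf_eq_real, measureReal_def, withDensity_apply _ measurableSet_Iic,
    integral_eq_lintegral_of_nonneg_ae (ae_of_all _ hf0) hf.aestronglyMeasurable]

lemma cdf_densityMeasure_eq_add (hf : Measurable f) (hf0 : ∀ x, 0 ≤ f x)
    [IsProbabilityMeasure (densityMeasure f)] :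
    (cdf (densityMeasure f) : ℝ → ℝ) =
      fun x => (∫ t in (0 : ℝ)..x, f t) + ∫ t in Iic 0, f t := by
  ext x
  have hi := integrable_of_densityMeasure hf hf0
  rw [cdf_densityMeasure hf hf0,
    ← intervalIntegral.integral_Iic_sub_Iic hi.integrableOn hi.integrableOn]
  ring

/-- The distribution function of a density is differentiable almost everywhere, with derivative
the density. -/
lemma ae_hasDerivAt_cdf (hf : Measurable f) (hf0 : ∀ x, 0 ≤ f x)
    [IsProbabilityMeasure (densityMeasure f)] :
    ∀ᵐ x, HasDerivAt (cdf (densityMeasure f)) (f x) x := by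
  have hi := integrable_of_densityMeasure hf hf0
  rw [cdf_densityMeasure_eq_add hf hf0]
  filter_upwards [LocallyIntegrable.ae_hasDerivAt_integral hi.locallyIntegrable] with x hx
  exact (hx 0).add_const _

lemma continuous_cdf (hf : Measurable f) (hf0 : ∀ x, 0 ≤ f x)
    [IsProbabilityMeasure (densityMeasure f)] :
    Continuous (cdf (densityMeasure f)) := by
  have hi := integrable_of_densityMeasure hf hf0
  rw [cdf_densityMeasure_eq_add hf hf0]
  exact (intervalIntegral.continuous_primitive (fun a b => hi.intervalIntegrable) 0).add_const _

lemma strictMono_cdf (hp : Measurable p) (hp0 : ∀ x, 0 < p x)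
    [IsProbabilityMeasure (densityMeasure p)] :
    StrictMono (cdf (densityMeasure p)) := by
  have hi := integrable_of_densityMeasure hp fun x => (hp0 x).le
  rw [cdf_densityMeasure_eq_add hp fun x => (hp0 x).le]
  intro x y hxy
  have h := intervalIntegral.integral_add_adjacent_intervals
    (hi.intervalIntegrable (a := 0) (b := x)) (hi.intervalIntegrable (a := x) (b := y))
  have h2 := intervalIntegral.intervalIntegral_pos_of_pos
    (hi.intervalIntegrable (a := x) (b := y)) hp0 hxy
  simp only
  linarith

lemma exists_cdf_eq (hf : Measurable f) (hf0 : ∀ x, 0 ≤ f x)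
    [IsProbabilityMeasure (densityMeasure f)] {c : ℝ} (h0 : 0 < c) (h1 : c < 1) :
    ∃ t, cdf (densityMeasure f) t = c :=
  mem_range_of_exists_le_of_exists_ge (continuous_cdf hf hf0)
    (((tendsto_cdf_atBot _).eventually (Iic_mem_nhds h0)).exists)
    (((tendsto_cdf_atTop _).eventually (Ici_mem_nhds h1)).exists)

/-- The monotone rearrangement of a positive density `p` onto a density `f`. -/
lemma exists_strictMono_map_eq (hf : Measurable f) (hf0 : ∀ x, 0 ≤ f x)
    (hp : Measurable p) (hp0 : ∀ x, 0 < p x)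
    [IsProbabilityMeasure (densityMeasure f)] [IsProbabilityMeasure (densityMeasure p)] :
    ∃ T : ℝ → ℝ, StrictMono T ∧ (densityMeasure p).map T = densityMeasure f ∧
      ∀ x, cdf (densityMeasure f) (T x) = cdf (densityMeasure p) x := by
  set F := cdf (densityMeasure f) with hF
  set P := cdf (densityMeasure p) with hP
  have hPm : StrictMono P := strictMono_cdf hp hp0
  have hP0 : ∀ x, 0 < P x := fun x =>
    (cdf_nonneg _ (x - 1)).trans_lt (hPm (by linarith))
  have hP1 : ∀ x, P x < 1 := fun x =>
    (hPm (by linarith : x < x + 1)).trans_le (cdf_le_one _ _)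
  choose T hT using fun x => exists_cdf_eq hf hf0 (hP0 x) (hP1 x)
  have hTm : StrictMono T := fun x y hxy => by
    by_contra h
    have := (monotone_cdf (densityMeasure f)) (not_lt.mp h)
    rw [hT, hT] at this
    exact absurd (hPm hxy) (not_lt.mpr this)
  refine ⟨T, hTm, ?_, hT⟩
  have hTmeas : Measurable T := hTm.monotone.measurable
  have : IsProbabilityMeasure ((densityMeasure p).map T) :=
    Measure.isProbabilityMeasure_map hTmeas.aemeasurable
  have hlt : ∀ {x t}, P x < F t → T x < t := fun {x t} h => by
    by_contra h'
    have := (monotone_cdf (densityMeasure f)) (not_lt.mp h')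
    rw [hT] at this
    exact absurd h (not_lt.mpr this)
  have hgt : ∀ {x t}, F t < P x → t < T x := fun {x t} h => by
    by_contra h'
    have := (monotone_cdf (densityMeasure f)) (not_lt.mp h')
    rw [hT] at this
    exact absurd h (not_lt.mpr this)
  refine Measure.ext_of_Iic _ _ fun t => ?_
  rw [Measure.map_apply hTmeas measurableSet_Iic, ← ofReal_cdf (densityMeasure f)]
  rcases (cdf_nonneg (densityMeasure f) t).eq_or_lt with h0 | h0
  · have : T ⁻¹' Iic t = ∅ := by
      ext x
      simpa using hgt (by rw [hF, ← h0]; exact hP0 x)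
    rw [this, ← h0]; simp
  rcases (cdf_le_one (densityMeasure f) t).eq_or_lt with h1 | h1
  · have : T ⁻¹' Iic t = univ := by
      ext x
      simpa using (hlt (by rw [hF, h1]; exact hP1 x)).le
    rw [this, h1]; simp
  obtain ⟨s, hs⟩ := exists_cdf_eq hp (fun x => (hp0 x).le) h0 h1
  have hIic : T ⁻¹' Iic t ⊆ Iic s := fun x hx => by
    by_contra h
    exact absurd (hgt (x := x) (t := t) (by rw [hF, ← hs]; exact hPm (not_le.mp h)))
      (not_lt.mpr hx)
  have hIio : Iio s ⊆ T ⁻¹' Iic t := fun x hx =>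
    (hlt (by rw [hF, ← hs]; exact hPm hx)).le
  rw [← hs, ofReal_cdf]
  refine le_antisymm (measure_mono hIic) ?_
  rw [← measure_congr (Iio_ae_eq_Iic (μ := densityMeasure p) (a := s))]
  exact measure_mono hIio

/-- The Jacobian equation for a monotone rearrangement. -/
lemma ae_mul_deriv_eq (hf : Measurable f) (hf0 : ∀ x, 0 ≤ f x)
    (hp : Measurable p) (hp0 : ∀ x, 0 < p x)
    [IsProbabilityMeasure (densityMeasure f)] [IsProbabilityMeasure (densityMeasure p)]
    {T : ℝ → ℝ} (hT : StrictMono T) (hmap : (densityMeasure p).map T = densityMeasure f)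
    (hcdf : ∀ x, cdf (densityMeasure f) (T x) = cdf (densityMeasure p) x) :
    ∀ᵐ x, DifferentiableAt ℝ T x ∧ 0 < deriv T x ∧ 0 < f (T x) ∧ f (T x) * deriv T x = p x := by
  have hac : (volume : Measure ℝ) ≪ densityMeasure p :=
    withDensity_absolutelyContinuous' hp.ennreal_ofReal.aemeasurable
      (ae_of_all _ fun x => by simpa using hp0 x)
  have h1 : ∀ᵐ x, HasDerivAt (cdf (densityMeasure f)) (f (T x)) (T x) := by
    apply hac.ae_le
    refine ae_of_ae_map (hT.monotone.measurable).aemeasurable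
      (p := fun y => HasDerivAt (cdf (densityMeasure f)) (f y) y) ?_
    rw [hmap]
    exact (withDensity_absolutelyContinuous _ _).ae_le (ae_hasDerivAt_cdf hf hf0)
  filter_upwards [h1, ae_hasDerivAt_cdf hp (fun x => (hp0 x).le),
    hT.monotone.ae_differentiableAt] with x hx hpx hTx
  have hc : HasDerivAt (cdf (densityMeasure p)) (f (T x) * deriv T x) x := by
    have := hx.comp x hTx.hasDerivAt
    rwa [show cdf (densityMeasure f) ∘ T = cdf (densityMeasure p) from funext hcdf] at this
  have heq := hc.unique hpx
  have hd : 0 ≤ deriv T x := hT.monotone.deriv_nonneg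
  have := hp0 x
  refine ⟨hTx, hd.lt_of_ne ?_, (hf0 _).lt_of_ne ?_, heq⟩
  · intro h; rw [← h] at heq; simp at heq; linarith
  · intro h; rw [← h] at heq; simp at heq; linarith

end Transport

section OneDim

lemma lintegral_deriv_mul_comp_le {Θ : ℝ → ℝ} (hΘ : Monotone Θ) (q : ℝ → ENNReal) :
    ∫⁻ t, ENNReal.ofReal (deriv Θ t) * q (Θ t) ≤ ∫⁻ z, q z := by
  set D := {t | DifferentiableAt ℝ Θ t}
  have hD : MeasurableSet D := measurableSet_of_differentiableAt ℝ Θ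
  have hDae : ∀ᵐ t, t ∈ D := hΘ.ae_differentiableAt
  have h := lintegral_image_eq_lintegral_deriv_mul_of_monotoneOn hD
    (fun t ht => (DifferentiableAt.hasDerivAt ht).hasDerivWithinAt) (hΘ.monotoneOn D) q
  rw [← setLIntegral_univ, ← setLIntegral_congr (eventuallyEq_univ.mpr hDae)]
  refine h.symm.trans_le ?_
  exact setLIntegral_le_lintegral _ _

lemma map_rotation_gaussianReal {a b : ℝ} (hab : a ^ 2 + b ^ 2 = 1) (ha : 0 ≤ a) (hb : 0 ≤ b) :
    MeasurePreserving (fun p : ℝ × ℝ => (b * p.1 + a * p.2, -a * p.1 + b * p.2))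
      ((gaussianReal 0 1).prod (gaussianReal 0 1)) ((gaussianReal 0 1).prod (gaussianReal 0 1)) := by
  refine ⟨by fun_prop, ?_⟩
  have hs : Real.sin (Real.arcsin a) = a := Real.sin_arcsin (by linarith) (by nlinarith)
  have hc : Real.cos (Real.arcsin a) = b := by
    rw [Real.cos_arcsin, show 1 - a ^ 2 = b ^ 2 by linarith, Real.sqrt_sq hb]
  have h := IsGaussian.map_rotation_eq_self_of_forall_strongDual_eq_zero
    (μ := gaussianReal 0 1)
    (fun L => by simp [integral_continuousLinearMap_gaussianReal]) (Real.arcsin a)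
  convert h using 2
  ext p <;> simp [ContinuousLinearMap.rotation_apply, hs, hc]

/-- The entropy gained by splitting unit variance in the proportions `l` and `1 - l`. -/
noncomputable def splitConst (l : ℝ) : ℝ := (l * Real.log l + (1 - l) * Real.log (1 - l)) / 2

lemma le_log_sqrt_mul_add {l u v : ℝ} (hl0 : 0 < l) (hl1 : l < 1) (hu : 0 < u) (hv : 0 < v) :
    l * Real.log u + (1 - l) * Real.log v - splitConst l ≤
      Real.log (√l * u + √(1 - l) * v) := by
  have ha : 0 < √l := Real.sqrt_pos.mpr hl0
  have hb : 0 < √(1 - l) := Real.sqrt_pos.mpr (by linarith)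
  have h := strictConcaveOn_log_Ioi.concaveOn.2 (x := u / √l) (y := v / √(1 - l))
    (div_pos hu ha) (div_pos hv hb) hl0.le (by linarith : 0 ≤ 1 - l) (by ring)
  have h1 : l • (u / √l) + (1 - l) • (v / √(1 - l)) = √l * u + √(1 - l) * v := by
    simp only [smul_eq_mul]
    have e1 : l = √l * √l := (Real.mul_self_sqrt hl0.le).symm
    have e2 : 1 - l = √(1 - l) * √(1 - l) := (Real.mul_self_sqrt (by linarith)).symm
    congr 1
    · nth_rewrite 1 [e1]; field_simp
    · nth_rewrite 1 [e2]; field_simp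
  rw [h1, Real.log_div hu.ne' ha.ne', Real.log_div hv.ne' hb.ne', Real.log_sqrt hl0.le,
    Real.log_sqrt (by linarith)] at h
  simp only [smul_eq_mul] at h
  refine le_trans (le_of_eq ?_) h
  unfold splitConst
  ring

lemma gaussianReal_eq_densityMeasure :
    gaussianReal 0 1 = densityMeasure (gaussianPDFReal 0 1) := by
  rw [gaussianReal_of_var_ne_zero _ one_ne_zero]; rfl

lemma integrable_log_gaussianPDFReal :
    Integrable (fun x => Real.log (gaussianPDFReal 0 1 x)) (gaussianReal 0 1) := by
  have h : (fun x => Real.log (gaussianPDFReal 0 1 x)) =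
      fun x : ℝ => Real.log (√(2 * Real.pi * (1 : NNReal)))⁻¹ + - (x ^ 2) / 2 := by
    ext x
    rw [gaussianPDFReal, Real.log_mul (by positivity) (by positivity), Real.log_exp]
    simp
  rw [h]
  have h2 : Integrable (fun x : ℝ => x ^ 2) (gaussianReal 0 1) :=
    (IsGaussian.memLp_two_id (μ := gaussianReal 0 1)).integrable_sq
  exact (integrable_const _).add (h2.neg.div_const 2)

lemma integral_densityMeasure {f : ℝ → ℝ} (hf : Measurable f) (hf0 : ∀ x, 0 ≤ f x) (u : ℝ → ℝ) :
    ∫ x, u x ∂(densityMeasure f) = ∫ x, f x * u x := by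
  rw [integral_withDensity_eq_integral_toReal_smul hf.ennreal_ofReal (by simp)]
  simp [ENNReal.toReal_ofReal (hf0 _)]

lemma integrable_densityMeasure_iff {f : ℝ → ℝ} (hf : Measurable f) (hf0 : ∀ x, 0 ≤ f x)
    (u : ℝ → ℝ) :
    Integrable u (densityMeasure f) ↔ Integrable fun x => f x * u x := by
  rw [integrable_withDensity_iff_integrable_smul' hf.ennreal_ofReal (by simp)]
  simp [ENNReal.toReal_ofReal (hf0 _)]

variable {f g q : ℝ → ℝ} {l Q : ℝ}

/-- The entropy power inequality on the line in variational form, by transport of a rotated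
Gaussian pair. -/
theorem integral_log_add_le (hl0 : 0 < l) (hl1 : l < 1)
    (hf : Measurable f) (hf0 : ∀ x, 0 ≤ f x) [IsProbabilityMeasure (densityMeasure f)]
    (hg : Measurable g) (hg0 : ∀ x, 0 ≤ g x) [IsProbabilityMeasure (densityMeasure g)]
    (hq : Measurable q) (hQ : 0 < Q) (hqQ : ∫⁻ z, ENNReal.ofReal (q z) ≤ ENNReal.ofReal Q)
    (hfi : Integrable fun x => f x * Real.log (f x))
    (hgi : Integrable fun x => g x * Real.log (g x))
    (hqpos : ∀ᵐ p ∂(densityMeasure f).prod (densityMeasure g), 0 < q (p.1 + p.2))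
    (hqi : Integrable (fun p : ℝ × ℝ => Real.log (q (p.1 + p.2)))
      ((densityMeasure f).prod (densityMeasure g))) :
    ∫ p : ℝ × ℝ, Real.log (q (p.1 + p.2)) ∂((densityMeasure f).prod (densityMeasure g)) ≤
      l * (∫ x, f x * Real.log (f x)) + (1 - l) * (∫ x, g x * Real.log (g x)) +
        splitConst l + Real.log Q := by
  set φ := gaussianPDFReal 0 1 with hφ
  have hφm : Measurable φ := measurable_gaussianPDFReal 0 1
  have hφ0 : ∀ x, 0 < φ x := fun x => gaussianPDFReal_pos 0 1 x one_ne_zero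
  set γ := gaussianReal 0 1 with hγ
  have hγφ : γ = densityMeasure φ := gaussianReal_eq_densityMeasure
  have : IsProbabilityMeasure (densityMeasure φ) := by rw [← hγφ]; infer_instance
  obtain ⟨T, hTm, hTmap, hTcdf⟩ := exists_strictMono_map_eq hf hf0 hφm hφ0
  obtain ⟨U, hUm, hUmap, hUcdf⟩ := exists_strictMono_map_eq hg hg0 hφm hφ0
  have hTae := ae_mul_deriv_eq hf hf0 hφm hφ0 hTm hTmap hTcdf
  have hUae := ae_mul_deriv_eq hg hg0 hφm hφ0 hUm hUmap hUcdf
  rw [← hγφ] at hTmap hUmap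
  have hγv : γ ≪ volume := gaussianReal_absolutelyContinuous 0 one_ne_zero
  have hvγ : volume ≪ γ := gaussianReal_absolutelyContinuous' 0 one_ne_zero
  replace hTae := hγv.ae_le hTae
  replace hUae := hγv.ae_le hUae
  have hTmeas := hTm.monotone.measurable
  have hUmeas := hUm.monotone.measurable
  set a := √l with ha
  set b := √(1 - l) with hb
  have ha0 : 0 < a := Real.sqrt_pos.mpr hl0
  have hb0 : 0 < b := Real.sqrt_pos.mpr (by linarith)
  have hab : a ^ 2 + b ^ 2 = 1 := by
    rw [ha, hb, Real.sq_sqrt hl0.le, Real.sq_sqrt (by linarith)]; ring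
  set R : ℝ × ℝ → ℝ × ℝ := fun p => (b * p.1 + a * p.2, -a * p.1 + b * p.2) with hR
  have hRmp : MeasurePreserving R (γ.prod γ) (γ.prod γ) :=
    map_rotation_gaussianReal hab ha0.le hb0.le
  have hTmp : MeasurePreserving T γ (densityMeasure f) := ⟨hTmeas, hTmap⟩
  have hUmp : MeasurePreserving U γ (densityMeasure g) := ⟨hUmeas, hUmap⟩
  have hΨmp := (hTmp.prod hUmp).comp hRmp
  have hXmp : MeasurePreserving (fun p => (R p).1) (γ.prod γ) γ :=
    measurePreserving_fst.comp hRmp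
  have hYmp : MeasurePreserving (fun p => (R p).2) (γ.prod γ) γ :=
    measurePreserving_snd.comp hRmp
  have hTae' := hXmp.quasiMeasurePreserving.ae hTae
  have hUae' := hYmp.quasiMeasurePreserving.ae hUae
  have hqpos' := hΨmp.quasiMeasurePreserving.ae hqpos
  -- the weight appearing in the change of variables
  set W : ℝ × ℝ → ℝ := fun p => (a * deriv T (R p).1 + b * deriv U (R p).2) *
    q (T (R p).1 + U (R p).2) / φ p.2 with hW
  have hWmeas : Measurable W := by
    have h1 := measurable_deriv T
    have h2 := measurable_deriv U
    have h3 := hRmp.measurable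
    fun_prop
  have hWint : ∫⁻ p, ENNReal.ofReal (W p) ∂(γ.prod γ) ≤ ENNReal.ofReal Q := by
    rw [lintegral_prod _ hWmeas.ennreal_ofReal.aemeasurable]
    have hslice : ∀ᵐ s ∂γ, ∫⁻ t, ENNReal.ofReal (W (s, t)) ∂γ ≤ ENNReal.ofReal Q := by
      filter_upwards [Measure.ae_ae_of_ae_prod hTae', Measure.ae_ae_of_ae_prod hUae'] with s h1 h2
      set Θ : ℝ → ℝ := fun t => T (R (s, t)).1 + U (R (s, t)).2 with hΘ
      have hΘm : Monotone Θ := by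
        intro t t' htt
        have e1 : b * s + a * t ≤ b * s + a * t' := by gcongr
        have e2 : -a * s + b * t ≤ -a * s + b * t' := by gcongr
        exact add_le_add (hTm.monotone e1) (hUm.monotone e2)
      refine le_trans ?_ ((lintegral_deriv_mul_comp_le hΘm fun z => ENNReal.ofReal (q z)).trans hqQ)
      rw [hγφ, lintegral_withDensity_eq_lintegral_mul _ hφm.ennreal_ofReal
        (by fun_prop)]
      refine lintegral_mono_ae ?_
      filter_upwards [hvγ.ae_le h1, hvγ.ae_le h2] with t ht1 ht2
      have hd : HasDerivAt Θ (a * deriv T (R (s, t)).1 + b * deriv U (R (s, t)).2) t := by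
        have d1 : HasDerivAt (fun t => b * s + a * t) a t := by
          simpa using ((hasDerivAt_id t).const_mul a).const_add (b * s)
        have d2 : HasDerivAt (fun t => -a * s + b * t) b t := by
          simpa using ((hasDerivAt_id t).const_mul b).const_add (-a * s)
        have e1 := HasDerivAt.comp t (h₂ := T) (ht1.1.hasDerivAt) d1
        have e2 := HasDerivAt.comp t (h₂ := U) (ht2.1.hasDerivAt) d2
        rw [mul_comm a, mul_comm b]
        exact e1.add e2
      rw [hd.deriv]
      simp only [Pi.mul_apply]
      have hnn : 0 ≤ a * deriv T (R (s, t)).1 + b * deriv U (R (s, t)).2 :=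
        (add_pos (mul_pos ha0 ht1.2.1) (mul_pos hb0 ht2.2.1)).le
      rw [← ENNReal.ofReal_mul (hφ0 t).le, ← ENNReal.ofReal_mul hnn]
      apply le_of_eq
      congr 1
      simp only [hW, hΘ]
      field_simp [(hφ0 t).ne']
    calc _ ≤ ∫⁻ _, ENNReal.ofReal Q ∂γ := lintegral_mono_ae hslice
      _ = _ := by simp
  have hW0 : 0 ≤ᵐ[γ.prod γ] W := by
    filter_upwards [hTae', hUae', hqpos'] with p h1 h2 h3
    have h3' : 0 < q (T (R p).1 + U (R p).2) := h3
    exact div_nonneg (mul_nonneg (add_pos (mul_pos ha0 h1.2.1) (mul_pos hb0 h2.2.1)).le h3'.le)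
      (hφ0 _).le
  have hWi : Integrable W (γ.prod γ) := by
    refine ⟨hWmeas.aestronglyMeasurable, ?_⟩
    rw [hasFiniteIntegral_iff_ofReal hW0]
    exact hWint.trans_lt ENNReal.ofReal_lt_top
  have hWle : ∫ p, W p ∂(γ.prod γ) ≤ Q := by
    rw [integral_eq_lintegral_of_nonneg_ae hW0 hWmeas.aestronglyMeasurable]
    exact ENNReal.toReal_le_of_le_ofReal hQ.le hWint
  -- transported integrals
  have hℓi := integrable_log_gaussianPDFReal
  set I := ∫ x, Real.log (φ x) ∂γ
  have hAi : Integrable (fun p => Real.log (f (T (R p).1))) (γ.prod γ) :=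
    (hTmp.comp hXmp).integrable_comp_of_integrable
      ((integrable_densityMeasure_iff hf hf0 fun x => Real.log (f x)).mpr hfi)
  have hBi : Integrable (fun p => Real.log (g (U (R p).2))) (γ.prod γ) :=
    (hUmp.comp hYmp).integrable_comp_of_integrable
      ((integrable_densityMeasure_iff hg hg0 fun x => Real.log (g x)).mpr hgi)
  have hℓt : Integrable (fun p : ℝ × ℝ => Real.log (φ p.2)) (γ.prod γ) :=
    measurePreserving_snd.integrable_comp_of_integrable hℓi
  have hℓx : Integrable (fun p : ℝ × ℝ => Real.log (φ (R p).1)) (γ.prod γ) :=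
    hXmp.integrable_comp_of_integrable hℓi
  have hℓy : Integrable (fun p : ℝ × ℝ => Real.log (φ (R p).2)) (γ.prod γ) :=
    hYmp.integrable_comp_of_integrable hℓi
  have hlogφ : Measurable fun x => Real.log (φ x) := hφm.log
  have key {α : Type} [MeasurableSpace α] {ν : Measure α} {Φ : ℝ × ℝ → α}
      (hΦ : MeasurePreserving Φ (γ.prod γ) ν) {u : α → ℝ} (hu : Measurable u) :
      ∫ p, u (Φ p) ∂(γ.prod γ) = ∫ x, u x ∂ν := by
    rw [← hΦ.map_eq, integral_map hΦ.measurable.aemeasurable hu.aestronglyMeasurable]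
  have eA : ∫ p, Real.log (f (T (R p).1)) ∂(γ.prod γ) = ∫ x, f x * Real.log (f x) := by
    exact (key (hTmp.comp hXmp) hf.log).trans (integral_densityMeasure hf hf0 _)
  have eB : ∫ p, Real.log (g (U (R p).2)) ∂(γ.prod γ) = ∫ x, g x * Real.log (g x) := by
    exact (key (hUmp.comp hYmp) hg.log).trans (integral_densityMeasure hg hg0 _)
  have et : ∫ p : ℝ × ℝ, Real.log (φ p.2) ∂(γ.prod γ) = I := key measurePreserving_snd hlogφ
  have ex : ∫ p : ℝ × ℝ, Real.log (φ (R p).1) ∂(γ.prod γ) = I := key hXmp hlogφ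
  have ey : ∫ p : ℝ × ℝ, Real.log (φ (R p).2) ∂(γ.prod γ) = I := key hYmp hlogφ
  have eL : ∫ p, Real.log (q (T (R p).1 + U (R p).2)) ∂(γ.prod γ) =
      ∫ p : ℝ × ℝ, Real.log (q (p.1 + p.2)) ∂((densityMeasure f).prod (densityMeasure g)) :=
    key hΨmp (u := fun p => Real.log (q (p.1 + p.2))) (by fun_prop)
  have hLi : Integrable (fun p => Real.log (q (T (R p).1 + U (R p).2))) (γ.prod γ) :=
    hΨmp.integrable_comp_of_integrable hqi
  have hbound : ∀ᵐ p ∂γ.prod γ, Real.log (q (T (R p).1 + U (R p).2)) ≤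
      W p / Q + (l * Real.log (f (T (R p).1)) + ((1 - l) * Real.log (g (U (R p).2)) +
        (Real.log (φ p.2) + (-l * Real.log (φ (R p).1) + (-(1 - l) * Real.log (φ (R p).2) +
          (splitConst l + Real.log Q - 1)))))) := by
    filter_upwards [hTae', hUae', hqpos'] with p ⟨_, hT', hfT, hTeq⟩ ⟨_, hU', hgU, hUeq⟩ h3
    have h3' : 0 < q (T (R p).1 + U (R p).2) := h3
    have hΘ' : 0 < a * deriv T (R p).1 + b * deriv U (R p).2 :=
      add_pos (mul_pos ha0 hT') (mul_pos hb0 hU')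
    have hWp : 0 < W p := div_pos (mul_pos hΘ' h3') (hφ0 _)
    have e1 := Real.log_le_sub_one_of_pos (div_pos hWp hQ)
    rw [Real.log_div hWp.ne' hQ.ne'] at e1
    simp only [hW] at e1 hWp ⊢
    rw [Real.log_div (mul_pos hΘ' h3').ne' (hφ0 _).ne', Real.log_mul hΘ'.ne' h3'.ne'] at e1
    have e2 := le_log_sqrt_mul_add hl0 hl1 hT' hU'
    have e3 : Real.log (φ (R p).1) = Real.log (f (T (R p).1)) + Real.log (deriv T (R p).1) := by
      rw [← hTeq, Real.log_mul hfT.ne' hT'.ne']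
    have e4 : Real.log (φ (R p).2) = Real.log (g (U (R p).2)) + Real.log (deriv U (R p).2) := by
      rw [← hUeq, Real.log_mul hgU.ne' hU'.ne']
    rw [e3, e4]
    linarith
  have i0 := integrable_const (μ := γ.prod γ) (splitConst l + Real.log Q - 1)
  have i1 := (hℓy.const_mul (-(1 - l))).add i0
  have i2 := (hℓx.const_mul (-l)).add i1
  have i3 := hℓt.add i2
  have i4 := (hBi.const_mul (1 - l)).add i3
  have i5 := (hAi.const_mul l).add i4
  have hmono := integral_mono_ae hLi ((hWi.div_const Q).add i5) hbound
  rw [eL] at hmono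
  refine hmono.trans ?_
  rw [integral_add' (hWi.div_const Q) i5, integral_add' (hAi.const_mul l) i4,
    integral_add' (hBi.const_mul (1 - l)) i3, integral_add' hℓt i2,
    integral_add' (hℓx.const_mul (-l)) i1, integral_add' (hℓy.const_mul (-(1 - l))) i0,
    integral_div, integral_const_mul, integral_const_mul, integral_const_mul,
    integral_const_mul, eA, eB, et, ex, ey]
  have : (∫ p, W p ∂(γ.prod γ)) / Q ≤ 1 := (div_le_one hQ).mpr hWle
  simp only [integral_const, probReal_univ, one_smul]
  linarith

end OneDim

section Bounded

/-- Bounded measurable real functions. -/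
def BoundedMeasurable {α : Type*} [MeasurableSpace α] (u : α → ℝ) : Prop :=
  Measurable u ∧ ∃ C, ∀ x, |u x| ≤ C

namespace BoundedMeasurable

variable {α β : Type*} [MeasurableSpace α] [MeasurableSpace β] {u v : α → ℝ}

lemma integrable (hu : BoundedMeasurable u) (μ : Measure α) [IsFiniteMeasure μ] :
    Integrable u μ := by
  obtain ⟨hm, C, hC⟩ := hu
  exact Integrable.of_bound hm.aestronglyMeasurable C (ae_of_all _ hC)

lemma mul (hu : BoundedMeasurable u) (hv : BoundedMeasurable v) :
    BoundedMeasurable fun x => u x * v x := by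
  obtain ⟨hm, C, hC⟩ := hu
  obtain ⟨hm', D, hD⟩ := hv
  refine ⟨hm.mul hm', C * D, fun x => ?_⟩
  rw [abs_mul]
  exact mul_le_mul (hC x) (hD x) (abs_nonneg _) ((abs_nonneg _).trans (hC x))

lemma comp {φ : β → α} (hu : BoundedMeasurable u) (hφ : Measurable φ) :
    BoundedMeasurable fun x => u (φ x) := by
  obtain ⟨hm, C, hC⟩ := hu
  exact ⟨hm.comp hφ, C, fun x => hC _⟩

lemma integral_right {w : α × β → ℝ} (hw : BoundedMeasurable w) (ν : Measure β)
    [IsFiniteMeasure ν] : BoundedMeasurable fun x => ∫ y, w (x, y) ∂ν := by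
  obtain ⟨hm, C, hC⟩ := hw
  refine ⟨hm.stronglyMeasurable.integral_prod_right'.measurable, C * ν.real univ, fun x => ?_⟩
  exact norm_integral_le_of_norm_le_const (f := fun y => w (x, y)) (ae_of_all _ fun y => hC (x, y))

lemma mul_log (hu : BoundedMeasurable u) : BoundedMeasurable fun x => u x * Real.log (u x) := by
  obtain ⟨hm, C, hC⟩ := hu
  obtain ⟨D, hD⟩ := (isCompact_Icc (a := -C) (b := C)).exists_bound_of_continuousOn
    Real.continuous_mul_log.continuousOn
  exact ⟨hm.mul hm.log, D, fun x => hD _ (abs_le.mp (hC x))⟩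

lemma log {δ : ℝ} (hu : BoundedMeasurable u) (hδ : 0 < δ) (h : ∀ x, δ ≤ u x) :
    BoundedMeasurable fun x => Real.log (u x) := by
  obtain ⟨hm, C, hC⟩ := hu
  refine ⟨hm.log, |Real.log δ| + |Real.log C|, fun x => ?_⟩
  have h1 := Real.log_le_log hδ (h x)
  have h2 := Real.log_le_log (hδ.trans_le (h x)) ((le_abs_self _).trans (hC x))
  rw [abs_le]
  constructor
  · linarith [neg_abs_le (Real.log δ), abs_nonneg (Real.log C)]
  · linarith [le_abs_self (Real.log C), abs_nonneg (Real.log δ)]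

end BoundedMeasurable

lemma integral_prod_prod_comm {α β : Type*} [MeasurableSpace α] [MeasurableSpace β]
    {μ : Measure α} {ν : Measure β} [IsFiniteMeasure μ] [IsFiniteMeasure ν]
    {K : (α × β) × (α × β) → ℝ} (hK : BoundedMeasurable K) :
    ∫ r, K r ∂((μ.prod ν).prod (μ.prod ν)) =
      ∫ p, ∫ s, K ((p.1, s.1), (p.2, s.2)) ∂(ν.prod ν) ∂(μ.prod μ) := by
  have h1 : BoundedMeasurable fun p : α × β => ∫ y, K (p, y) ∂(μ.prod ν) :=
    hK.integral_right _
  rw [integral_prod _ (hK.integrable _), integral_prod _ (h1.integrable _)]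
  have h2 : BoundedMeasurable fun p : α × α =>
      ∫ s, K ((p.1, s.1), (p.2, s.2)) ∂(ν.prod ν) :=
    BoundedMeasurable.integral_right
      (w := fun z : (α × α) × (β × β) => K ((z.1.1, z.2.1), (z.1.2, z.2.2)))
      (hK.comp (by fun_prop)) _
  rw [integral_prod _ (h2.integrable _)]
  refine integral_congr_ae (ae_of_all _ fun x => ?_)
  simp only
  have h3 : ∀ x', ∫ y, K ((x, x'), y) ∂(μ.prod ν) = ∫ y, ∫ y', K ((x, x'), (y, y')) ∂ν ∂μ :=
    fun x' => integral_prod _ ((hK.comp (φ := fun y => ((x, x'), y)) (by fun_prop)).integrable _)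
  have h4 : ∀ y, ∫ s, K ((x, s.1), (y, s.2)) ∂(ν.prod ν) =
      ∫ x', ∫ y', K ((x, x'), (y, y')) ∂ν ∂ν := fun y =>
    integral_prod (fun s : β × β => K ((x, s.1), (y, s.2)))
      ((hK.comp (φ := fun s : β × β => ((x, s.1), (y, s.2))) (by fun_prop)).integrable _)
  simp_rw [h3, h4]
  refine integral_integral_swap (f := fun x' y => ∫ y', K ((x, x'), (y, y')) ∂ν) ?_
  exact (BoundedMeasurable.integral_right
    (w := fun z : (β × α) × β => K ((x, z.1.1), (z.1.2, z.2)))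
    (hK.comp (by fun_prop)) ν).integrable _

end Bounded

section Tensorization

/-- A homogeneous form of the entropy power inequality, in its variational formulation, for
bounded densities with respect to a finite measure `μ` tested against densities with respect
to `ρ`. -/
def EntropyBound {E : Type*} [MeasurableSpace E] [Add E] (l c : ℝ) (μ ρ : Measure E) : Prop :=
  ∀ (f g q : E → ℝ) (δ : ℝ), BoundedMeasurable f → BoundedMeasurable g → BoundedMeasurable q →
    (∀ x, 0 ≤ f x) → (∀ x, 0 ≤ g x) → 0 < δ → (∀ x, δ ≤ q x) →
    ∫ p : E × E, f p.1 * g p.2 * Real.log (q (p.1 + p.2)) ∂(μ.prod μ) ≤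
      l * (∫ y, g y ∂μ) *
          ((∫ x, f x * Real.log (f x) ∂μ) - (∫ x, f x ∂μ) * Real.log (∫ x, f x ∂μ)) +
        (1 - l) * (∫ x, f x ∂μ) *
          ((∫ y, g y * Real.log (g y) ∂μ) - (∫ y, g y ∂μ) * Real.log (∫ y, g y ∂μ)) +
        (∫ x, f x ∂μ) * (∫ y, g y ∂μ) * (c + Real.log (∫ z, q z ∂ρ))

/-- Entropy bounds tensorize: their constants add up. -/
theorem EntropyBound.prod {E E' : Type*} [MeasurableSpace E] [MeasurableSpace E']
    [Add E] [Add E'] [MeasurableAdd₂ E] [MeasurableAdd₂ E'] {l c c' : ℝ}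
    {μ ρ : Measure E} {μ' ρ' : Measure E'} [IsFiniteMeasure μ] [IsFiniteMeasure ρ]
    [IsFiniteMeasure μ'] [IsFiniteMeasure ρ'] (hρ' : ρ' ≠ 0)
    (h : EntropyBound l c μ ρ) (h' : EntropyBound l c' μ' ρ') :
    EntropyBound l (c + c') (μ.prod μ') (ρ.prod ρ') := by
  intro f g q δ hf hg hq hf0 hg0 hδ hqδ
  have hf1 : BoundedMeasurable fun x => ∫ x', f (x, x') ∂μ' := hf.integral_right μ'
  have hg1 : BoundedMeasurable fun x => ∫ x', g (x, x') ∂μ' := hg.integral_right μ'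
  have hq1 : BoundedMeasurable fun x => ∫ x', q (x, x') ∂ρ' := hq.integral_right ρ'
  have hfl : BoundedMeasurable fun x => ∫ x', f (x, x') * Real.log (f (x, x')) ∂μ' :=
    hf.mul_log.integral_right μ'
  have hgl : BoundedMeasurable fun x => ∫ x', g (x, x') * Real.log (g (x, x')) ∂μ' :=
    hg.mul_log.integral_right μ'
  have hql : BoundedMeasurable fun p : (E × E') × (E × E') => Real.log (q (p.1 + p.2)) :=
    (hq.log hδ hqδ).comp (φ := fun p : (E × E') × (E × E') => (p.1.1 + p.2.1, p.1.2 + p.2.2))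
      (by fun_prop)
  have hK : BoundedMeasurable fun p : (E × E') × (E × E') =>
      f p.1 * g p.2 * Real.log (q (p.1 + p.2)) :=
    ((hf.comp measurable_fst).mul (hg.comp measurable_snd)).mul hql
  have eF : ∫ x, f x ∂(μ.prod μ') = ∫ x, ∫ x', f (x, x') ∂μ' ∂μ :=
    integral_prod _ (hf.integrable _)
  have eG : ∫ x, g x ∂(μ.prod μ') = ∫ x, ∫ x', g (x, x') ∂μ' ∂μ :=
    integral_prod _ (hg.integrable _)
  have eQ : ∫ x, q x ∂(ρ.prod ρ') = ∫ x, ∫ x', q (x, x') ∂ρ' ∂ρ :=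
    integral_prod _ (hq.integrable _)
  have eFl : ∫ x, f x * Real.log (f x) ∂(μ.prod μ') =
      ∫ x, ∫ x', f (x, x') * Real.log (f (x, x')) ∂μ' ∂μ :=
    integral_prod _ (hf.mul_log.integrable _)
  have eGl : ∫ x, g x * Real.log (g x) ∂(μ.prod μ') =
      ∫ x, ∫ x', g (x, x') * Real.log (g (x, x')) ∂μ' ∂μ :=
    integral_prod _ (hg.mul_log.integrable _)
  rw [eF, eG, eQ, eFl, eGl, integral_prod_prod_comm hK]
  set f₁ := fun x => ∫ x', f (x, x') ∂μ'
  set g₁ := fun x => ∫ x', g (x, x') ∂μ'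
  set q₁ := fun x => ∫ x', q (x, x') ∂ρ'
  set a := fun x => ∫ x', f (x, x') * Real.log (f (x, x')) ∂μ'
  set b := fun x => ∫ x', g (x, x') * Real.log (g (x, x')) ∂μ'
  have hf10 : ∀ x, 0 ≤ f₁ x := fun x => integral_nonneg fun _ => hf0 _
  have hg10 : ∀ x, 0 ≤ g₁ x := fun x => integral_nonneg fun _ => hg0 _
  have hρpos : 0 < ρ'.real univ := by
    rw [measureReal_def]
    exact ENNReal.toReal_pos (by simpa using hρ') (measure_ne_top _ _)
  have hδ' : 0 < δ * ρ'.real univ := mul_pos hδ hρpos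
  have hq1δ : ∀ x, δ * ρ'.real univ ≤ q₁ x := fun x => by
    have := integral_mono (μ := ρ') (integrable_const δ)
      ((hq.comp (φ := fun x' => (x, x')) (by fun_prop)).integrable ρ') fun x' => hqδ (x, x')
    simpa [mul_comm] using this
  have hfib : ∀ p : E × E, ∫ s : E' × E', f (p.1, s.1) * g (p.2, s.2) *
      Real.log (q ((p.1, s.1) + (p.2, s.2))) ∂(μ'.prod μ') ≤
      l * ((a p.1 - f₁ p.1 * Real.log (f₁ p.1)) * g₁ p.2) +
        ((1 - l) * (f₁ p.1 * (b p.2 - g₁ p.2 * Real.log (g₁ p.2))) +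
          (c' * (f₁ p.1 * g₁ p.2) + f₁ p.1 * g₁ p.2 * Real.log (q₁ (p.1 + p.2)))) := fun p => by
    refine (h' (fun x' => f (p.1, x')) (fun x' => g (p.2, x')) (fun x' => q (p.1 + p.2, x')) δ
      (hf.comp (by fun_prop)) (hg.comp (by fun_prop)) (hq.comp (by fun_prop))
      (fun _ => hf0 _) (fun _ => hg0 _) hδ (fun _ => hqδ _)).trans (le_of_eq ?_)
    simp only [a, b, f₁, g₁, q₁]
    ring
  have hql1 : BoundedMeasurable fun p : E × E => Real.log (q₁ (p.1 + p.2)) :=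
    (hq1.log hδ' hq1δ).comp (measurable_fst.add measurable_snd)
  have hu : Integrable (fun x => a x - f₁ x * Real.log (f₁ x)) μ :=
    (hfl.integrable μ).sub (hf1.mul_log.integrable μ)
  have hv : Integrable (fun x => b x - g₁ x * Real.log (g₁ x)) μ :=
    (hgl.integrable μ).sub (hg1.mul_log.integrable μ)
  have j4 : Integrable (fun p : E × E => f₁ p.1 * g₁ p.2 * Real.log (q₁ (p.1 + p.2)))
      (μ.prod μ) :=
    (((hf1.comp measurable_fst).mul (hg1.comp measurable_snd)).mul hql1).integrable _
  have j3 := (((hf1.integrable μ).mul_prod (hg1.integrable μ)).const_mul c').add j4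
  have j2 := (((hf1.integrable μ).mul_prod hv).const_mul (1 - l)).add j3
  have j0 := ((hu.mul_prod (hg1.integrable μ)).const_mul l)
  have j1 := j0.add j2
  have hKi : BoundedMeasurable fun p : E × E => ∫ s : E' × E', f (p.1, s.1) * g (p.2, s.2) *
      Real.log (q ((p.1, s.1) + (p.2, s.2))) ∂(μ'.prod μ') :=
    BoundedMeasurable.integral_right (w := fun z : (E × E) × (E' × E') =>
      f (z.1.1, z.2.1) * g (z.1.2, z.2.2) * Real.log (q ((z.1.1, z.2.1) + (z.1.2, z.2.2))))
      (hK.comp (φ := fun z : (E × E) × (E' × E') => ((z.1.1, z.2.1), (z.1.2, z.2.2)))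
        (by fun_prop)) _
  refine (integral_mono (hKi.integrable _) j1 hfib).trans ?_
  rw [integral_add' j0 j2, integral_add' (((hf1.integrable μ).mul_prod hv).const_mul (1 - l)) j3,
    integral_add' (((hf1.integrable μ).mul_prod (hg1.integrable μ)).const_mul c') j4,
    integral_const_mul, integral_const_mul, integral_const_mul,
    integral_prod_mul (fun x => a x - f₁ x * Real.log (f₁ x)) g₁,
    integral_prod_mul f₁ (fun x => b x - g₁ x * Real.log (g₁ x)), integral_prod_mul f₁ g₁,
    integral_sub (hfl.integrable μ) (hf1.mul_log.integrable μ),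
    integral_sub (hgl.integrable μ) (hg1.mul_log.integrable μ)]
  have hbase := h f₁ g₁ q₁ _ hf1 hg1 hq1 hf10 hg10 hδ' hq1δ
  refine (add_le_add_right (add_le_add_right (add_le_add_right hbase _) _) _).trans
    (le_of_eq ?_)
  ring

theorem EntropyBound.of_measurableEquiv {E E' : Type*} [MeasurableSpace E] [MeasurableSpace E']
    [Add E] [Add E'] {l c : ℝ} {μ ρ : Measure E} {μ' ρ' : Measure E'}
    [IsFiniteMeasure μ] [IsFiniteMeasure μ'] (e : E ≃ᵐ E')
    (he : ∀ x y, e.symm (x + y) = e.symm x + e.symm y)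
    (hμ : MeasurePreserving e μ μ') (hρ : MeasurePreserving e ρ ρ')
    (h : EntropyBound l c μ' ρ') : EntropyBound l c μ ρ := by
  intro f g q δ hf hg hq hf0 hg0 hδ hqδ
  have hμ' := hμ.symm e
  have hρ'' := hρ.symm e
  have := h (fun x => f (e.symm x)) (fun x => g (e.symm x)) (fun x => q (e.symm x)) δ
    (hf.comp e.symm.measurable) (hg.comp e.symm.measurable) (hq.comp e.symm.measurable)
    (fun _ => hf0 _) (fun _ => hg0 _) hδ (fun _ => hqδ _)
  simp_rw [he] at this
  rw [hμ'.integral_comp' f, hμ'.integral_comp' g, hρ''.integral_comp' q,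
    hμ'.integral_comp' (fun x => f x * Real.log (f x)),
    hμ'.integral_comp' (fun x => g x * Real.log (g x))] at this
  refine le_trans (le_of_eq ?_) this
  have hp := hμ'.prod hμ'
  exact (MeasurePreserving.integral_comp' (f := e.symm.prodCongr e.symm) hp
    (fun p : E × E => f p.1 * g p.2 * Real.log (q (p.1 + p.2)))).symm

theorem EntropyBound.pi {l c : ℝ} {μ ρ : Measure ℝ} [IsFiniteMeasure μ] [IsFiniteMeasure ρ]
    (hρ : ρ ≠ 0) (h : EntropyBound l c μ ρ) (n : ℕ) :
    EntropyBound l (n * c) (Measure.pi fun _ : Fin n => μ) (Measure.pi fun _ : Fin n => ρ) := by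
  induction n with
  | zero =>
    intro f g q δ hf hg hq hf0 hg0 hδ hqδ
    simp only [Measure.pi_of_empty _ (0 : Fin 0 → ℝ), Measure.dirac_prod_dirac]
    simp
  | succ n ih =>
    have hpi : (Measure.pi fun _ : Fin n => ρ) ≠ 0 := by
      rw [← Measure.measure_univ_ne_zero, Measure.pi_univ]
      exact Finset.prod_ne_zero_iff.mpr fun _ _ => by simpa using hρ
    have := EntropyBound.of_measurableEquiv (l := l) (c := c + n * c)
      (MeasurableEquiv.piFinSuccAbove (fun _ : Fin (n + 1) => ℝ) 0)
      (fun x y => by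
        simp only [MeasurableEquiv.piFinSuccAbove_symm_apply]
        ext i
        refine Fin.cases ?_ (fun j => ?_) i <;> simp [Fin.insertNthEquiv])
      (measurePreserving_piFinSuccAbove (fun _ : Fin (n + 1) => μ) 0)
      (measurePreserving_piFinSuccAbove (fun _ : Fin (n + 1) => ρ) 0)
      (h.prod hpi ih)
    convert this using 1
    push_cast; ring

end Tensorization

section Interval

variable {K : Set ℝ} {f : ℝ → ℝ} {F : ℝ}

/-- The probability density obtained by restricting `f` to `K` and dividing by its mass `F`. -/
noncomputable def normalized (K : Set ℝ) (F : ℝ) (f : ℝ → ℝ) : ℝ → ℝ :=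
  K.indicator fun x => f x / F

lemma measurable_normalized (hK : MeasurableSet K) (hf : Measurable f) :
    Measurable (normalized K F f) := (hf.div_const F).indicator hK

lemma normalized_nonneg (hf0 : ∀ x, 0 ≤ f x) (hF : 0 < F) (x : ℝ) : 0 ≤ normalized K F f x :=
  indicator_nonneg (fun x _ => div_nonneg (hf0 x) hF.le) x

lemma densityMeasure_normalized (hK : MeasurableSet K) :
    densityMeasure (normalized K F f) =
      (volume.restrict K).withDensity fun x => ENNReal.ofReal (f x / F) := by
  have h : (fun x => ENNReal.ofReal (normalized K F f x)) =
      K.indicator fun x => ENNReal.ofReal (f x / F) := by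
    funext x
    by_cases hx : x ∈ K <;> simp [normalized, hx]
  rw [← withDensity_indicator hK, ← h]

lemma isProbabilityMeasure_normalized [IsFiniteMeasure (volume.restrict K)]
    (hK : MeasurableSet K) (hf : BoundedMeasurable f)
    (hf0 : ∀ x, 0 ≤ f x) (hF : 0 < F) (hF' : ∫ x in K, f x = F) :
    IsProbabilityMeasure (densityMeasure (normalized K F f)) := by
  constructor
  rw [densityMeasure_normalized hK, withDensity_apply _ MeasurableSet.univ, setLIntegral_univ,
    ← ofReal_integral_eq_lintegral_ofReal ((hf.integrable _).div_const F)
      (ae_of_all _ fun x => div_nonneg (hf0 x) hF.le), integral_div, hF', div_self hF.ne']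
  simp

lemma normalized_mul_log (hF : 0 < F) :
    (fun x => normalized K F f x * Real.log (normalized K F f x)) =
      K.indicator fun x => (f x * Real.log (f x) - f x * Real.log F) / F := by
  ext x
  by_cases hx : x ∈ K
  · simp only [normalized, hx, indicator_of_mem]
    rcases eq_or_ne (f x) 0 with h | h
    · simp [h]
    · rw [Real.log_div h hF.ne']; ring
  · simp [normalized, hx]

lemma integrable_normalized_mul_log [IsFiniteMeasure (volume.restrict K)]
    (hK : MeasurableSet K) (hf : BoundedMeasurable f) (hF : 0 < F) :
    Integrable fun x => normalized K F f x * Real.log (normalized K F f x) := by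
  rw [normalized_mul_log hF, integrable_indicator_iff hK]
  exact ((hf.mul_log.integrable _).sub ((hf.integrable _).mul_const _)).div_const F

lemma integral_normalized_mul_log [IsFiniteMeasure (volume.restrict K)]
    (hK : MeasurableSet K) (hf : BoundedMeasurable f) (hF : 0 < F) (hF' : ∫ x in K, f x = F) :
    ∫ x, normalized K F f x * Real.log (normalized K F f x) =
      ((∫ x in K, f x * Real.log (f x)) - F * Real.log F) / F := by
  rw [normalized_mul_log hF, integral_indicator hK, integral_div,
    integral_sub (hf.mul_log.integrable _) ((hf.integrable _).mul_const _), integral_mul_const, hF']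

theorem entropyBound_Icc {l : ℝ} (hl0 : 0 < l) (hl1 : l < 1) {r : ℝ} (hr : 0 < r) :
    EntropyBound l (splitConst l) (volume.restrict (Icc (-r) r))
      (volume.restrict (Icc (-(2 * r)) (2 * r))) := by
  intro f g q δ hf hg hq hf0 hg0 hδ hqδ
  set K := Icc (-r) r
  set K₂ := Icc (-(2 * r)) (2 * r)
  have hK : MeasurableSet K := measurableSet_Icc
  have hK₂ : MeasurableSet K₂ := measurableSet_Icc
  set μ := (volume : Measure ℝ).restrict K with hμ
  have : IsFiniteMeasure μ := by rw [hμ]; infer_instance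
  set F := ∫ x, f x ∂μ with hF
  set G := ∫ x, g x ∂μ with hG
  have hF0 : 0 ≤ F := integral_nonneg hf0
  have hG0 : 0 ≤ G := integral_nonneg hg0
  have hzero : ∀ {u : ℝ → ℝ}, BoundedMeasurable u → (∀ x, 0 ≤ u x) → 0 = ∫ x, u x ∂μ →
      u =ᵐ[μ] 0 := fun hu hu0 h =>
    (integral_eq_zero_iff_of_nonneg hu0 (hu.integrable μ)).mp h.symm
  rcases hF0.eq_or_lt with hF' | hFpos
  · have h := hzero hf hf0 hF'
    have h1 : ∫ p : ℝ × ℝ, f p.1 * g p.2 * Real.log (q (p.1 + p.2)) ∂(μ.prod μ) = 0 := by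
      refine integral_eq_zero_of_ae ?_
      filter_upwards [Measure.quasiMeasurePreserving_fst.ae h] with p hp
      have hp' : f p.1 = 0 := hp
      simp [hp']
    have h2 : ∫ x, f x * Real.log (f x) ∂μ = 0 := by
      refine integral_eq_zero_of_ae ?_
      filter_upwards [h] with x hx
      simp [hx]
    rw [h1, h2, ← hF']; simp
  rcases hG0.eq_or_lt with hG' | hGpos
  · have h := hzero hg hg0 hG'
    have h1 : ∫ p : ℝ × ℝ, f p.1 * g p.2 * Real.log (q (p.1 + p.2)) ∂(μ.prod μ) = 0 := by
      refine integral_eq_zero_of_ae ?_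
      filter_upwards [Measure.quasiMeasurePreserving_snd.ae h] with p hp
      have hp' : g p.2 = 0 := hp
      simp [hp']
    have h2 : ∫ x, g x * Real.log (g x) ∂μ = 0 := by
      refine integral_eq_zero_of_ae ?_
      filter_upwards [h] with x hx
      simp [hx]
    rw [h1, h2, ← hG']; simp
  have := isProbabilityMeasure_normalized hK hf hf0 hFpos rfl
  have := isProbabilityMeasure_normalized hK hg hg0 hGpos rfl
  set Q := ∫ z in K₂, q z with hQ
  have hq0 : ∀ z, 0 < q z := fun z => hδ.trans_le (hqδ z)
  have hQpos : 0 < Q := by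
    have h1 : ∫ _ in K₂, δ ≤ Q := integral_mono (integrable_const δ) (hq.integrable _) hqδ
    refine lt_of_lt_of_le ?_ h1
    rw [setIntegral_const, measureReal_def, Real.volume_Icc, smul_eq_mul]
    refine mul_pos (ENNReal.toReal_pos ?_ ENNReal.ofReal_ne_top) hδ
    simp; linarith
  have hprod : (densityMeasure (normalized K F f)).prod (densityMeasure (normalized K G g)) =
      (μ.prod μ).withDensity fun p =>
        ENNReal.ofReal (f p.1 / F) * ENNReal.ofReal (g p.2 / G) := by
    rw [densityMeasure_normalized hK, densityMeasure_normalized hK]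
    exact prod_withDensity (hf.1.div_const F).ennreal_ofReal (hg.1.div_const G).ennreal_ofReal
  have hmemK : ∀ᵐ x ∂μ, x ∈ K := ae_restrict_mem hK
  have hind : ∀ᵐ p ∂(μ.prod μ), K₂.indicator q (p.1 + p.2) = q (p.1 + p.2) := by
    filter_upwards [Measure.quasiMeasurePreserving_fst.ae hmemK,
      Measure.quasiMeasurePreserving_snd.ae hmemK] with p h1 h2
    refine indicator_of_mem ?_ q
    exact ⟨by linarith [h1.1, h2.1], by linarith [h1.2, h2.2]⟩
  have hac := withDensity_absolutelyContinuous (μ.prod μ) fun p =>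
    ENNReal.ofReal (f p.1 / F) * ENNReal.ofReal (g p.2 / G)
  have hql : BoundedMeasurable fun p : ℝ × ℝ => Real.log (q (p.1 + p.2)) :=
    (hq.log hδ hqδ).comp (by fun_prop)
  have hmain := integral_log_add_le (f := normalized K F f) (g := normalized K G g)
    (q := K₂.indicator q) (Q := Q) hl0 hl1
    (measurable_normalized hK hf.1) (normalized_nonneg hf0 hFpos)
    (measurable_normalized hK hg.1) (normalized_nonneg hg0 hGpos)
    (hq.1.indicator hK₂) hQpos
    (by
      rw [hQ, ofReal_integral_eq_lintegral_ofReal (hq.integrable _)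
        (ae_of_all _ fun z => (hq0 z).le), ← lintegral_indicator hK₂]
      refine lintegral_mono fun z => ?_
      by_cases hz : z ∈ K₂ <;> simp [hz])
    (integrable_normalized_mul_log hK hf hFpos)
    (integrable_normalized_mul_log hK hg hGpos)
    (by
      rw [hprod]
      filter_upwards [hac.ae_le hind] with p hp
      rw [hp]; exact hq0 _)
    (by
      refine (hql.integrable _).congr ?_
      rw [hprod]
      filter_upwards [hac.ae_le hind] with p hp
      rw [hp])
  have hdm : Measurable fun p : ℝ × ℝ =>
      ENNReal.ofReal (f p.1 / F) * ENNReal.ofReal (g p.2 / G) := by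
    have := hf.1
    have := hg.1
    fun_prop
  rw [integral_normalized_mul_log hK hf hFpos rfl, integral_normalized_mul_log hK hg hGpos rfl,
    hprod, integral_withDensity_eq_integral_toReal_smul hdm
      (ae_of_all _ fun p => ENNReal.mul_lt_top ENNReal.ofReal_lt_top ENNReal.ofReal_lt_top)] at hmain
  have hL : ∫ p : ℝ × ℝ, (ENNReal.ofReal (f p.1 / F) * ENNReal.ofReal (g p.2 / G)).toReal •
      Real.log (K₂.indicator q (p.1 + p.2)) ∂(μ.prod μ) =
      (∫ p : ℝ × ℝ, f p.1 * g p.2 * Real.log (q (p.1 + p.2)) ∂(μ.prod μ)) / (F * G) := by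
    rw [← integral_div]
    refine integral_congr_ae ?_
    filter_upwards [hind] with p hp
    rw [hp, ENNReal.toReal_mul, ENNReal.toReal_ofReal (div_nonneg (hf0 _) hF0),
      ENNReal.toReal_ofReal (div_nonneg (hg0 _) hG0), smul_eq_mul]
    field_simp
  rw [hL, div_le_iff₀ (mul_pos hFpos hGpos)] at hmain
  refine hmain.trans (le_of_eq ?_)
  field_simp
  ring

end Interval

section Truncation

/-- The cube `[-r, r]ⁿ`. -/
def cube (n : ℕ) (r : ℝ) : Set (Fin n → ℝ) := univ.pi fun _ => Icc (-r) r

lemma measurableSet_cube (n : ℕ) (r : ℝ) : MeasurableSet (cube n r) :=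
  MeasurableSet.univ_pi fun _ => measurableSet_Icc

lemma eventually_mem_cube {n : ℕ} (x : Fin n → ℝ) : ∀ᶠ k : ℕ in atTop, x ∈ cube n (k + 1) := by
  filter_upwards [eventually_ge_atTop ⌈‖x‖⌉₊] with k hk i _
  have h1 : ‖x‖ ≤ k := (Nat.le_ceil _).trans (by exact_mod_cast hk)
  have h2 : |x i| ≤ ‖x‖ := norm_le_pi_norm x i
  exact abs_le.mp (by linarith)

lemma volume_restrict_cube (n : ℕ) (r : ℝ) :
    (volume : Measure (Fin n → ℝ)).restrict (cube n r) =
      Measure.pi fun _ => volume.restrict (Icc (-r) r) := by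
  rw [cube, volume_pi, Measure.restrict_pi_pi]

lemma isFiniteMeasure_restrict_cube (n : ℕ) (r : ℝ) :
    IsFiniteMeasure ((volume : Measure (Fin n → ℝ)).restrict (cube n r)) := by
  rw [volume_restrict_cube]; infer_instance

theorem entropyBound_cube {l : ℝ} (hl0 : 0 < l) (hl1 : l < 1) (n : ℕ) {r : ℝ} (hr : 0 < r) :
    EntropyBound l (n * splitConst l) (volume.restrict (cube n r))
      (volume.restrict (cube n (2 * r))) := by
  rw [volume_restrict_cube, volume_restrict_cube]
  refine (entropyBound_Icc hl0 hl1 hr).pi ?_ n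
  rw [Ne, Measure.restrict_eq_zero, Real.volume_Icc, ENNReal.ofReal_eq_zero]
  linarith

/-- The function equal to `u` where `u ≤ r` and to `0` elsewhere. -/
noncomputable def truncate {α : Type*} (r : ℝ) (u : α → ℝ) (x : α) : ℝ :=
  if u x ≤ r then u x else 0

variable {α : Type*} {u : α → ℝ}

lemma truncate_nonneg (hu : ∀ x, 0 ≤ u x) (r : ℝ) (x : α) : 0 ≤ truncate r u x := by
  unfold truncate
  split_ifs
  exacts [hu x, le_rfl]

lemma truncate_le (hu : ∀ x, 0 ≤ u x) (r : ℝ) (x : α) : truncate r u x ≤ u x := by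
  unfold truncate
  split_ifs
  exacts [le_rfl, hu x]

lemma boundedMeasurable_truncate [MeasurableSpace α] (hm : Measurable u) (hu : ∀ x, 0 ≤ u x)
    {r : ℝ} (hr : 0 ≤ r) : BoundedMeasurable (truncate r u) := by
  refine ⟨Measurable.ite (measurableSet_le hm measurable_const) hm measurable_const, r,
    fun x => ?_⟩
  rw [abs_of_nonneg (truncate_nonneg hu r x)]
  unfold truncate
  split_ifs with h
  exacts [h, hr]

lemma eventually_le_add_one (a : ℝ) : ∀ᶠ k : ℕ in atTop, a ≤ (k : ℝ) + 1 := by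
  filter_upwards [eventually_ge_atTop ⌈a⌉₊] with k hk
  have h1 : a ≤ k := (Nat.le_ceil _).trans (by exact_mod_cast hk)
  linarith

lemma eventually_truncate_eq (x : α) : ∀ᶠ k : ℕ in atTop, truncate (k + 1) u x = u x := by
  filter_upwards [eventually_le_add_one (u x)] with k hk
  exact if_pos hk

lemma tendsto_integral_truncate {n : ℕ} {u : (Fin n → ℝ) → ℝ} {φ : ℝ → ℝ} (hφ : Measurable φ)
    (hφ0 : φ 0 = 0) (hm : Measurable u) (hu : ∀ x, 0 ≤ u x) (hi : Integrable fun x => φ (u x)) :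
    Tendsto (fun k : ℕ => ∫ x in cube n (k + 1), φ (truncate (k + 1) u x)) atTop
      (𝓝 (∫ x, φ (u x))) := by
  simp_rw [← integral_indicator (measurableSet_cube n _)]
  refine tendsto_integral_of_dominated_convergence (fun x => |φ (u x)|) (fun k => ?_) hi.abs
    (fun k => ae_of_all _ fun x => ?_) (ae_of_all _ fun x => ?_)
  · exact ((hφ.comp (boundedMeasurable_truncate hm hu (by positivity)).1).indicator
      (measurableSet_cube n _)).aestronglyMeasurable
  · refine (norm_indicator_le_norm_self _ _).trans ?_
    rw [Real.norm_eq_abs, truncate]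
    split_ifs
    · exact le_rfl
    · simp [hφ0]
  · refine tendsto_const_nhds.congr' ?_
    filter_upwards [eventually_mem_cube x, eventually_truncate_eq (u := u) x] with k h1 h2
    rw [indicator_of_mem h1, h2]

lemma abs_log_clamp_le {a r δ : ℝ} (ha : 0 < a) (hδ1 : δ ≤ 1) (hr : 1 ≤ r) :
    |Real.log (max (min a r) δ)| ≤ |Real.log a| := by
  rcases le_total 1 a with h | h
  · have h1 : 1 ≤ max (min a r) δ := le_max_of_le_left (le_min h hr)
    rw [abs_of_nonneg (Real.log_nonneg h1), abs_of_nonneg (Real.log_nonneg h)]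
    exact Real.log_le_log (by linarith) (max_le (min_le_left _ _) (hδ1.trans h))
  · have h1 : a ≤ max (min a r) δ := le_max_of_le_left (le_min le_rfl (h.trans hr))
    have h2 : max (min a r) δ ≤ 1 := max_le ((min_le_left _ _).trans h) hδ1
    rw [abs_of_nonpos (Real.log_nonpos (ha.le.trans h1) h2),
      abs_of_nonpos (Real.log_nonpos ha.le h)]
    exact neg_le_neg (Real.log_le_log ha h1)

end Truncation

section Limit

variable {n : ℕ} {f g h : (Fin n → ℝ) → ℝ}

/-- If `h` is the convolution of the densities `f` and `g`, then integrals against `h` are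
integrals of `w (x + y)` against `f ⊗ g`. -/
lemma integrable_integral_add (hf : Measurable f) (hg : Measurable g) (hh : Measurable h)
    (hf0 : ∀ x, 0 ≤ f x) (hg0 : ∀ x, 0 ≤ g x) (hh0 : ∀ x, 0 ≤ h x)
    (hconv : ((volume.prod volume).withDensity fun p : (Fin n → ℝ) × (Fin n → ℝ) =>
        ENNReal.ofReal (f p.1) * ENNReal.ofReal (g p.2)).map (fun p => p.1 + p.2) =
      volume.withDensity fun z => ENNReal.ofReal (h z))
    {w : (Fin n → ℝ) → ℝ} (hw : Measurable w) (hi : Integrable fun z => h z * w z) :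
    Integrable (fun p : (Fin n → ℝ) × (Fin n → ℝ) => f p.1 * g p.2 * w (p.1 + p.2))
        (volume.prod volume) ∧
      ∫ p : (Fin n → ℝ) × (Fin n → ℝ), f p.1 * g p.2 * w (p.1 + p.2) ∂(volume.prod volume) =
        ∫ z, h z * w z := by
  have hdm : Measurable fun p : (Fin n → ℝ) × (Fin n → ℝ) =>
      ENNReal.ofReal (f p.1) * ENNReal.ofReal (g p.2) := by fun_prop
  have hdt : ∀ᵐ p ∂((volume : Measure (Fin n → ℝ)).prod (volume : Measure (Fin n → ℝ))),
      ENNReal.ofReal (f p.1) * ENNReal.ofReal (g p.2) < ⊤ :=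
    ae_of_all _ fun p => ENNReal.mul_lt_top ENNReal.ofReal_lt_top ENNReal.ofReal_lt_top
  have hadd : Measurable fun p : (Fin n → ℝ) × (Fin n → ℝ) => p.1 + p.2 := by fun_prop
  have hsm : ∀ p : (Fin n → ℝ) × (Fin n → ℝ),
      (ENNReal.ofReal (f p.1) * ENNReal.ofReal (g p.2)).toReal • w (p.1 + p.2) =
        f p.1 * g p.2 * w (p.1 + p.2) := fun p => by
    rw [ENNReal.toReal_mul, ENNReal.toReal_ofReal (hf0 _), ENNReal.toReal_ofReal (hg0 _),
      smul_eq_mul]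
  have hsm' : ∀ z, (ENNReal.ofReal (h z)).toReal • w z = h z * w z := fun z => by
    rw [ENNReal.toReal_ofReal (hh0 _), smul_eq_mul]
  constructor
  · simp_rw [← hsm]
    rw [← integrable_withDensity_iff_integrable_smul' hdm hdt]
    refine (integrable_map_measure hw.aestronglyMeasurable hadd.aemeasurable).mp ?_
    rw [hconv, integrable_withDensity_iff_integrable_smul' hh.ennreal_ofReal
        (ae_of_all _ fun z => ENNReal.ofReal_lt_top)]
    simpa only [hsm'] using hi
  · simp_rw [← hsm]
    rw [← integral_withDensity_eq_integral_toReal_smul hdm hdt,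
      ← integral_map hadd.aemeasurable hw.aestronglyMeasurable, hconv,
      integral_withDensity_eq_integral_toReal_smul hh.ennreal_ofReal
        (ae_of_all _ fun z => ENNReal.ofReal_lt_top)]
    simp_rw [hsm']

lemma ae_pos_add (hf : Measurable f) (hg : Measurable g) (hh : Measurable h)
    (hconv : ((volume.prod volume).withDensity fun p : (Fin n → ℝ) × (Fin n → ℝ) =>
        ENNReal.ofReal (f p.1) * ENNReal.ofReal (g p.2)).map (fun p => p.1 + p.2) =
      volume.withDensity fun z => ENNReal.ofReal (h z)) :
    ∀ᵐ p ∂((volume : Measure (Fin n → ℝ)).prod (volume : Measure (Fin n → ℝ))),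
      0 < f p.1 → 0 < g p.2 → 0 < h (p.1 + p.2) := by
  have hdm : Measurable fun p : (Fin n → ℝ) × (Fin n → ℝ) =>
      ENNReal.ofReal (f p.1) * ENNReal.ofReal (g p.2) := by fun_prop
  have hadd : Measurable fun p : (Fin n → ℝ) × (Fin n → ℝ) => p.1 + p.2 := by fun_prop
  have h1 : ∀ᵐ z ∂((volume : Measure (Fin n → ℝ)).withDensity fun z => ENNReal.ofReal (h z)),
      0 < h z := by
    rw [ae_withDensity_iff hh.ennreal_ofReal]
    refine ae_of_all _ fun z hz => ?_
    simpa using hz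
  rw [← hconv] at h1
  have h2 := ae_of_ae_map hadd.aemeasurable h1
  rw [ae_withDensity_iff hdm] at h2
  filter_upwards [h2] with p hp hp1 hp2
  refine hp (mul_ne_zero ?_ ?_) <;> simpa

/-- The entropy power inequality in `ℝⁿ`, linearized with weight `l`. -/
theorem integral_mul_log_le {l : ℝ} (hl0 : 0 < l) (hl1 : l < 1)
    (hf : Measurable f) (hg : Measurable g) (hh : Measurable h)
    (hf0 : ∀ x, 0 ≤ f x) (hg0 : ∀ x, 0 ≤ g x) (hh0 : ∀ x, 0 ≤ h x)
    (hconv : ((volume.prod volume).withDensity fun p : (Fin n → ℝ) × (Fin n → ℝ) =>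
        ENNReal.ofReal (f p.1) * ENNReal.ofReal (g p.2)).map (fun p => p.1 + p.2) =
      volume.withDensity fun z => ENNReal.ofReal (h z))
    (hf1 : Integrable f) (hg1 : Integrable g) (hh1 : Integrable h)
    (hf1' : ∫ x, f x = 1) (hg1' : ∫ x, g x = 1) (hh1' : ∫ x, h x = 1)
    (hfi : Integrable fun x => f x * Real.log (f x))
    (hgi : Integrable fun x => g x * Real.log (g x))
    (hhi : Integrable fun x => h x * Real.log (h x)) :
    ∫ z, h z * Real.log (h z) ≤ l * (∫ x, f x * Real.log (f x)) +
      (1 - l) * (∫ x, g x * Real.log (g x)) + n * splitConst l := by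
  obtain ⟨hint, heq⟩ := integrable_integral_add hf hg hh hf0 hg0 hh0 hconv hh.log hhi
  have hpos := ae_pos_add hf hg hh hconv
  set V : ℕ → ℝ := fun k => (volume : Measure (Fin n → ℝ)).real (cube n (2 * (k + 1)))
  set δ : ℕ → ℝ := fun k => 1 / (k + 1) / (1 + V k)
  have hV : ∀ k, 0 ≤ V k := fun k => measureReal_nonneg
  have hk0 : ∀ k : ℕ, (0 : ℝ) < 1 / (k + 1) := fun k => by positivity
  have hδ0 : ∀ k, 0 < δ k := fun k => div_pos (hk0 k) (by linarith [hV k])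
  have hδk : ∀ k : ℕ, δ k ≤ 1 / (k + 1) := fun k =>
    div_le_self (hk0 k).le (by linarith [hV k])
  have hδ1 : ∀ k, δ k ≤ 1 := fun k => (hδk k).trans <| by
    rw [div_le_one (by positivity)]; linarith [k.cast_nonneg (α := ℝ)]
  have hδV : ∀ k : ℕ, δ k * V k ≤ 1 / (k + 1) := fun k => by
    have := hV k
    rw [div_mul_eq_mul_div, div_le_iff₀ (by linarith)]
    exact mul_le_mul_of_nonneg_left (by linarith) (hk0 k).le
  set q : ℕ → (Fin n → ℝ) → ℝ := fun k z => max (min (h z) (k + 1)) (δ k)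
  have hqm : ∀ k, Measurable (q k) := fun k => (hh.min measurable_const).max measurable_const
  have hq0 : ∀ k z, 0 < q k z := fun k z => (hδ0 k).trans_le (le_max_right _ _)
  have hqb : ∀ k, BoundedMeasurable (q k) := fun k => by
    refine ⟨hqm k, k + 1, fun z => ?_⟩
    rw [abs_of_pos (hq0 k z)]
    exact max_le (min_le_right _ _) ((hδ1 k).trans (by linarith [k.cast_nonneg (α := ℝ)]))
  have hQ : ∀ k : ℕ, Real.log (∫ z in cube n (2 * (k + 1)), q k z) ≤ 1 / (k + 1) := fun k => by
    have := isFiniteMeasure_restrict_cube n (2 * ((k : ℝ) + 1))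
    have hle : ∫ z in cube n (2 * (k + 1)), q k z ≤ 1 + 1 / (k + 1) := by
      calc ∫ z in cube n (2 * (k + 1)), q k z
          ≤ ∫ z in cube n (2 * (k + 1)), (h z + δ k) := by
            refine integral_mono ((hqb k).integrable _)
              (hh1.integrableOn.add (integrable_const _)) fun z => ?_
            exact max_le ((min_le_left _ _).trans (by linarith [hδ0 k])) (by linarith [hh0 z])
        _ = (∫ z in cube n (2 * (k + 1)), h z) + V k * δ k := by
            rw [integral_add hh1.integrableOn (integrable_const _), setIntegral_const, smul_eq_mul]
        _ ≤ 1 + 1 / (k + 1) := by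
            refine add_le_add ?_ ((mul_comm _ _).trans_le (hδV k))
            rw [← hh1']
            exact setIntegral_le_integral hh1 (ae_of_all _ hh0)
    rcases (integral_nonneg fun z => (hq0 k z).le :
      0 ≤ ∫ z in cube n (2 * ((k : ℝ) + 1)), q k z).eq_or_lt with h0 | h0
    · rw [← h0, Real.log_zero]; exact (hk0 k).le
    · linarith [Real.log_le_sub_one_of_pos h0]
  have hF := tendsto_integral_truncate measurable_id rfl hf hf0 hf1
  have hG := tendsto_integral_truncate measurable_id rfl hg hg0 hg1
  have hmlog : Measurable fun x : ℝ => x * Real.log x := Real.continuous_mul_log.measurable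
  have hA := tendsto_integral_truncate hmlog (by simp) hf hf0 hfi
  have hB := tendsto_integral_truncate hmlog (by simp) hg hg0 hgi
  simp only [id_eq, hf1', hg1'] at hF hG
  have hFl := (Real.continuous_mul_log.tendsto 1).comp hF
  have hGl := (Real.continuous_mul_log.tendsto 1).comp hG
  simp only [Real.log_one, mul_zero, Function.comp_def] at hFl hGl
  have hR := (((hG.const_mul l).mul (hA.sub hFl)).add
    ((hF.const_mul (1 - l)).mul (hB.sub hGl))).add
    ((hF.mul hG).mul (tendsto_one_div_add_atTop_nhds_zero_nat.const_add (n * splitConst l)))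
  have hL : Tendsto (fun k : ℕ => ∫ p : (Fin n → ℝ) × (Fin n → ℝ),
      truncate (k + 1) f p.1 * truncate (k + 1) g p.2 * Real.log (q k (p.1 + p.2))
        ∂((volume.restrict (cube n (k + 1))).prod (volume.restrict (cube n (k + 1)))))
      atTop (𝓝 (∫ z, h z * Real.log (h z))) := by
    rw [← heq]
    simp_rw [Measure.prod_restrict,
      ← integral_indicator ((measurableSet_cube n _).prod (measurableSet_cube n _))]
    have htm : ∀ {u : (Fin n → ℝ) → ℝ}, Measurable u → (∀ x, 0 ≤ u x) → ∀ k : ℕ,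
        Measurable (truncate (k + 1) u) := fun hu hu0 k =>
      (boundedMeasurable_truncate hu hu0 (by positivity)).1
    refine tendsto_integral_of_dominated_convergence
      (fun p => |f p.1 * g p.2 * Real.log (h (p.1 + p.2))|) (fun k => ?_) hint.abs
      (fun k => ?_) ?_
    · refine (Measurable.indicator ?_
        ((measurableSet_cube n _).prod (measurableSet_cube n _))).aestronglyMeasurable
      have := htm hf hf0 k
      have := htm hg hg0 k
      have := (hqm k).log
      fun_prop
    · filter_upwards [hpos] with p hp
      refine (norm_indicator_le_norm_self _ _).trans ?_
      rw [Real.norm_eq_abs, abs_mul, abs_mul, abs_mul, abs_mul,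
        abs_of_nonneg (truncate_nonneg hf0 _ _), abs_of_nonneg (truncate_nonneg hg0 _ _),
        abs_of_nonneg (hf0 _), abs_of_nonneg (hg0 _)]
      rcases (hf0 p.1).eq_or_lt with h0 | h0
      · simp [truncate, ← h0]
      rcases (hg0 p.2).eq_or_lt with h0' | h0'
      · simp [truncate, ← h0']
      exact mul_le_mul (mul_le_mul (truncate_le hf0 _ _) (truncate_le hg0 _ _)
        (truncate_nonneg hg0 _ _) (hf0 _))
        (abs_log_clamp_le (hp h0 h0') (hδ1 k) (by linarith [k.cast_nonneg (α := ℝ)]))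
        (abs_nonneg _) (mul_nonneg (hf0 _) (hg0 _))
    · filter_upwards [hpos] with p hp
      rcases (hf0 p.1).eq_or_lt with h0 | h0
      · refine tendsto_const_nhds.congr fun k => ?_
        rw [← h0, zero_mul, zero_mul]
        exact (indicator_apply_eq_zero.mpr fun _ => by simp [truncate, ← h0]).symm
      rcases (hg0 p.2).eq_or_lt with h0' | h0'
      · refine tendsto_const_nhds.congr fun k => ?_
        rw [← h0', mul_zero, zero_mul]
        exact (indicator_apply_eq_zero.mpr fun _ => by simp [truncate, ← h0']).symm
      refine tendsto_const_nhds.congr' ?_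
      filter_upwards [eventually_mem_cube p.1, eventually_mem_cube p.2,
        eventually_truncate_eq (u := f) p.1, eventually_truncate_eq (u := g) p.2,
        eventually_le_add_one (h (p.1 + p.2)),
        tendsto_one_div_add_atTop_nhds_zero_nat.eventually_le_const (hp h0 h0')]
        with k h1 h2 h3 h4 h5 h6
      have h7 : q k (p.1 + p.2) = h (p.1 + p.2) := by
        simp only [q]
        rw [min_eq_left h5, max_eq_left ((hδk k).trans h6)]
      rw [indicator_of_mem (mk_mem_prod h1 h2), h3, h4, h7]
  refine (le_of_tendsto_of_tendsto' hL hR fun k => ?_).trans (le_of_eq (by ring))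
  refine (entropyBound_cube hl0 hl1 n (by positivity) _ _ _ (δ k)
    (boundedMeasurable_truncate hf hf0 (by positivity))
    (boundedMeasurable_truncate hg hg0 (by positivity)) (hqb k)
    (truncate_nonneg hf0 _) (truncate_nonneg hg0 _) (hδ0 k) fun z => le_max_right _ _).trans ?_
  refine add_le_add le_rfl (mul_le_mul_of_nonneg_left (add_le_add le_rfl (hQ k)) ?_)
  exact mul_nonneg (integral_nonneg (truncate_nonneg hf0 _))
    (integral_nonneg (truncate_nonneg hg0 _))

lemma integral_eq_one_of_isProbabilityMeasure (hf : Measurable f) (hf0 : ∀ x, 0 ≤ f x)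
    [IsProbabilityMeasure (volume.withDensity fun x => ENNReal.ofReal (f x))] :
    Integrable f ∧ ∫ x, f x = 1 := by
  have h1 : ∫⁻ x, ENNReal.ofReal (f x) = 1 := by
    rw [← setLIntegral_univ, ← withDensity_apply _ MeasurableSet.univ, measure_univ]
  constructor
  · refine ⟨hf.aestronglyMeasurable, ?_⟩
    rw [hasFiniteIntegral_iff_ofReal (ae_of_all _ hf0), h1]
    exact ENNReal.one_lt_top
  · rw [integral_eq_lintegral_of_nonneg_ae (ae_of_all _ hf0) hf.aestronglyMeasurable, h1,
      ENNReal.toReal_one]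

lemma exp_add_exp_le {a b s : ℝ}
    (H : ∀ l, 0 < l → l < 1 → l * a + (1 - l) * b - 2 * splitConst l ≤ s) :
    Real.exp a + Real.exp b ≤ Real.exp s := by
  set T := Real.exp a + Real.exp b with hT
  have ha := Real.exp_pos a
  have hb := Real.exp_pos b
  have hTpos : 0 < T := add_pos ha hb
  have h1 : 1 - Real.exp a / T = Real.exp b / T := by
    field_simp; rw [hT]; ring
  have h := H (Real.exp a / T) (div_pos ha hTpos) (by rw [div_lt_one hTpos]; linarith)
  rw [splitConst, h1, Real.log_div ha.ne' hTpos.ne', Real.log_div hb.ne' hTpos.ne',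
    Real.log_exp, Real.log_exp] at h
  rw [← Real.log_le_iff_le_exp hTpos]
  have h2 : Real.exp a / T + Real.exp b / T = 1 := by linarith
  linear_combination h - Real.log T * h2

end Limit

end EntropyPower

/-- Entropy Power Inequality: if `X, Y : Ω → ℝ^n` are independent random vectors whose
laws have densities `f`, `g` with respect to Lebesgue measure, `h` is a density of the
law of `X + Y`, and `f ln f`, `g ln g`, `h ln h` are integrable, then with
`S(Z) = −∫ density·ln density` one has
`exp(2 S(X+Y)/n) ≥ exp(2 S(X)/n) + exp(2 S(Y)/n)`. -/
theorem entropy_power_inequality {Ω : Type*} [MeasureSpace Ω]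
    [IsProbabilityMeasure (ℙ : Measure Ω)] {n : ℕ} (hn : 0 < n)
    (X Y : Ω → (Fin n → ℝ)) (hX : Measurable X) (hY : Measurable Y)
    (hindep : IndepFun X Y ℙ)
    (f g h : (Fin n → ℝ) → ℝ)
    (hf : Measurable f) (hg : Measurable g) (hh : Measurable h)
    (hf0 : ∀ x, 0 ≤ f x) (hg0 : ∀ x, 0 ≤ g x) (hh0 : ∀ x, 0 ≤ h x)
    (hfd : Measure.map X ℙ = volume.withDensity fun x => ENNReal.ofReal (f x))
    (hgd : Measure.map Y ℙ = volume.withDensity fun x => ENNReal.ofReal (g x))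
    (hhd : Measure.map (X + Y) ℙ = volume.withDensity fun x => ENNReal.ofReal (h x))
    (hfi : Integrable (fun x => f x * Real.log (f x)) volume)
    (hgi : Integrable (fun x => g x * Real.log (g x)) volume)
    (hhi : Integrable (fun x => h x * Real.log (h x)) volume) :
    Real.exp (2 * (-∫ x, h x * Real.log (h x)) / n) ≥
      Real.exp (2 * (-∫ x, f x * Real.log (f x)) / n) +
        Real.exp (2 * (-∫ x, g x * Real.log (g x)) / n) := by
  have hconv : ((volume.prod volume).withDensity fun p : (Fin n → ℝ) × (Fin n → ℝ) =>
        ENNReal.ofReal (f p.1) * ENNReal.ofReal (g p.2)).map (fun p => p.1 + p.2) =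
      volume.withDensity fun z => ENNReal.ofReal (h z) := by
    rw [← prod_withDensity hf.ennreal_ofReal hg.ennreal_ofReal, ← hfd, ← hgd,
      ← (indepFun_iff_map_prod_eq_prod_map_map hX.aemeasurable hY.aemeasurable).mp hindep,
      Measure.map_map (by fun_prop) (hX.prodMk hY), ← hhd]
    rfl
  have hpf : IsProbabilityMeasure (volume.withDensity fun x => ENNReal.ofReal (f x)) :=
    hfd ▸ Measure.isProbabilityMeasure_map hX.aemeasurable
  have hpg : IsProbabilityMeasure (volume.withDensity fun x => ENNReal.ofReal (g x)) :=
    hgd ▸ Measure.isProbabilityMeasure_map hY.aemeasurable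
  have hph : IsProbabilityMeasure (volume.withDensity fun x => ENNReal.ofReal (h x)) :=
    hhd ▸ Measure.isProbabilityMeasure_map (hX.add hY).aemeasurable
  obtain ⟨hf1, hf1'⟩ := EntropyPower.integral_eq_one_of_isProbabilityMeasure hf hf0
  obtain ⟨hg1, hg1'⟩ := EntropyPower.integral_eq_one_of_isProbabilityMeasure hg hg0
  obtain ⟨hh1, hh1'⟩ := EntropyPower.integral_eq_one_of_isProbabilityMeasure hh hh0
  refine EntropyPower.exp_add_exp_le fun l hl0 hl1 => ?_
  have hle := EntropyPower.integral_mul_log_le hl0 hl1 hf hg hh hf0 hg0 hh0 hconv hf1 hg1 hh1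
    hf1' hg1' hh1' hfi hgi hhi
  have hn' : (0 : ℝ) < n := by exact_mod_cast hn
  rw [le_div_iff₀ hn']
  have : (l * (2 * (-∫ x, f x * Real.log (f x)) / n) +
      (1 - l) * (2 * (-∫ x, g x * Real.log (g x)) / n) - 2 * EntropyPower.splitConst l) * n =
      -2 * (l * (∫ x, f x * Real.log (f x)) + (1 - l) * (∫ x, g x * Real.log (g x)) +
        n * EntropyPower.splitConst l) := by
    field_simp
    ring
  rw [this]
  linarith
end

section
/- Conditional Entropy Power Inequality: let (Ω, F, P) be a probability space, X, Y : Ω → ℝ^n random vectors, and M : Ω → S a random variable with values in a standard Borel space S, such that X and Y are conditionally independent given M. Assume that for (P∘M⁻¹)-almost every m ∈ S the regular conditional distributions of X, of Y and of X+Y given M = m are absolutely continuous with respect to Lebesgue measure, with densities f_m, g_m, h_m, and that the conditional differential entropies S(X|M) = ∫_S (−∫_{ℝ^n} f_m ln f_m) d(P∘M⁻¹)(m), S(Y|M) and S(X+Y|M) (defined analogously with g_m and h_m) are well-defined and finite. Then exp(2·S(X+Y|M)/n) ≥ exp(2·S(X|M)/n) + exp(2·S(Y|M)/n). -/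
open MeasureTheory ProbabilityTheory

lemma continuous_cdf_of_absolutelyContinuous {μ : Measure ℝ} [IsProbabilityMeasure μ]
    (hμ : μ ≪ volume) : Continuous (cdf μ) := by
  refine continuous_iff_continuousAt.2 fun x => ?_
  rw [(monotone_cdf μ).continuousAt_iff_leftLim_eq_rightLim, (cdf μ).rightLim_eq]
  have h := (cdf μ).measure_singleton x
  rw [measure_cdf, hμ (by simp)] at h
  have h1 := ENNReal.ofReal_eq_zero.1 h.symm
  linarith [(monotone_cdf μ).leftLim_le (le_refl x)]

lemma strictMono_cdf_gaussianReal : StrictMono (cdf (gaussianReal 0 1)) := by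
  intro x y hxy
  have h := (cdf (gaussianReal 0 1)).measure_Ioc x y
  rw [measure_cdf] at h
  have h0 : gaussianReal 0 1 (Set.Ioc x y) ≠ 0 := fun h0 => by
    have := gaussianReal_absolutelyContinuous' 0 (v := 1) one_ne_zero h0
    simp only [Real.volume_Ioc, ENNReal.ofReal_eq_zero] at this
    linarith
  rw [h] at h0
  have := ENNReal.ofReal_pos.1 (pos_iff_ne_zero.2 h0)
  linarith

lemma cdf_gaussianReal_pos (t : ℝ) : 0 < cdf (gaussianReal 0 1) t :=
  (cdf_nonneg _ (t - 1)).trans_lt (strictMono_cdf_gaussianReal (by linarith))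

lemma cdf_gaussianReal_lt_one (t : ℝ) : cdf (gaussianReal 0 1) t < 1 :=
  (strictMono_cdf_gaussianReal (lt_add_one t)).trans_le (cdf_le_one _ _)

/-- The increasing rearrangement sending the standard Gaussian measure to `μ`. -/
noncomputable def gaussianTransport (μ : Measure ℝ) (t : ℝ) : ℝ :=
  sInf {s | cdf (gaussianReal 0 1) t ≤ cdf μ s}

lemma gaussianTransport_le_iff (μ : Measure ℝ) (t s : ℝ) :
    gaussianTransport μ t ≤ s ↔ cdf (gaussianReal 0 1) t ≤ cdf μ s := by
  have hbdd : BddBelow {s | cdf (gaussianReal 0 1) t ≤ cdf μ s} := by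
    obtain ⟨a, ha⟩ := ((tendsto_cdf_atBot μ).eventually
      (gt_mem_nhds (cdf_gaussianReal_pos t))).exists
    exact ⟨a, fun s hs => le_of_not_gt fun hsa =>
      absurd (hs.trans (monotone_cdf μ hsa.le)) (not_le.2 ha)⟩
  have hne : {s | cdf (gaussianReal 0 1) t ≤ cdf μ s}.Nonempty := by
    obtain ⟨a, ha⟩ := ((tendsto_cdf_atTop μ).eventually
      (lt_mem_nhds (cdf_gaussianReal_lt_one t))).exists
    exact ⟨a, ha.le⟩
  refine ⟨fun h => ?_, fun h => csInf_le hbdd h⟩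
  refine ge_of_tendsto (((cdf μ).right_continuous s).mono Set.Ioi_subset_Ici_self).tendsto ?_
  filter_upwards [self_mem_nhdsWithin] with r hr
  obtain ⟨u, hu, hur⟩ := exists_lt_of_csInf_lt hne (h.trans_lt hr)
  exact hu.trans (monotone_cdf μ hur.le)

lemma cdf_gaussianTransport {μ : Measure ℝ} [IsProbabilityMeasure μ] (hμ : μ ≪ volume) (t : ℝ) :
    cdf μ (gaussianTransport μ t) = cdf (gaussianReal 0 1) t := by
  refine le_antisymm ?_ ((gaussianTransport_le_iff μ t _).1 le_rfl)
  refine le_of_tendsto ((continuous_cdf_of_absolutelyContinuous hμ).continuousWithinAt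
    (s := Set.Iio (gaussianTransport μ t))).tendsto ?_
  filter_upwards [self_mem_nhdsWithin] with r hr
  exact le_of_not_ge fun h => absurd ((gaussianTransport_le_iff μ t r).2 h) (not_le.2 hr)

lemma strictMono_gaussianTransport {μ : Measure ℝ} [IsProbabilityMeasure μ] (hμ : μ ≪ volume) :
    StrictMono (gaussianTransport μ) := by
  intro s t hst
  by_contra! h
  have := monotone_cdf μ h
  rw [cdf_gaussianTransport hμ, cdf_gaussianTransport hμ] at this
  exact absurd (strictMono_cdf_gaussianReal hst) (not_lt.2 this)

lemma map_gaussianTransport {μ : Measure ℝ} [IsProbabilityMeasure μ] (hμ : μ ≪ volume) :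
    (gaussianReal 0 1).map (gaussianTransport μ) = μ := by
  have hm := (strictMono_gaussianTransport hμ).monotone.measurable
  have : IsProbabilityMeasure ((gaussianReal 0 1).map (gaussianTransport μ)) :=
    Measure.isProbabilityMeasure_map hm.aemeasurable
  refine Measure.ext_of_Iic _ _ fun s => ?_
  rw [Measure.map_apply hm measurableSet_Iic, ← ofReal_cdf μ]
  have hset : gaussianTransport μ ⁻¹' Set.Iic s = {t | cdf (gaussianReal 0 1) t ≤ cdf μ s} := by
    ext t
    exact gaussianTransport_le_iff μ t s
  rw [hset]
  have hcont := continuous_cdf_of_absolutelyContinuous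
    (gaussianReal_absolutelyContinuous 0 (v := 1) one_ne_zero)
  rcases (cdf_nonneg μ s).eq_or_lt with h0 | h0
  · rw [← h0]
    simp [not_le.2 (cdf_gaussianReal_pos _)]
  rcases (cdf_le_one μ s).eq_or_lt with h1 | h1
  · rw [h1]
    simp [cdf_le_one]
  obtain ⟨t, ht⟩ := mem_range_of_exists_le_of_exists_ge hcont
    (((tendsto_cdf_atBot (gaussianReal 0 1)).eventually (gt_mem_nhds h0)).exists.imp
      fun _ h => h.le)
    (((tendsto_cdf_atTop (gaussianReal 0 1)).eventually (lt_mem_nhds h1)).exists.imp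
      fun _ h => h.le)
  rw [← ht, ofReal_cdf]
  congr 1
  ext r
  exact strictMono_cdf_gaussianReal.le_iff_le

lemma ae_hasDerivAt_cdf {k : ℝ → ENNReal} (hk : Measurable k) (hk1 : ∫⁻ s, k s = 1) :
    ∀ᵐ s, HasDerivAt (cdf (volume.withDensity k)) (k s).toReal s := by
  have : IsProbabilityMeasure (volume.withDensity k) := ⟨by simpa using hk1⟩
  have h := (cdf (volume.withDensity k)).ae_hasDerivAt
  rw [measure_cdf] at h
  filter_upwards [h, Measure.rnDeriv_withDensity volume hk] with s hs hs'
  rwa [hs'] at hs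

lemma ae_hasDerivAt_gaussianTransport {k : ℝ → ENNReal} (hk : Measurable k)
    (hk1 : ∫⁻ s, k s = 1) :
    ∀ᵐ t, 0 < (k (gaussianTransport (volume.withDensity k) t)).toReal ∧
      HasDerivAt (gaussianTransport (volume.withDensity k))
        (gaussianPDFReal 0 1 t / (k (gaussianTransport (volume.withDensity k) t)).toReal) t := by
  set μ := volume.withDensity k with hμ_def
  have : IsProbabilityMeasure μ := ⟨by simpa [hμ_def] using hk1⟩
  have hμ : μ ≪ volume := withDensity_absolutelyContinuous _ _
  have h1 : ∀ᵐ t ∂gaussianReal 0 1, HasDerivAt (cdf μ) (k (gaussianTransport μ t)).toReal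
      (gaussianTransport μ t) := by
    refine ae_of_ae_map (p := fun s => HasDerivAt (cdf μ) (k s).toReal s)
      (strictMono_gaussianTransport hμ).monotone.measurable.aemeasurable ?_
    rw [map_gaussianTransport hμ]
    exact hμ (ae_hasDerivAt_cdf hk hk1)
  have h2 : ∀ᵐ t, HasDerivAt (cdf (gaussianReal 0 1)) (gaussianPDFReal 0 1 t) t := by
    have h := ae_hasDerivAt_cdf (measurable_gaussianPDF 0 1)
      (lintegral_gaussianPDF_eq_one 0 one_ne_zero)
    rw [← gaussianReal_of_var_ne_zero 0 one_ne_zero] at h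
    simpa only [toReal_gaussianPDF] using h
  filter_upwards [gaussianReal_absolutelyContinuous' 0 one_ne_zero h1, h2,
    (strictMono_gaussianTransport hμ).monotone.ae_differentiableAt] with t h1 h2 h3
  have h4 := h1.comp t h3.hasDerivAt
  have h5 : cdf μ ∘ gaussianTransport μ = cdf (gaussianReal 0 1) :=
    funext fun t => cdf_gaussianTransport hμ t
  rw [h5] at h4
  have h6 := h4.unique h2
  have hpos := gaussianPDFReal_pos 0 1 t one_ne_zero
  have hk0 : (k (gaussianTransport μ t)).toReal ≠ 0 := by
    rintro h
    rw [h, zero_mul] at h6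
    exact hpos.ne h6
  refine ⟨lt_of_le_of_ne ENNReal.toReal_nonneg hk0.symm, ?_⟩
  rw [← h6, mul_div_cancel_left₀ _ hk0]
  exact h3.hasDerivAt

lemma measurable_gaussianTransport {α : Type*} [MeasurableSpace α] {k : α → ℝ → ENNReal}
    (hk : Measurable (Function.uncurry k)) (hk1 : ∀ x, ∫⁻ s, k x s = 1) :
    Measurable fun p : α × ℝ => gaussianTransport (volume.withDensity (k p.1)) p.2 := by
  refine measurable_of_Iic fun s => ?_
  have hset : (fun p : α × ℝ => gaussianTransport (volume.withDensity (k p.1)) p.2) ⁻¹' Set.Iic s =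
      {p | cdf (gaussianReal 0 1) p.2 ≤ (∫⁻ r in Set.Iic s, k p.1 r).toReal} := by
    ext p
    have : IsProbabilityMeasure (volume.withDensity (k p.1)) := ⟨by simpa using hk1 p.1⟩
    simp only [Set.mem_preimage, Set.mem_Iic, gaussianTransport_le_iff, Set.mem_ofPred_eq]
    rw [cdf_eq_real (volume.withDensity (k p.1)), Measure.real,
      withDensity_apply _ measurableSet_Iic]
  rw [hset]
  exact measurableSet_le ((monotone_cdf _).measurable.comp measurable_snd)
    ((hk.lintegral_prod_right' (ν := volume.restrict (Set.Iic s))).ennreal_toReal.comp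
      measurable_fst)

lemma lintegral_comp_add_le {S V D K : ℝ → ℝ} (hS : StrictMono S) (hV : StrictMono V)
    (hSD : ∀ᵐ t, HasDerivAt S (D t) t) (hVK : ∀ᵐ t, HasDerivAt V (K t) t)
    {a b : ℝ} (ha : 0 < a) (hb : 0 < b) (c d : ℝ) (q : ℝ → ENNReal) :
    ∫⁻ w, q (S (a * w + c) + V (b * w + d)) *
      ENNReal.ofReal (a * D (a * w + c) + b * K (b * w + d)) ≤ ∫⁻ s, q s := by
  have haff : ∀ (a c : ℝ), 0 < a → ∀ {p : ℝ → Prop}, (∀ᵐ t, p t) → ∀ᵐ w, p (a * w + c) := by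
    intro a c ha p hp
    have h1 : Measure.QuasiMeasurePreserving (fun w : ℝ => a * w + c) volume volume := by
      refine (measurePreserving_add_right volume c).quasiMeasurePreserving.comp
        ⟨by fun_prop, ?_⟩
      rw [Real.map_volume_mul_left ha.ne']
      exact Measure.smul_absolutelyContinuous
    exact h1.ae hp
  set F : ℝ → ℝ := fun w => S (a * w + c) + V (b * w + d)
  set F' : ℝ → ℝ := fun w => a * D (a * w + c) + b * K (b * w + d)
  have hF : StrictMono F := fun x y hxy => add_lt_add (hS (by gcongr)) (hV (by gcongr))
  have hder : ∀ᵐ w, HasDerivAt F (F' w) w := by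
    filter_upwards [haff a c ha hSD, haff b d hb hVK] with w h1 h2
    have e1 : HasDerivAt (fun w => a * w + c) a w := by
      simpa using ((hasDerivAt_id w).const_mul a).add_const c
    have e2 : HasDerivAt (fun w => b * w + d) b w := by
      simpa using ((hasDerivAt_id w).const_mul b).add_const d
    have := (h1.comp w e1).add (h2.comp w e2)
    simpa [F', mul_comm] using! this
  set N := toMeasurable volume {w | ¬ HasDerivAt F (F' w) w}
  have hN : volume N = 0 := by rw [measure_toMeasurable]; exact hder
  have hrestr : volume.restrict Nᶜ = (volume : Measure ℝ) :=
    Measure.restrict_eq_self_of_ae_mem (compl_mem_ae_iff.2 hN)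
  have hderN : ∀ w ∈ Nᶜ, HasDerivWithinAt F (F' w) Nᶜ w := fun w hw => by
    have : w ∉ {w | ¬ HasDerivAt F (F' w) w} := fun h => hw (subset_toMeasurable _ _ h)
    exact (not_not.1 this).hasDerivWithinAt
  calc ∫⁻ w, q (F w) * ENNReal.ofReal (F' w)
      ≤ ∫⁻ w in Nᶜ, ENNReal.ofReal |F' w| * q (F w) := by
        rw [hrestr]
        refine lintegral_mono fun w => ?_
        rw [mul_comm]
        gcongr
        exact le_abs_self _
    _ = ∫⁻ s in F '' Nᶜ, q s := (lintegral_image_eq_lintegral_abs_deriv_mul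
        (measurableSet_toMeasurable _ _).compl hderN hF.injective.injOn q).symm
    _ ≤ ∫⁻ s, q s := setLIntegral_le_lintegral _ _

/-- The standard Gaussian measure on `Fin n → ℝ`. -/
noncomputable abbrev gaussianPi (n : ℕ) : Measure (Fin n → ℝ) :=
  Measure.pi fun _ => gaussianReal 0 1

/-- The density of `gaussianPi n`. -/
noncomputable def gaussianPiPDFReal (n : ℕ) (x : Fin n → ℝ) : ℝ :=
  ∏ i, gaussianPDFReal 0 1 (x i)

@[fun_prop]
lemma measurable_gaussianPiPDFReal (n : ℕ) : Measurable (gaussianPiPDFReal n) :=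
  Finset.measurable_prod _ fun i _ =>
    (measurable_gaussianPDFReal 0 1).comp (measurable_pi_apply i)

lemma gaussianPiPDFReal_pos (n : ℕ) (x : Fin n → ℝ) : 0 < gaussianPiPDFReal n x :=
  Finset.prod_pos fun i _ => gaussianPDFReal_pos 0 1 (x i) one_ne_zero

lemma gaussianPiPDFReal_cons {n : ℕ} (t : ℝ) (y : Fin n → ℝ) :
    gaussianPiPDFReal (n + 1) (Fin.cons t y) = gaussianPDFReal 0 1 t * gaussianPiPDFReal n y := by
  simp [gaussianPiPDFReal, Fin.prod_univ_succ]

@[fun_prop]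
lemma Measurable.finCons {α : Type*} [MeasurableSpace α] {n : ℕ} {s : α → ℝ} {y : α → Fin n → ℝ}
    (hs : Measurable s) (hy : Measurable y) :
    Measurable fun x => (Fin.cons (s x) (y x) : Fin (n + 1) → ℝ) := by
  refine measurable_pi_lambda _ fun i => ?_
  refine Fin.cases ?_ (fun j => ?_) i
  · simpa using hs
  · simpa using! (measurable_pi_apply j).comp hy

@[fun_prop]
lemma measurable_finTail {n : ℕ} : Measurable (Fin.tail : (Fin (n + 1) → ℝ) → Fin n → ℝ) :=
  measurable_pi_lambda _ fun i => measurable_pi_apply i.succ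

lemma lintegral_pi_fin_succ {n : ℕ} (μ : Measure ℝ) [SigmaFinite μ]
    {F : (Fin (n + 1) → ℝ) → ENNReal} (hF : Measurable F) :
    ∫⁻ x, F x ∂Measure.pi (fun _ => μ) =
      ∫⁻ y, ∫⁻ t, F (Fin.cons t y) ∂μ ∂Measure.pi (fun _ : Fin n => μ) := by
  have h := (measurePreserving_piFinSuccAbove (fun _ : Fin (n + 1) => μ) 0).symm
  rw [← h.lintegral_comp hF, lintegral_prod_symm']
  · simp [MeasurableEquiv.piFinSuccAbove_symm_apply, Fin.insertNthEquiv]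
  · exact hF.comp (MeasurableEquiv.measurable _)

lemma lintegral_volume_fin_succ {n : ℕ} {F : (Fin (n + 1) → ℝ) → ENNReal} (hF : Measurable F) :
    ∫⁻ x, F x = ∫⁻ y : Fin n → ℝ, ∫⁻ t : ℝ, F (Fin.cons t y) :=
  lintegral_pi_fin_succ volume hF

lemma ae_volume_fin_succ {n : ℕ} {s : Set (Fin (n + 1) → ℝ)} (hs : MeasurableSet s)
    (h : ∀ᵐ y : Fin n → ℝ, ∀ᵐ t : ℝ, (Fin.cons t y : Fin (n + 1) → ℝ) ∈ s) :
    ∀ᵐ x, x ∈ s := by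
  have h0 : ∫⁻ x, sᶜ.indicator 1 x = 0 := by
    rw [lintegral_volume_fin_succ (measurable_one.indicator hs.compl)]
    refine lintegral_eq_zero_of_ae_eq_zero ?_
    filter_upwards [h] with y hy
    refine lintegral_eq_zero_of_ae_eq_zero ?_
    filter_upwards [hy] with t ht
    simpa using ht
  rw [lintegral_indicator_one hs.compl] at h0
  exact h0

lemma gaussianPi_eq_withDensity (n : ℕ) :
    gaussianPi n = volume.withDensity fun x => ENNReal.ofReal (gaussianPiPDFReal n x) := by
  induction n with
  | zero =>
    have h : ∀ x, gaussianPiPDFReal 0 x = 1 := fun x => by simp [gaussianPiPDFReal]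
    simp only [h, ENNReal.ofReal_one]
    rw [← Pi.one_def, withDensity_one, volume_pi, gaussianPi, Measure.pi_of_empty,
      Measure.pi_of_empty]
  | succ n ih =>
    refine Measure.ext_of_lintegral _ fun F hF => ?_
    rw [gaussianPi, lintegral_pi_fin_succ _ hF, ← gaussianPi, ih,
      lintegral_withDensity_eq_lintegral_mul _ (by fun_prop)
        (Measurable.lintegral_prod_right' (f := fun p : (Fin n → ℝ) × ℝ => F (Fin.cons p.2 p.1))
          (by fun_prop)),
      lintegral_withDensity_eq_lintegral_mul _ (by fun_prop) hF,
      lintegral_volume_fin_succ (by fun_prop)]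
    refine lintegral_congr fun y => ?_
    rw [gaussianReal_of_var_ne_zero 0 one_ne_zero, Pi.mul_apply,
      lintegral_withDensity_eq_lintegral_mul _ (measurable_gaussianPDF 0 1) (by fun_prop),
      ← lintegral_const_mul _ (by have := measurable_gaussianPDF 0 1; fun_prop)]
    refine lintegral_congr fun t => ?_
    simp only [Pi.mul_apply, gaussianPiPDFReal_cons, gaussianPDF]
    rw [ENNReal.ofReal_mul (gaussianPDFReal_nonneg _ _ _)]
    ring

/-- `IsTriangularMap n T J` says that `T` is a triangular map, each of whose components is strictly
increasing in its own variable, and that `J` is the product of the corresponding partial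
derivatives. -/
def IsTriangularMap : ∀ n : ℕ, ((Fin n → ℝ) → Fin n → ℝ) → ((Fin n → ℝ) → ℝ) → Prop
  | 0, _, J => ∀ x, J x = 1
  | n + 1, T, J => ∃ (T' : (Fin n → ℝ) → Fin n → ℝ) (J' : (Fin n → ℝ) → ℝ)
      (S D : (Fin n → ℝ) → ℝ → ℝ), IsTriangularMap n T' J' ∧
      Measurable (Function.uncurry S) ∧ Measurable (Function.uncurry D) ∧
      (∀ y, StrictMono (S y)) ∧ (∀ y t, 0 ≤ D y t) ∧
      (∀ y, ∀ᵐ t, HasDerivAt (S y) (D y t) t) ∧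
      (∀ x, T x = Fin.cons (S (Fin.tail x) (x 0)) (T' (Fin.tail x))) ∧
      ∀ x, J x = D (Fin.tail x) (x 0) * J' (Fin.tail x)

lemma IsTriangularMap.measurable {n : ℕ} {T : (Fin n → ℝ) → Fin n → ℝ} {J : (Fin n → ℝ) → ℝ}
    (h : IsTriangularMap n T J) : Measurable T := by
  induction n with
  | zero => exact measurable_of_subsingleton_codomain T
  | succ n ih =>
    obtain ⟨T', J', S, D, h', hS, -, -, -, -, hT, -⟩ := h
    have := ih h'
    rw [funext hT]
    exact (hS.comp (measurable_finTail.prodMk (measurable_pi_apply 0))).finCons (by fun_prop)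

lemma IsTriangularMap.measurable_jacobian {n : ℕ} {T : (Fin n → ℝ) → Fin n → ℝ}
    {J : (Fin n → ℝ) → ℝ} (h : IsTriangularMap n T J) : Measurable J := by
  induction n with
  | zero => exact Subsingleton.measurable
  | succ n ih =>
    obtain ⟨T', J', S, D, h', -, hD, -, -, -, -, hJ⟩ := h
    have := ih h'
    rw [funext hJ]
    exact (hD.comp (measurable_finTail.prodMk (measurable_pi_apply 0))).mul (by fun_prop)

lemma IsTriangularMap.jacobian_nonneg {n : ℕ} {T : (Fin n → ℝ) → Fin n → ℝ}
    {J : (Fin n → ℝ) → ℝ} (h : IsTriangularMap n T J) (x : Fin n → ℝ) : 0 ≤ J x := by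
  induction n with
  | zero => simp [h x]
  | succ n ih =>
    obtain ⟨T', J', S, D, h', -, -, -, hD, -, -, hJ⟩ := h
    rw [hJ]
    exact mul_nonneg (hD _ _) (ih h' _)

lemma IsTriangularMap.lintegral_comp_add_le {n : ℕ} {T U : (Fin n → ℝ) → Fin n → ℝ}
    {J K : (Fin n → ℝ) → ℝ} (hT : IsTriangularMap n T J) (hU : IsTriangularMap n U K)
    {a b c : ℝ} (ha : 0 < a) (hb : 0 < b) (hc : 0 ≤ c)
    (hmean : ∀ x y, 0 ≤ x → 0 ≤ y → c * (x ^ (a ^ 2) * y ^ (b ^ 2)) ≤ a * x + b * y)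
    (u v : Fin n → ℝ) {q : (Fin n → ℝ) → ENNReal} (hq : Measurable q) :
    ∫⁻ w, q (T (a • w + u) + U (b • w + v)) *
      ENNReal.ofReal (c ^ n * (J (a • w + u) ^ (a ^ 2) * K (b • w + v) ^ (b ^ 2))) ≤
        ∫⁻ x, q x := by
  induction n with
  | zero =>
    refine lintegral_mono fun w => ?_
    rw [hT, hU, Subsingleton.elim (T (a • w + u) + U (b • w + v)) w]
    simp
  | succ n ih =>
    have mT := hT.measurable
    have mU := hU.measurable
    have mJ := hT.measurable_jacobian
    have mK := hU.measurable_jacobian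
    obtain ⟨T', J', S, D, hT', hS, hD, hSm, hD0, hSD, hT1, hJ1⟩ := hT
    obtain ⟨U', K', V, E, hU', hV, hE, hVm, hE0, hVE, hU1, hK1⟩ := hU
    rw [lintegral_volume_fin_succ hq, lintegral_volume_fin_succ (by fun_prop)]
    refine le_trans (lintegral_mono fun y => ?_) (ih hT' hU' (Fin.tail u) (Fin.tail v)
      (q := fun y => ∫⁻ t, q (Fin.cons t y))
      (Measurable.lintegral_prod_right' (f := fun p : (Fin n → ℝ) × ℝ => q (Fin.cons p.2 p.1))
        (by fun_prop)))
    set y₁ := a • y + Fin.tail u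
    set y₂ := b • y + Fin.tail v
    have e1 : ∀ t, Fin.tail (a • (Fin.cons t y : Fin (n + 1) → ℝ) + u) = y₁ := fun t => by
      ext i; simp [Fin.tail, y₁]
    have e2 : ∀ t, Fin.tail (b • (Fin.cons t y : Fin (n + 1) → ℝ) + v) = y₂ := fun t => by
      ext i; simp [Fin.tail, y₂]
    have hJ' := hT'.jacobian_nonneg y₁
    have hK' := hU'.jacobian_nonneg y₂
    have key := _root_.lintegral_comp_add_le (hSm y₁) (hVm y₂) (hSD y₁) (hVE y₂) ha hb (u 0) (v 0)
      (fun s => q (Fin.cons s (T' y₁ + U' y₂)))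
    refine le_trans ?_ (mul_le_mul_left key _)
    rw [← lintegral_mul_const _ (by
      have h1 : Measurable (S y₁) := (hSm y₁).monotone.measurable
      have h2 : Measurable (V y₂) := (hVm y₂).monotone.measurable
      have h3 : Measurable (D y₁) := hD.of_uncurry_left
      have h4 : Measurable (E y₂) := hE.of_uncurry_left
      fun_prop)]
    refine lintegral_mono fun t => ?_
    simp only [hT1, hU1, hJ1, hK1, e1, e2]
    have e3 : (Fin.cons (S y₁ ((a • (Fin.cons t y : Fin (n + 1) → ℝ) + u) 0)) (T' y₁) +
        Fin.cons (V y₂ ((b • (Fin.cons t y : Fin (n + 1) → ℝ) + v) 0)) (U' y₂) : Fin (n + 1) → ℝ) =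
        Fin.cons (S y₁ (a * t + u 0) + V y₂ (b * t + v 0)) (T' y₁ + U' y₂) := by
      ext i
      refine Fin.cases ?_ (fun j => ?_) i <;> simp
    rw [e3, mul_assoc]
    gcongr
    have d1 := hD0 y₁ (a * t + u 0)
    have d2 := hE0 y₂ (b * t + v 0)
    rw [← ENNReal.ofReal_mul (by positivity)]
    refine ENNReal.ofReal_le_ofReal ?_
    simp only [Pi.add_apply, Pi.smul_apply, Fin.cons_zero, smul_eq_mul]
    rw [Real.mul_rpow d1 hJ', Real.mul_rpow d2 hK']
    calc _ = c * (D y₁ (a * t + u 0) ^ (a ^ 2) * E y₂ (b * t + v 0) ^ (b ^ 2)) *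
          (c ^ n * (J' y₁ ^ a ^ 2 * K' y₂ ^ b ^ 2)) := by ring
      _ ≤ _ := by
        gcongr
        exact hmean _ _ d1 d2

/-- The conditional density of the first coordinate given the others, for the density `f`; it is
replaced by the standard Gaussian density where the marginal density is zero or infinite. -/
noncomputable def condDensity {n : ℕ} (f : (Fin (n + 1) → ℝ) → ENNReal) (y : Fin n → ℝ) (t : ℝ) :
    ENNReal :=
  open Classical in
  if (∫⁻ s, f (Fin.cons s y)) = 0 ∨ (∫⁻ s, f (Fin.cons s y)) = ⊤ then gaussianPDF 0 1 t
  else f (Fin.cons t y) / ∫⁻ s, f (Fin.cons s y)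

section condDensity

variable {n : ℕ} {f : (Fin (n + 1) → ℝ) → ENNReal}

lemma measurable_marginal (hf : Measurable f) :
    Measurable fun y : Fin n → ℝ => ∫⁻ s, f (Fin.cons s y) :=
  Measurable.lintegral_prod_right' (f := fun p : (Fin n → ℝ) × ℝ => f (Fin.cons p.2 p.1))
    (by fun_prop)

lemma measurable_condDensity (hf : Measurable f) :
    Measurable (Function.uncurry (condDensity f)) := by
  have hm : Measurable fun p : (Fin n → ℝ) × ℝ => ∫⁻ s, f (Fin.cons s p.1) :=
    (measurable_marginal hf).comp measurable_fst
  refine Measurable.ite ?_ ((measurable_gaussianPDF 0 1).comp measurable_snd)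
    (Measurable.div (by fun_prop) hm)
  exact (hm (measurableSet_singleton 0)).union (hm (measurableSet_singleton ⊤))

lemma lintegral_condDensity (hf : Measurable f) (y : Fin n → ℝ) :
    ∫⁻ t, condDensity f y t = 1 := by
  unfold condDensity
  split_ifs with h
  · exact lintegral_gaussianPDF_eq_one 0 one_ne_zero
  · push Not at h
    simp_rw [div_eq_mul_inv]
    rw [lintegral_mul_const _ (by fun_prop), ENNReal.mul_inv_cancel h.1 h.2]

lemma ae_eq_marginal_mul_condDensity (hf : Measurable f) (hf1 : ∫⁻ x, f x = 1) :
    ∀ᵐ x, f x = (∫⁻ s, f (Fin.cons s (Fin.tail x))) * condDensity f (Fin.tail x) (x 0) := by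
  have hm := measurable_marginal hf
  have hk := measurable_condDensity hf
  refine ae_volume_fin_succ (s := {x | f x = _}) (measurableSet_eq_fun hf ?_) ?_
  · exact (hm.comp measurable_finTail).mul
      (hk.comp (measurable_finTail.prodMk (measurable_pi_apply 0)))
  rw [lintegral_volume_fin_succ hf] at hf1
  filter_upwards [ae_lt_top hm (by rw [hf1]; simp)] with y hy
  by_cases h0 : ∫⁻ s, f (Fin.cons s y) = 0
  · filter_upwards [(lintegral_eq_zero_iff (by fun_prop)).1 h0] with t ht
    simpa [h0] using ht
  · refine Filter.Eventually.of_forall fun t => ?_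
    simp [condDensity, h0, hy.ne, ENNReal.mul_div_cancel h0 hy.ne]

lemma exists_ae_eq_marginal_mul_condDensity (hf : Measurable f) (hf1 : ∫⁻ x, f x = 1) :
    ∃ (m : (Fin n → ℝ) → ENNReal) (k : (Fin n → ℝ) → ℝ → ENNReal), Measurable m ∧
      ∫⁻ y, m y = 1 ∧ Measurable (Function.uncurry k) ∧ (∀ y, ∫⁻ t, k y t = 1) ∧
      ∀ᵐ x, f x = m (Fin.tail x) * k (Fin.tail x) (x 0) :=
  ⟨_, _, measurable_marginal hf, by rw [← lintegral_volume_fin_succ hf, hf1],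
    measurable_condDensity hf, lintegral_condDensity hf, ae_eq_marginal_mul_condDensity hf hf1⟩

end condDensity

lemma map_cons_gaussianTransport {n : ℕ} {f : (Fin (n + 1) → ℝ) → ENNReal}
    {m : (Fin n → ℝ) → ENNReal} {k : (Fin n → ℝ) → ℝ → ENNReal} {T : (Fin n → ℝ) → Fin n → ℝ}
    (hf : Measurable f) (hm : Measurable m) (hk : Measurable (Function.uncurry k))
    (hk1 : ∀ y, ∫⁻ t, k y t = 1) (hT : Measurable T)
    (hmap : (gaussianPi n).map T = volume.withDensity m)
    (hfmk : ∀ᵐ x, f x = m (Fin.tail x) * k (Fin.tail x) (x 0)) :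
    (gaussianPi (n + 1)).map (fun x => Fin.cons
      (gaussianTransport (volume.withDensity (k (T (Fin.tail x)))) (x 0)) (T (Fin.tail x))) =
      volume.withDensity f := by
  have hprob : ∀ y, IsProbabilityMeasure (volume.withDensity (k y)) := fun y =>
    ⟨by simpa using hk1 y⟩
  have hac : ∀ y, volume.withDensity (k y) ≪ volume := fun y =>
    withDensity_absolutelyContinuous _ _
  have hk_tail : Measurable fun x : Fin (n + 1) → ℝ => k (Fin.tail x) (x 0) :=
    hk.comp (measurable_finTail.prodMk (measurable_pi_apply 0))
  have hS : Measurable fun x : Fin (n + 1) → ℝ =>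
      gaussianTransport (volume.withDensity (k (T (Fin.tail x)))) (x 0) :=
    (measurable_gaussianTransport hk hk1).comp
      ((hT.comp measurable_finTail).prodMk (measurable_pi_apply 0))
  refine Measure.ext_of_lintegral _ fun q hq => ?_
  have hinner : ∀ y, ∫⁻ t, q (Fin.cons (gaussianTransport (volume.withDensity (k (T y))) t) (T y))
      ∂gaussianReal 0 1 = ∫⁻ s, k (T y) s * q (Fin.cons s (T y)) := fun y => by
    have h1 : Measurable (k (T y)) := hk.of_uncurry_left
    have h2 := lintegral_map (μ := gaussianReal 0 1) (f := fun s => q (Fin.cons s (T y)))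
      (by fun_prop) (strictMono_gaussianTransport (hac (T y))).monotone.measurable
    rw [map_gaussianTransport (hac (T y)),
      lintegral_withDensity_eq_lintegral_mul _ h1 (by fun_prop)] at h2
    exact h2.symm
  have hQ : Measurable fun y : Fin n → ℝ => ∫⁻ s, k y s * q (Fin.cons s y) :=
    Measurable.lintegral_prod_right'
      (f := fun p : (Fin n → ℝ) × ℝ => k p.1 p.2 * q (Fin.cons p.2 p.1))
      (hk.mul (by fun_prop))
  rw [lintegral_map hq (by fun_prop), gaussianPi, lintegral_pi_fin_succ _ (by fun_prop)]
  simp only [Fin.tail_cons, Fin.cons_zero, hinner]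
  rw [← lintegral_map hQ hT, ← gaussianPi, hmap, lintegral_withDensity_eq_lintegral_mul _ hm hQ,
    lintegral_withDensity_eq_lintegral_mul _ hf hq]
  have hcongr : ∫⁻ x, (f * q) x = ∫⁻ x, m (Fin.tail x) * k (Fin.tail x) (x 0) * q x := by
    refine lintegral_congr_ae ?_
    filter_upwards [hfmk] with x hx
    rw [Pi.mul_apply, hx]
  rw [hcongr, lintegral_volume_fin_succ (by fun_prop)]
  refine lintegral_congr fun y => ?_
  have h1 : Measurable (k y) := hk.of_uncurry_left
  rw [Pi.mul_apply, ← lintegral_const_mul _ (by fun_prop)]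
  simp [mul_assoc]

lemma exists_isTriangularMap {n : ℕ} {f : (Fin n → ℝ) → ENNReal} (hf : Measurable f)
    (hf1 : ∫⁻ x, f x = 1) :
    ∃ T J, IsTriangularMap n T J ∧ (gaussianPi n).map T = volume.withDensity f ∧
      ∀ᵐ x, 0 < (f (T x)).toReal ∧ (f (T x)).toReal * J x = gaussianPiPDFReal n x := by
  induction n with
  | zero =>
    have h1 : ∀ x, f x = 1 := fun x => by
      rw [← hf1, volume_pi, Measure.pi_of_empty (x := x), lintegral_dirac]
    refine ⟨id, fun _ => 1, fun _ => rfl, ?_, ?_⟩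
    · rw [Measure.map_id, funext h1, ← Pi.one_def, withDensity_one, volume_pi, gaussianPi,
        Measure.pi_of_empty, Measure.pi_of_empty]
    · simp [h1, gaussianPiPDFReal]
  | succ n ih =>
    obtain ⟨m, k, hm, hm1, mk, k1, hf'⟩ := exists_ae_eq_marginal_mul_condDensity hf hf1
    obtain ⟨T, J, hT, hmap, hJ⟩ := ih hm hm1
    have mT := hT.measurable
    set S : (Fin n → ℝ) → ℝ → ℝ :=
      fun y t => gaussianTransport (volume.withDensity (k (T y))) t with hS_def
    have mS : Measurable (Function.uncurry S) :=
      measurable_gaussianTransport (k := fun y => k (T y))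
        (mk.comp ((mT.comp measurable_fst).prodMk measurable_snd)) fun y => k1 (T y)
    set D : (Fin n → ℝ) → ℝ → ℝ :=
      fun y t => gaussianPDFReal 0 1 t / (k (T y) (S y t)).toReal with hD_def
    have mD : Measurable (Function.uncurry D) :=
      ((measurable_gaussianPDFReal 0 1).comp measurable_snd).div
        (mk.comp ((mT.comp measurable_fst).prodMk mS)).ennreal_toReal
    have hprob : ∀ y, IsProbabilityMeasure (volume.withDensity (k y)) := fun y =>
      ⟨by simpa using k1 y⟩
    have hac : ∀ y, volume.withDensity (k y) ≪ volume := fun y =>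
      withDensity_absolutelyContinuous _ _
    set T₁ : (Fin (n + 1) → ℝ) → Fin (n + 1) → ℝ :=
      fun x => Fin.cons (S (Fin.tail x) (x 0)) (T (Fin.tail x)) with hT₁
    set J₁ : (Fin (n + 1) → ℝ) → ℝ := fun x => D (Fin.tail x) (x 0) * J (Fin.tail x) with hJ₁
    have htri : IsTriangularMap (n + 1) T₁ J₁ :=
      ⟨T, J, S, D, hT, mS, mD, fun y => strictMono_gaussianTransport (hac _),
        fun y t => div_nonneg (gaussianPDFReal_nonneg _ _ _) ENNReal.toReal_nonneg,
        fun y => (ae_hasDerivAt_gaussianTransport mk.of_uncurry_left (k1 _)).mono fun t h => h.2,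
        fun _ => rfl, fun _ => rfl⟩
    have mT₁ := htri.measurable
    have mJ₁ := htri.measurable_jacobian
    have hmap₁ : (gaussianPi (n + 1)).map T₁ = volume.withDensity f :=
      map_cons_gaussianTransport hf hm mk k1 mT hmap hf'
    refine ⟨T₁, J₁, htri, hmap₁, ?_⟩
    have hvol : (volume : Measure (Fin (n + 1) → ℝ)) ≪ gaussianPi (n + 1) := by
      rw [gaussianPi_eq_withDensity]
      refine withDensity_absolutelyContinuous' (by fun_prop) (Filter.Eventually.of_forall fun x => ?_)
      simpa using gaussianPiPDFReal_pos _ x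
    have hf'' : ∀ᵐ x, f (T₁ x) = m (T (Fin.tail x)) *
        k (T (Fin.tail x)) (S (Fin.tail x) (x 0)) := by
      have : ∀ᵐ z ∂(gaussianPi (n + 1)).map T₁,
          f z = m (Fin.tail z) * k (Fin.tail z) (z 0) := by
        rw [hmap₁]
        exact withDensity_absolutelyContinuous _ _ hf'
      exact hvol (ae_of_ae_map mT₁.aemeasurable this)
    have hprod : ∀ᵐ x : Fin (n + 1) → ℝ,
        x ∈ {x | 0 < (m (T (Fin.tail x)) *
          k (T (Fin.tail x)) (S (Fin.tail x) (x 0))).toReal ∧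
          (m (T (Fin.tail x)) *
          k (T (Fin.tail x)) (S (Fin.tail x) (x 0))).toReal * J₁ x =
          gaussianPiPDFReal (n + 1) x} := by
      have h1 : Measurable fun x : Fin (n + 1) → ℝ => (m (T (Fin.tail x)) *
          k (T (Fin.tail x)) (S (Fin.tail x) (x 0))).toReal := by
        have := mS.comp (measurable_finTail.prodMk (measurable_pi_apply (0 : Fin (n + 1))))
        exact (Measurable.mul (by fun_prop)
          (mk.comp ((mT.comp measurable_finTail).prodMk this))).ennreal_toReal
      refine ae_volume_fin_succ ((measurableSet_lt measurable_const h1).inter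
        (measurableSet_eq_fun (h1.mul mJ₁) (by fun_prop))) ?_
      filter_upwards [hJ] with y hy
      filter_upwards [ae_hasDerivAt_gaussianTransport mk.of_uncurry_left (k1 (T y))] with t ht
      have e : Fin.tail (Fin.cons t y : Fin (n + 1) → ℝ) = y := Fin.tail_cons _ _
      refine ⟨?_, ?_⟩
      · rw [e, ENNReal.toReal_mul]
        exact mul_pos hy.1 ht.1
      · simp only [hJ₁]
        rw [e, ENNReal.toReal_mul, gaussianPiPDFReal_cons, ← hy.2, Fin.cons_zero]
        have h3 : (k (T y) (S y t)).toReal ≠ 0 := ht.1.ne'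
        simp only [hD_def]
        field_simp
    filter_upwards [hf'', hprod] with x h1 h2
    rw [h1]
    exact h2

instance isGaussian_gaussianPi (n : ℕ) : IsGaussian (gaussianPi n) := by
  have h := map_pi_eq_stdGaussian (ι := Fin n)
  have h2 : (gaussianPi n) = (stdGaussian (EuclideanSpace ℝ (Fin n))).map
      (EuclideanSpace.equiv (Fin n) ℝ) := by
    rw [← h, Measure.map_map (by fun_prop) (by fun_prop)]
    exact Measure.map_id.symm
  rw [h2]
  infer_instance

lemma integral_id_gaussianPi (n : ℕ) : (gaussianPi n)[id] = 0 := by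
  ext i
  rw [eval_integral fun i => ?_]
  · have h := (measurePreserving_eval (fun _ : Fin n => gaussianReal 0 1) i)
    have h2 := integral_map (μ := gaussianPi n) (φ := Function.eval i) (f := fun x : ℝ => x)
      h.measurable.aemeasurable (by fun_prop)
    rw [h.map_eq, integral_id_gaussianReal] at h2
    exact h2.symm
  · exact (IsGaussian.integrable_id (μ := gaussianPi n)).eval i

/-- The standard Gaussian measure on the product is invariant under rotations. -/
lemma measurePreserving_rotation_gaussianPi (n : ℕ) {a b : ℝ} (hab : a ^ 2 + b ^ 2 = 1)
    (ha : 0 < a) (hb : 0 < b) :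
    MeasurePreserving (fun p : (Fin n → ℝ) × (Fin n → ℝ) => (a • p.1 - b • p.2, b • p.1 + a • p.2))
      ((gaussianPi n).prod (gaussianPi n)) ((gaussianPi n).prod (gaussianPi n)) := by
  refine ⟨by fun_prop, ?_⟩
  have h := IsGaussian.map_rotation_eq_self (integral_id_gaussianPi n) (-Real.arccos a)
  have hc : Real.cos (-Real.arccos a) = a := by
    rw [Real.cos_neg, Real.cos_arccos] <;> nlinarith
  have hs : Real.sin (-Real.arccos a) = -b := by
    rw [Real.sin_neg, Real.sin_arccos, ← hab, add_sub_cancel_left, Real.sqrt_sq hb.le]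
  convert h using 2
  ext p : 1
  rw [ContinuousLinearMap.rotation_apply, hc, hs]
  simp [sub_eq_add_neg]

lemma integrable_log_gaussianPiPDFReal (n : ℕ) :
    Integrable (fun x => Real.log (gaussianPiPDFReal n x)) (gaussianPi n) := by
  have h1 : Integrable (fun t => Real.log (gaussianPDFReal 0 1 t)) (gaussianReal 0 1) := by
    have h2 : (fun t => Real.log (gaussianPDFReal 0 1 t)) =
        fun t => Real.log (√(2 * Real.pi * 1))⁻¹ - t ^ 2 / 2 := by
      ext t
      rw [gaussianPDFReal, Real.log_mul (by positivity) (Real.exp_pos _).ne', Real.log_exp]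
      simp
      ring
    rw [h2]
    refine (integrable_const _).sub (Integrable.div_const ?_ _)
    exact (memLp_id_gaussianReal 2).integrable_sq
  have h3 : (fun x => Real.log (gaussianPiPDFReal n x)) =
      fun x => ∑ i, Real.log (gaussianPDFReal 0 1 (x i)) := by
    ext x
    exact Real.log_prod fun i _ => (gaussianPDFReal_pos 0 1 (x i) one_ne_zero).ne'
  rw [h3]
  refine integrable_finsetSum _ fun i _ => ?_
  exact (measurePreserving_eval (fun _ : Fin n => gaussianReal 0 1) i).integrable_comp_of_integrable
    h1

lemma integrable_log_comp_of_measurePreserving {Ω E : Type*} [MeasurableSpace Ω]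
    [MeasurableSpace E] {P : Measure Ω} {μ : Measure E} {A : Ω → E} {f : E → ℝ}
    (hf : Measurable f) (hf0 : ∀ x, 0 ≤ f x)
    (hA : MeasurePreserving A P (μ.withDensity fun x => ENNReal.ofReal (f x)))
    (hi : Integrable (fun x => f x * Real.log (f x)) μ) :
    Integrable (fun ω => Real.log (f (A ω))) P ∧
      ∫ ω, Real.log (f (A ω)) ∂P = ∫ x, f x * Real.log (f x) ∂μ := by
  have h1 : Integrable (fun x => Real.log (f x)) (μ.withDensity fun x => ENNReal.ofReal (f x)) := by
    rw [integrable_withDensity_iff_integrable_smul' (by fun_prop) (by simp)]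
    simpa [ENNReal.toReal_ofReal (hf0 _)] using hi
  refine ⟨hA.integrable_comp_of_integrable h1, ?_⟩
  have h2 := integral_map (μ := P) (φ := A) (f := fun x => Real.log (f x)) hA.measurable.aemeasurable
    (Real.measurable_log.comp hf).aestronglyMeasurable
  rw [← h2, hA.map_eq, integral_withDensity_eq_integral_toReal_smul (by fun_prop) (by simp)]
  simp [ENNReal.toReal_ofReal (hf0 _)]

/-- The entropy power inequality for densities, in Lieb's form. -/
theorem entropy_add_ge_of_sq_add_sq_eq_one {n : ℕ} {f g h : (Fin n → ℝ) → ℝ}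
    (hf : Measurable f) (hg : Measurable g) (hh : Measurable h)
    (hf0 : ∀ x, 0 ≤ f x) (hg0 : ∀ x, 0 ≤ g x) (hh0 : ∀ x, 0 ≤ h x)
    (hf1 : ∫⁻ x, ENNReal.ofReal (f x) = 1) (hg1 : ∫⁻ x, ENNReal.ofReal (g x) = 1)
    (hadd : ((volume.withDensity fun x => ENNReal.ofReal (f x)).prod
        (volume.withDensity fun x => ENNReal.ofReal (g x))).map (fun p => p.1 + p.2) =
      volume.withDensity fun x => ENNReal.ofReal (h x))
    (hfi : Integrable fun x => f x * Real.log (f x))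
    (hgi : Integrable fun x => g x * Real.log (g x))
    (hhi : Integrable fun x => h x * Real.log (h x))
    {a b : ℝ} (ha : 0 < a) (hb : 0 < b) (hab : a ^ 2 + b ^ 2 = 1) :
    a ^ 2 * (-∫ x, f x * Real.log (f x)) + b ^ 2 * (-∫ x, g x * Real.log (g x)) +
      n * (-(a ^ 2 * Real.log a) - b ^ 2 * Real.log b) ≤ -∫ x, h x * Real.log (h x) := by
  obtain ⟨T, J, hT, hTmap, hTJ⟩ := exists_isTriangularMap (n := n)
    (f := fun x => ENNReal.ofReal (f x)) (by fun_prop) hf1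
  obtain ⟨U, K, hU, hUmap, hUK⟩ := exists_isTriangularMap (n := n)
    (f := fun x => ENNReal.ofReal (g x)) (by fun_prop) hg1
  simp only [ENNReal.toReal_ofReal (hf0 _)] at hTJ
  simp only [ENNReal.toReal_ofReal (hg0 _)] at hUK
  set c : ℝ := a⁻¹ ^ (a ^ 2) * b⁻¹ ^ (b ^ 2) with hc
  have hc0 : 0 < c := by positivity
  have hlogc : Real.log c = -(a ^ 2 * Real.log a) - b ^ 2 * Real.log b := by
    rw [hc, Real.log_mul (by positivity) (by positivity), Real.log_rpow (by positivity),
      Real.log_rpow (by positivity), Real.log_inv, Real.log_inv]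
    ring
  have hmean : ∀ x y : ℝ, 0 ≤ x → 0 ≤ y → c * (x ^ (a ^ 2) * y ^ (b ^ 2)) ≤ a * x + b * y := by
    intro x y hx hy
    have := Real.geom_mean_le_arith_mean2_weighted (sq_nonneg a) (sq_nonneg b)
      (mul_nonneg (inv_nonneg.2 ha.le) hx) (mul_nonneg (inv_nonneg.2 hb.le) hy) hab
    rw [Real.mul_rpow (by positivity) hx, Real.mul_rpow (by positivity) hy] at this
    calc _ = a⁻¹ ^ a ^ 2 * x ^ a ^ 2 * (b⁻¹ ^ b ^ 2 * y ^ b ^ 2) := by rw [hc]; ring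
      _ ≤ _ := this
      _ = _ := by field_simp
  clear_value c
  set γ := gaussianPi n
  set φ := gaussianPiPDFReal n
  have hγ : γ = volume.withDensity fun x => ENNReal.ofReal (φ x) := gaussianPi_eq_withDensity n
  have hγac : γ ≪ volume := hγ ▸ withDensity_absolutelyContinuous _ _
  set P := γ.prod γ
  have hrot := measurePreserving_rotation_gaussianPi n hab ha hb
  have hG₁ : MeasurePreserving (fun p : (Fin n → ℝ) × (Fin n → ℝ) => a • p.1 - b • p.2) P γ :=
    measurePreserving_fst.comp hrot
  have hG₂ : MeasurePreserving (fun p : (Fin n → ℝ) × (Fin n → ℝ) => b • p.1 + a • p.2) P γ :=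
    measurePreserving_snd.comp hrot
  set G₁ := fun p : (Fin n → ℝ) × (Fin n → ℝ) => a • p.1 - b • p.2 with hG₁def
  set G₂ := fun p : (Fin n → ℝ) × (Fin n → ℝ) => b • p.1 + a • p.2 with hG₂def
  have hTm := hT.measurable
  have hUm := hU.measurable
  have hJm := hT.measurable_jacobian
  have hKm := hU.measurable_jacobian
  have hTp : MeasurePreserving T γ (volume.withDensity fun x => ENNReal.ofReal (f x)) :=
    ⟨hTm, hTmap⟩
  have hUp : MeasurePreserving U γ (volume.withDensity fun x => ENNReal.ofReal (g x)) :=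
    ⟨hUm, hUmap⟩
  have hΘ : MeasurePreserving (fun p => T (G₁ p) + U (G₂ p)) P
      (volume.withDensity fun x => ENNReal.ofReal (h x)) := by
    have : MeasurePreserving (fun p : (Fin n → ℝ) × (Fin n → ℝ) => p.1 + p.2)
      ((volume.withDensity fun x => ENNReal.ofReal (f x)).prod
        (volume.withDensity fun x => ENNReal.ofReal (g x)))
      (volume.withDensity fun x => ENNReal.ofReal (h x)) := ⟨by fun_prop, hadd⟩
    exact (this.comp (hTp.prod hUp)).comp hrot
  obtain ⟨hfi', hfe⟩ := integrable_log_comp_of_measurePreserving hf hf0 (hTp.comp hG₁) hfi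
  obtain ⟨hgi', hge⟩ := integrable_log_comp_of_measurePreserving hg hg0 (hUp.comp hG₂) hgi
  obtain ⟨hhi', hhe⟩ := integrable_log_comp_of_measurePreserving hh hh0 hΘ hhi
  simp only [Function.comp_def] at hfi' hfe hgi' hge
  have hφi := integrable_log_gaussianPiPDFReal n
  have hcomp : ∀ {A : (Fin n → ℝ) × (Fin n → ℝ) → Fin n → ℝ}, MeasurePreserving A P γ →
      Integrable (fun p => Real.log (φ (A p))) P ∧
        ∫ p, Real.log (φ (A p)) ∂P = ∫ x, Real.log (φ x) ∂γ := fun {A} hA => by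
    refine ⟨hA.integrable_comp_of_integrable hφi, ?_⟩
    rw [← hA.map_eq, integral_map hA.measurable.aemeasurable]
    exact (Real.measurable_log.comp (measurable_gaussianPiPDFReal n)).aestronglyMeasurable
  obtain ⟨hℓ₀, hℓ₀e⟩ := hcomp (measurePreserving_fst (μ := γ) (ν := γ))
  obtain ⟨hℓ₁, hℓ₁e⟩ := hcomp hG₁
  obtain ⟨hℓ₂, hℓ₂e⟩ := hcomp hG₂
  have hφm : Measurable φ := measurable_gaussianPiPDFReal n
  have hG₁m : Measurable G₁ := hG₁.measurable
  have hG₂m : Measurable G₂ := hG₂.measurable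
  set W : (Fin n → ℝ) × (Fin n → ℝ) → ℝ := fun p =>
    c ^ n * (J (G₁ p) ^ (a ^ 2) * K (G₂ p) ^ (b ^ 2)) with hW
  have hW0 : ∀ p, 0 ≤ W p := fun p => mul_nonneg (by positivity)
    (mul_nonneg (Real.rpow_nonneg (hT.jacobian_nonneg _) _)
      (Real.rpow_nonneg (hU.jacobian_nonneg _) _))
  have hWm : Measurable W := by fun_prop
  set R : (Fin n → ℝ) × (Fin n → ℝ) → ℝ := fun p =>
    h (T (G₁ p) + U (G₂ p)) * W p / φ p.1 with hR
  have hRm : Measurable R := by fun_prop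
  have hR0 : ∀ p, 0 ≤ R p := fun p =>
    div_nonneg (mul_nonneg (hh0 _) (hW0 p)) (gaussianPiPDFReal_pos n _).le
  have hh1 : ∫⁻ x, ENNReal.ofReal (h x) = 1 := by
    have hf2 : IsProbabilityMeasure (volume.withDensity fun x => ENNReal.ofReal (f x)) :=
      ⟨by rw [withDensity_apply _ .univ, Measure.restrict_univ, hf1]⟩
    have hg2 : IsProbabilityMeasure (volume.withDensity fun x => ENNReal.ofReal (g x)) :=
      ⟨by rw [withDensity_apply _ .univ, Measure.restrict_univ, hg1]⟩
    rw [← setLIntegral_univ, ← withDensity_apply _ .univ, ← hadd,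
      Measure.map_apply (by fun_prop) .univ, Set.preimage_univ, measure_univ]
  have hRint : ∫⁻ p, ENNReal.ofReal (R p) ∂P ≤ 1 := by
    rw [lintegral_prod_symm' _ (by fun_prop)]
    calc _ ≤ ∫⁻ _ : Fin n → ℝ, 1 ∂γ := by
          refine lintegral_mono fun z => ?_
          rw [hγ, lintegral_withDensity_eq_lintegral_mul _ (by fun_prop) (by fun_prop), ← hh1]
          refine le_trans (le_of_eq (lintegral_congr fun w => ?_))
            (hT.lintegral_comp_add_le hU ha hb hc0.le hmean (-(b • z)) (a • z)
              (q := fun x => ENNReal.ofReal (h x)) (by fun_prop))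
          have hp := gaussianPiPDFReal_pos n w
          simp only [Pi.mul_apply]
          rw [← ENNReal.ofReal_mul hp.le, ← ENNReal.ofReal_mul (hh0 _)]
          congr 1
          simp only [hR, hW, hG₁def, hG₂def, ← sub_eq_add_neg]
          exact mul_div_cancel₀ _ hp.ne'
      _ = 1 := by simp
  have hRi : Integrable R P :=
    ⟨hRm.aestronglyMeasurable, by
      rw [hasFiniteIntegral_iff_ofReal (Filter.Eventually.of_forall hR0)]
      exact hRint.trans_lt ENNReal.one_lt_top⟩
  have hRle : ∫ p, R p ∂P ≤ 1 := by
    rw [integral_eq_lintegral_of_nonneg_ae (Filter.Eventually.of_forall hR0)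
      hRm.aestronglyMeasurable]
    exact ENNReal.toReal_le_of_le_ofReal zero_le_one (by simpa using hRint)
  have hTJ' : ∀ᵐ p ∂P, 0 < f (T (G₁ p)) ∧ f (T (G₁ p)) * J (G₁ p) = φ (G₁ p) :=
    hG₁.quasiMeasurePreserving.ae (hγac.ae_le hTJ)
  have hUK' : ∀ᵐ p ∂P, 0 < g (U (G₂ p)) ∧ g (U (G₂ p)) * K (G₂ p) = φ (G₂ p) :=
    hG₂.quasiMeasurePreserving.ae (hγac.ae_le hUK)
  have hpos : ∀ᵐ p ∂P, 0 < h (T (G₁ p) + U (G₂ p)) := by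
    refine hΘ.quasiMeasurePreserving.ae (p := fun x => 0 < h x) ?_
    rw [ae_withDensity_iff (by fun_prop)]
    refine Filter.Eventually.of_forall fun x hx => ?_
    simpa using hx
  have hkey : ∫ p, (Real.log (h (T (G₁ p) + U (G₂ p))) + n * Real.log c +
      a ^ 2 * (Real.log (φ (G₁ p)) - Real.log (f (T (G₁ p)))) +
      b ^ 2 * (Real.log (φ (G₂ p)) - Real.log (g (U (G₂ p)))) - Real.log (φ p.1)) ∂P ≤
      ∫ p, (R p - 1) ∂P := by
    refine integral_mono_ae (by fun_prop) (by fun_prop) ?_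
    filter_upwards [hTJ', hUK', hpos] with p ⟨hfp, hJp⟩ ⟨hgp, hKp⟩ hhp
    have hφ₀ : 0 < φ p.1 := gaussianPiPDFReal_pos n _
    have hφ₁ : 0 < φ (G₁ p) := gaussianPiPDFReal_pos n _
    have hφ₂ : 0 < φ (G₂ p) := gaussianPiPDFReal_pos n _
    have hJ : 0 < J (G₁ p) := pos_of_mul_pos_right (hJp ▸ hφ₁) hfp.le
    have hK : 0 < K (G₂ p) := pos_of_mul_pos_right (hKp ▸ hφ₂) hgp.le
    have hRp : 0 < R p := by positivity
    refine le_trans (le_of_eq ?_) (Real.log_le_sub_one_of_pos hRp)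
    rw [← hJp, ← hKp, Real.log_mul hfp.ne' hJ.ne', Real.log_mul hgp.ne' hK.ne', hR]
    simp only [hW]
    rw [Real.log_div (by positivity) hφ₀.ne', Real.log_mul hhp.ne' (by positivity),
      Real.log_mul (pow_pos hc0 n).ne' (by positivity), Real.log_pow,
      Real.log_mul (Real.rpow_pos_of_pos hJ _).ne' (Real.rpow_pos_of_pos hK _).ne',
      Real.log_rpow hJ, Real.log_rpow hK]
    ring
  rw [integral_sub hRi (integrable_const _), integral_sub (by fun_prop) hℓ₀,
    integral_add (by fun_prop) (by fun_prop), integral_add (by fun_prop) (by fun_prop),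
    integral_add hhi' (by fun_prop), integral_const_mul, integral_const_mul,
    integral_const_mul,
    integral_sub hℓ₁ hfi', integral_sub hℓ₂ hgi', hℓ₀e, hℓ₁e, hℓ₂e, hfe, hge, hhe, hlogc] at hkey
  simp only [integral_const, probReal_univ, one_smul] at hkey
  have : (∫ x, Real.log (φ x) ∂γ) * (a ^ 2 + b ^ 2) = ∫ x, Real.log (φ x) ∂γ := by
    rw [hab, mul_one]
  linarith

lemma exists_measurable_leftInverse_mul_log {s : Set ℝ} (hs : MeasurableSet s)
    (hinj : Set.InjOn (fun x => x * Real.log x) s) :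
    ∃ k : ℝ → ℝ, Measurable k ∧ ∀ x ∈ s, k (x * Real.log x) = x := by
  obtain ⟨k, hk, hks⟩ := (Real.continuous_mul_log.continuousOn.measurableEmbedding hs
    hinj).exists_measurable_extend (measurable_subtype_coe (p := (· ∈ s))) fun _ => ⟨0⟩
  exact ⟨k, hk, fun x hx => congrFun hks ⟨x, hx⟩⟩

lemma exists_mem_Icc_mul_log_eq {y : ℝ} (hy : 0 ≤ y) (hy' : y * Real.log y ≤ 0) :
    ∃ x ∈ Set.Icc 0 (Real.exp (-1)), x * Real.log x = y * Real.log y := by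
  rcases le_total y (Real.exp (-1)) with h | h
  · exact ⟨y, ⟨hy, h⟩, rfl⟩
  · have h1 := intermediate_value_Icc' (Real.exp_pos (-1)).le
      Real.continuous_mul_log.continuousOn
    refine h1 ⟨?_, by simpa using hy'⟩
    exact Real.mul_log_strictMonoOn.monotoneOn Set.self_mem_Ici h h

/-- A density `F` such that `F log F` is a.e. measurable can be replaced by a measurable density
with the same entropy. -/
lemma exists_measurable_density {E : Type*} [MeasurableSpace E] {μ : Measure E} [SigmaFinite μ]
    {F : E → ℝ} (hF0 : ∀ x, 0 ≤ F x) (hF : AEMeasurable (fun x => F x * Real.log (F x)) μ) :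
    ∃ G : E → ℝ, Measurable G ∧ (∀ x, 0 ≤ G x) ∧
      (μ.withDensity fun x => ENNReal.ofReal (G x)) =
        (μ.withDensity fun x => ENNReal.ofReal (F x)) ∧
      (fun x => G x * Real.log (G x)) =ᵐ[μ] fun x => F x * Real.log (F x) := by
  obtain ⟨g, hgm, hgF, hg⟩ := exists_measurable_le_withDensity_eq μ fun x => ENNReal.ofReal (F x)
  have hG : ∀ x, ENNReal.ofReal (g x).toReal = g x := fun x =>
    ENNReal.ofReal_toReal ((hgF x).trans_lt ENNReal.ofReal_lt_top).ne
  have hGF : ∀ x, (g x).toReal ≤ F x := fun x => ENNReal.toReal_le_of_le_ofReal (hF0 x) (hgF x)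
  refine ⟨fun x => (g x).toReal, hgm.ennreal_toReal, fun x => ENNReal.toReal_nonneg,
    by simpa only [hG] using hg, ?_⟩
  set G := fun x => (g x).toReal
  have hGm : Measurable G := hgm.ennreal_toReal
  have hmax : ∀ {A : Set E} {k : E → ℝ}, MeasurableSet A → Measurable k →
      (∀ᵐ x ∂μ, x ∈ A → k x ≤ F x) → ∀ᵐ x ∂μ, x ∈ A → k x ≤ G x := by
    intro A k hA hk hkF
    have h1 : A.indicator (fun x => ENNReal.ofReal (k x)) ≤ᵐ[μ] g := by
      refine ae_le_of_forall_setLIntegral_le_of_sigmaFinite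
        ((by fun_prop : Measurable fun x => ENNReal.ofReal (k x)).indicator hA) fun s hs _ => ?_
      rw [← withDensity_apply g hs, hg, withDensity_apply _ hs]
      refine lintegral_mono_ae (ae_restrict_of_ae ?_)
      filter_upwards [hkF] with x hx
      by_cases hxA : x ∈ A
      · simpa [hxA] using ENNReal.ofReal_le_ofReal (hx hxA)
      · simp [hxA]
    filter_upwards [h1] with x hx hxA
    rw [Set.indicator_of_mem hxA] at hx
    exact (ENNReal.ofReal_le_iff_le_toReal
      ((hgF x).trans_lt ENNReal.ofReal_lt_top).ne).1 hx
  obtain ⟨u, hum, hu⟩ := hF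
  obtain ⟨k, hkm, hk⟩ := exists_measurable_leftInverse_mul_log measurableSet_Icc
    Real.mul_log_strictAntiOn.injOn
  obtain ⟨l, hlm, hl⟩ := exists_measurable_leftInverse_mul_log measurableSet_Ici
    Real.mul_log_strictMonoOn.injOn
  have hlF : ∀ x, F x * Real.log (F x) = u x → Real.exp (-1) ≤ F x → l (u x) = F x :=
    fun x hx hxc => hx ▸ hl _ hxc
  have hkF : ∀ x, F x * Real.log (F x) = u x → F x ≤ Real.exp (-1) → k (u x) = F x :=
    fun x hx hxc => hx ▸ hk _ ⟨hF0 x, hxc⟩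
  have hpos : ∀ x, F x * Real.log (F x) = u x → 0 < u x → Real.exp (-1) ≤ F x := by
    intro x hx hux
    by_contra! hlt
    have : F x * Real.log (F x) ≤ 0 := Real.mul_log_nonpos (hF0 x)
      (hlt.le.trans (Real.exp_le_one_iff.2 (by norm_num)))
    linarith
  have hlarge : ∀ x, F x * Real.log (F x) = u x → k (u x) < G x → Real.exp (-1) ≤ F x := by
    intro x hx hux
    by_contra! hlt
    exact absurd (hGF x) (not_le.2 (hkF x hx hlt.le ▸ hux))
  have hsmall : ∀ x, F x * Real.log (F x) = u x → u x ≤ 0 →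
      k (u x) ≤ F x ∧ k (u x) * Real.log (k (u x)) = u x := by
    intro x hx hux
    obtain ⟨y, hy, hyF⟩ := exists_mem_Icc_mul_log_eq (hF0 x) (hx.trans_le hux)
    have hky : k (u x) = y := by rw [← hx, ← hyF, hk y hy]
    refine ⟨?_, by rw [hky, hyF, hx]⟩
    rcases le_total (F x) (Real.exp (-1)) with h | h
    · exact (hkF x hx h).le
    · exact hky ▸ hy.2.trans h
  have h1 := hmax (A := {x | 0 < u x}) (k := fun x => l (u x)) (by measurability) (by fun_prop)
    (hu.mono fun x hx hxA => (hlF x hx (hpos x hx hxA)).le)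
  have h2 := hmax (A := {x | k (u x) < G x}) (k := fun x => l (u x))
    (measurableSet_lt (by fun_prop) hGm) (by fun_prop)
    (hu.mono fun x hx hxA => (hlF x hx (hlarge x hx hxA)).le)
  have h3 := hmax (A := {x | u x ≤ 0}) (k := fun x => k (u x)) (by measurability) (by fun_prop)
    (hu.mono fun x hx hxA => (hsmall x hx hxA).1)
  filter_upwards [hu, h1, h2, h3] with x hx hx1 hx2 hx3
  have hle : Real.exp (-1) ≤ F x → l (u x) ≤ G x → G x = F x := fun hc hxl =>
    le_antisymm (hGF x) (hlF x hx hc ▸ hxl)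
  rcases lt_or_ge (k (u x)) (G x) with h | h
  · rw [hle (hlarge x hx h) (hx2 h)]
  rcases lt_or_ge 0 (u x) with h' | h'
  · rw [hle (hpos x hx h') (hx1 h')]
  · rw [le_antisymm h (hx3 h'), (hsmall x hx h').2, hx]

/-- The entropy power inequality for possibly nonmeasurable densities, in Lieb's form. -/
theorem entropy_add_ge_of_sq_add_sq_eq_one' {n : ℕ} {f g h : (Fin n → ℝ) → ℝ}
    {μ ν : Measure (Fin n → ℝ)} [IsProbabilityMeasure μ] [IsProbabilityMeasure ν]
    (hf0 : ∀ x, 0 ≤ f x) (hg0 : ∀ x, 0 ≤ g x) (hh0 : ∀ x, 0 ≤ h x)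
    (hf : μ = volume.withDensity fun x => ENNReal.ofReal (f x))
    (hg : ν = volume.withDensity fun x => ENNReal.ofReal (g x))
    (hadd : (μ.prod ν).map (fun p => p.1 + p.2) =
      volume.withDensity fun x => ENNReal.ofReal (h x))
    (hfi : Integrable fun x => f x * Real.log (f x))
    (hgi : Integrable fun x => g x * Real.log (g x))
    (hhi : Integrable fun x => h x * Real.log (h x))
    {a b : ℝ} (ha : 0 < a) (hb : 0 < b) (hab : a ^ 2 + b ^ 2 = 1) :
    a ^ 2 * (-∫ x, f x * Real.log (f x)) + b ^ 2 * (-∫ x, g x * Real.log (g x)) +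
      n * (-(a ^ 2 * Real.log a) - b ^ 2 * Real.log b) ≤ -∫ x, h x * Real.log (h x) := by
  obtain ⟨f', hfm', hf0', hf', hfl⟩ := exists_measurable_density hf0 hfi.aemeasurable
  obtain ⟨g', hgm', hg0', hg', hgl⟩ := exists_measurable_density hg0 hgi.aemeasurable
  obtain ⟨h', hhm', hh0', hh', hhl⟩ := exists_measurable_density hh0 hhi.aemeasurable
  rw [← hf'] at hf
  rw [← hg'] at hg
  rw [← integral_congr_ae hfl, ← integral_congr_ae hgl, ← integral_congr_ae hhl]
  refine entropy_add_ge_of_sq_add_sq_eq_one hfm' hgm' hhm' hf0' hg0' hh0' ?_ ?_ ?_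
    (hfi.congr hfl.symm) (hgi.congr hgl.symm) (hhi.congr hhl.symm) ha hb hab
  · rw [← setLIntegral_univ, ← withDensity_apply _ .univ, ← hf, measure_univ]
  · rw [← setLIntegral_univ, ← withDensity_apply _ .univ, ← hg, measure_univ]
  · rw [← hf, ← hg, hadd, hh']

/-- Lieb's form of the entropy power inequality implies the exponential form. -/
lemma exp_add_exp_le_of_forall_sq_add_sq_eq_one {n : ℕ} (hn : 0 < n) {r s t : ℝ}
    (H : ∀ a b : ℝ, 0 < a → 0 < b → a ^ 2 + b ^ 2 = 1 →
      a ^ 2 * s + b ^ 2 * t + n * (-(a ^ 2 * Real.log a) - b ^ 2 * Real.log b) ≤ r) :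
    Real.exp (2 * s / n) + Real.exp (2 * t / n) ≤ Real.exp (2 * r / n) := by
  have hn' : (0 : ℝ) < n := Nat.cast_pos.2 hn
  set A := 2 * s / n with hA
  set B := 2 * t / n with hB
  have hs : s = n * A / 2 := by rw [hA]; field_simp
  have ht : t = n * B / 2 := by rw [hB]; field_simp
  set Z := Real.exp A + Real.exp B with hZ
  have hZ0 : 0 < Z := by positivity
  have hlog : ∀ C, Real.log √(Real.exp C / Z) = (C - Real.log Z) / 2 := fun C => by
    rw [Real.log_sqrt (by positivity), Real.log_div (Real.exp_pos _).ne' hZ0.ne', Real.log_exp]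
  have hsq : ∀ C, √(Real.exp C / Z) ^ 2 = Real.exp C / Z := fun C =>
    Real.sq_sqrt (by positivity)
  have hsum : Real.exp A / Z + Real.exp B / Z = 1 := by rw [← add_div, ← hZ, div_self hZ0.ne']
  have h := H √(Real.exp A / Z) √(Real.exp B / Z) (by positivity) (by positivity)
    (by rw [hsq, hsq, hsum])
  rw [hsq, hsq, hlog, hlog, hs, ht] at h
  rw [← Real.exp_log hZ0]
  refine Real.exp_le_exp.2 ((le_div_iff₀ hn').2 ?_)
  linear_combination 2 * h - n * Real.log Z * hsum

/-- Conditional Entropy Power Inequality: let `X, Y : Ω → ℝ^n` be random vectors and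
`M : Ω → S` a random variable with values in a standard Borel space, such that `X` and
`Y` are conditionally independent given `M` (the regular conditional distribution of
`(X,Y)` given `M = m` is the product of those of `X` and of `Y` given `M = m`, for
`(P∘M⁻¹)`-a.e. `m`). Assume that for a.e. `m` the regular conditional distributions of
`X`, `Y` and `X+Y` given `M = m` have densities `f_m`, `g_m`, `h_m` with respect to
Lebesgue measure, with `f_m ln f_m`, `g_m ln g_m`, `h_m ln h_m` integrable for a.e. `m`,
and the conditional entropies `S(X|M) = ∫ (−∫ f_m ln f_m) d(P∘M⁻¹)(m)` etc. are
well-defined and finite. Then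
`exp(2 S(X+Y|M)/n) ≥ exp(2 S(X|M)/n) + exp(2 S(Y|M)/n)`. -/
theorem conditional_entropy_power_inequality {Ω : Type*} [MeasureSpace Ω]
    [IsProbabilityMeasure (ℙ : Measure Ω)]
    {S : Type*} [MeasurableSpace S] [StandardBorelSpace S]
    {n : ℕ} (hn : 0 < n)
    (X Y : Ω → (Fin n → ℝ)) (hX : Measurable X) (hY : Measurable Y)
    (M : Ω → S) (hM : Measurable M)
    (hcondindep : ∀ᵐ m ∂Measure.map M ℙ,
      condDistrib (fun ω => (X ω, Y ω)) M ℙ m =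
        (condDistrib X M ℙ m).prod (condDistrib Y M ℙ m))
    (f g h : S → (Fin n → ℝ) → ℝ)
    (hf0 : ∀ m x, 0 ≤ f m x) (hg0 : ∀ m x, 0 ≤ g m x) (hh0 : ∀ m x, 0 ≤ h m x)
    (hfd : ∀ᵐ m ∂Measure.map M ℙ,
      condDistrib X M ℙ m = volume.withDensity fun x => ENNReal.ofReal (f m x))
    (hgd : ∀ᵐ m ∂Measure.map M ℙ,
      condDistrib Y M ℙ m = volume.withDensity fun x => ENNReal.ofReal (g m x))
    (hhd : ∀ᵐ m ∂Measure.map M ℙ,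
      condDistrib (X + Y) M ℙ m = volume.withDensity fun x => ENNReal.ofReal (h m x))
    (hfi : ∀ᵐ m ∂Measure.map M ℙ,
      Integrable (fun x => f m x * Real.log (f m x)) volume)
    (hgi : ∀ᵐ m ∂Measure.map M ℙ,
      Integrable (fun x => g m x * Real.log (g m x)) volume)
    (hhi : ∀ᵐ m ∂Measure.map M ℙ,
      Integrable (fun x => h m x * Real.log (h m x)) volume)
    (hfI : Integrable (fun m => -∫ x, f m x * Real.log (f m x)) (Measure.map M ℙ))
    (hgI : Integrable (fun m => -∫ x, g m x * Real.log (g m x)) (Measure.map M ℙ))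
    (hhI : Integrable (fun m => -∫ x, h m x * Real.log (h m x)) (Measure.map M ℙ)) :
    Real.exp
        (2 * (∫ m, (-∫ x, h m x * Real.log (h m x)) ∂Measure.map M ℙ) / n) ≥
      Real.exp
          (2 * (∫ m, (-∫ x, f m x * Real.log (f m x)) ∂Measure.map M ℙ) / n) +
        Real.exp
          (2 * (∫ m, (-∫ x, g m x * Real.log (g m x)) ∂Measure.map M ℙ) / n) := by
  have hPM : IsProbabilityMeasure (Measure.map M ℙ) :=
    Measure.isProbabilityMeasure_map hM.aemeasurable
  refine exp_add_exp_le_of_forall_sq_add_sq_eq_one hn fun a b ha hb hab => ?_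
  have hadd : ∀ᵐ m ∂Measure.map M ℙ, condDistrib (X + Y) M ℙ m =
      ((condDistrib X M ℙ m).prod (condDistrib Y M ℙ m)).map fun p => p.1 + p.2 := by
    have h := condDistrib_comp (mβ := inferInstance) (μ := (ℙ : Measure Ω)) M
      (Y := fun ω => (X ω, Y ω)) (by fun_prop) (f := fun p => p.1 + p.2) (by fun_prop)
    filter_upwards [h, hcondindep] with m hm hm'
    rw [← hm', ← Kernel.map_apply _ (by fun_prop), ← hm]
    rfl
  calc _ = ∫ m, (a ^ 2 * (-∫ x, f m x * Real.log (f m x)) +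
        b ^ 2 * (-∫ x, g m x * Real.log (g m x)) +
        n * (-(a ^ 2 * Real.log a) - b ^ 2 * Real.log b)) ∂Measure.map M ℙ := by
        rw [integral_add (by fun_prop) (by fun_prop), integral_add (by fun_prop) (by fun_prop),
          integral_const_mul, integral_const_mul, integral_const, probReal_univ, one_smul]
    _ ≤ _ := by
        refine integral_mono_ae (by fun_prop) hhI ?_
        filter_upwards [hadd, hfd, hgd, hhd, hfi, hgi, hhi] with m hm hf hg hh hf' hg' hh'
        exact entropy_add_ge_of_sq_add_sq_eq_one' (hf0 m) (hg0 m) (hh0 m) hf hg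
          (hm.symm.trans hh) hf' hg' hh' ha hb hab
end

section
/- Majorization theorem for the thinning: let 0 ≤ λ ≤ 1 and let p : ℕ → ℝ be a probability distribution on ℕ (p_n ≥ 0 for all n and ∑_n p_n = 1). Let σ : ℕ → ℕ be a bijection such that the sequence p↓ defined by p↓_n = p_{σ(n)} is nonincreasing. Then T_λ(p) is majorized by T_λ(p↓): there exists a doubly stochastic infinite matrix A : ℕ × ℕ → ℝ (i.e., A_{mn} ≥ 0 for all m, n, and ∑_k A_{nk} = 1 and ∑_k A_{kn} = 1 for every n) such that (T_λ(p))_n = ∑_{k=0}^∞ A_{nk} (T_λ(p↓))_k for every n ∈ ℕ. -/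
/-- The thinning with parameter `λ` of a (summable) sequence `x : ℕ → ℝ`:
`(T_λ x)_n = ∑_{k} (k choose n) λ^n (1−λ)^{k−n} x_k` (the binomial coefficient vanishes
for `k < n`, so this is the sum from `k = n`; the convention `0^0 = 1` is Lean's). -/
noncomputable def thin (lam : ℝ) (x : ℕ → ℝ) : ℕ → ℝ :=
  fun n => ∑' k : ℕ, (k.choose n : ℝ) * lam ^ n * (1 - lam) ^ (k - n) * x k

/-- An infinite matrix `A : ℕ × ℕ → ℝ` is doubly stochastic if it has nonnegative entries
and all its rows and columns sum to `1`. -/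
def DoublyStochastic (A : ℕ → ℕ → ℝ) : Prop :=
  (∀ m n, 0 ≤ A m n) ∧ (∀ n, HasSum (fun k => A n k) 1) ∧ (∀ n, HasSum (fun k => A k n) 1)

section Preliminaries

open Finset

section SumInterchange

theorem hasSum_tsum_of_nonneg {f : ℕ → ℕ → ℝ} {g : ℕ → ℝ} {s : ℝ} (hf : ∀ k n, 0 ≤ f k n)
    (hg : ∀ k, HasSum (f k) (g k)) (hs : HasSum g s) :
    (∀ n, Summable fun k => f k n) ∧ HasSum (fun n => ∑' k, f k n) s := by
  have hsum : Summable fun x : ℕ × ℕ => f x.1 x.2 := by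
    refine (summable_prod_of_nonneg fun x => hf x.1 x.2).2 ⟨fun k => (hg k).summable, ?_⟩
    simpa only [(hg _).tsum_eq] using hs.summable
  have hswap : Summable fun x : ℕ × ℕ => f x.2 x.1 := hsum.prod_symm
  refine ⟨hswap.prod_factor, ?_⟩
  have h : ∑' n, ∑' k, f k n = s := by
    rw [Summable.tsum_comm (f := fun k n => f k n) hsum]
    simpa only [(hg _).tsum_eq] using hs.tsum_eq
  exact h ▸ hswap.prod.hasSum

end SumInterchange

section Transfer

/-- The combination of the entries `k` and `k + 1` of `x` that a transfer removes from `x`. -/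
def transferOut (k : ℕ) (t : ℝ) (x : ℕ → ℝ) : ℝ := t * x k + (1 - t) * x (k + 1)

/-- The sequence left after `transferOut k t x` has been removed from `x`: the entries `k` and
`k + 1` are merged into the complementary combination. -/
def transferRest (k : ℕ) (t : ℝ) (x : ℕ → ℝ) (i : ℕ) : ℝ :=
  if i < k then x i else if i = k then (1 - t) * x k + t * x (k + 1) else x (i + 1)

theorem sum_range_transferRest_of_le {k : ℕ} (t : ℝ) (x : ℕ → ℝ) {N : ℕ} (h : N ≤ k) :
    ∑ i ∈ range N, transferRest k t x i = ∑ i ∈ range N, x i :=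
  sum_congr rfl fun _ hi => if_pos ((mem_range.1 hi).trans_le h)

theorem sum_range_transferRest_of_lt {k : ℕ} (t : ℝ) (x : ℕ → ℝ) {N : ℕ} (h : k + 1 ≤ N) :
    ∑ i ∈ range N, transferRest k t x i = ∑ i ∈ range (N + 1), x i - transferOut k t x := by
  induction N, h using Nat.le_induction with
  | base =>
    rw [sum_range_succ, sum_range_transferRest_of_le t x le_rfl, sum_range_succ, sum_range_succ]
    simp only [transferRest, transferOut, lt_irrefl, if_false, if_true]
    ring
  | succ N hN ih =>
    rw [sum_range_succ, ih, sum_range_succ _ (N + 1)]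
    have h1 : ¬ N < k := by omega
    have h2 : N ≠ k := by omega
    simp only [transferRest, h1, h2, if_false]
    ring

theorem hasSum_transferRest (k : ℕ) (t : ℝ) {x : ℕ → ℝ} {s : ℝ} (hx : HasSum x s) :
    HasSum (transferRest k t x) (s - transferOut k t x) := by
  have h1 := (hasSum_nat_add_iff' (k + 2)).2 hx
  rw [← hasSum_nat_add_iff' (k + 1), sum_range_transferRest_of_lt t x le_rfl]
  convert h1 using 1
  · ext i
    have h1 : ¬ i + (k + 1) < k := by omega
    have h2 : i + (k + 1) ≠ k := by omega
    simp only [transferRest, h1, h2, if_false]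
    rfl
  · ring

theorem transferOut_nonneg (k : ℕ) {t : ℝ} (ht0 : 0 ≤ t) (ht1 : t ≤ 1) {x : ℕ → ℝ}
    (hx : ∀ i, 0 ≤ x i) : 0 ≤ transferOut k t x :=
  add_nonneg (mul_nonneg ht0 (hx _)) (mul_nonneg (sub_nonneg.2 ht1) (hx _))

theorem transferRest_nonneg (k : ℕ) {t : ℝ} (ht0 : 0 ≤ t) (ht1 : t ≤ 1) {x : ℕ → ℝ}
    (hx : ∀ i, 0 ≤ x i) (i : ℕ) : 0 ≤ transferRest k t x i := by
  unfold transferRest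
  split_ifs
  · exact hx _
  · exact add_nonneg (mul_nonneg (sub_nonneg.2 ht1) (hx _)) (mul_nonneg ht0 (hx _))
  · exact hx _

theorem transferRest_le (k : ℕ) {t : ℝ} (ht0 : 0 ≤ t) {x : ℕ → ℝ} (hx : Antitone x) (i : ℕ) :
    transferRest k t x i ≤ x i := by
  unfold transferRest
  split_ifs with h1 h2
  · exact le_rfl
  · subst h2
    nlinarith [hx i.le_succ]
  · exact hx i.le_succ

theorem antitone_transferRest (k : ℕ) {t : ℝ} (ht0 : 0 ≤ t) (ht1 : t ≤ 1) {x : ℕ → ℝ}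
    (hx : Antitone x) : Antitone (transferRest k t x) := by
  refine antitone_nat_of_succ_le fun i => ?_
  rcases lt_or_ge i k with hi | hi
  · exact (transferRest_le k ht0 hx (i + 1)).trans <| by
      simpa only [transferRest, hi, if_true] using hx i.le_succ
  · have h1 : ¬ i + 1 < k := by omega
    have h2 : i + 1 ≠ k := by omega
    have h3 : ¬ i < k := by omega
    simp only [transferRest, h1, h2, h3, if_false]
    have h4 := hx (i + 1).le_succ
    split_ifs with h
    · subst h
      nlinarith [hx i.le_succ]
    · exact h4

theorem hasSum_transferOut (k : ℕ) (t : ℝ) {f : ℕ → ℕ → ℝ} {x : ℕ → ℝ}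
    (h : ∀ i, HasSum (f i) (x i)) :
    HasSum (fun j => transferOut k t fun i => f i j) (transferOut k t x) :=
  ((h k).mul_left t).add ((h (k + 1)).mul_left (1 - t))

theorem hasSum_transferRest_apply (k : ℕ) (t : ℝ) {f : ℕ → ℕ → ℝ} {x : ℕ → ℝ}
    (h : ∀ i, HasSum (f i) (x i)) (i : ℕ) :
    HasSum (fun j => transferRest k t (fun i => f i j) i) (transferRest k t x i) := by
  unfold transferRest
  split_ifs
  · exact h i
  · exact ((h k).mul_left (1 - t)).add ((h (k + 1)).mul_left t)
  · exact h (i + 1)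

theorem transferOut_mul_const (k : ℕ) (t : ℝ) (x : ℕ → ℝ) (c : ℝ) :
    transferOut k t (fun i => x i * c) = transferOut k t x * c := by
  unfold transferOut; ring

theorem transferRest_mul_const (k : ℕ) (t : ℝ) (x : ℕ → ℝ) (c : ℝ) (i : ℕ) :
    transferRest k t (fun i => x i * c) i = transferRest k t x i * c := by
  unfold transferRest; split_ifs <;> ring

/-- The sequence left after `n` successive transfers with parameters `κ` and `τ`. -/
def transferSeq (κ : ℕ → ℕ) (τ : ℕ → ℝ) (x : ℕ → ℝ) : ℕ → ℕ → ℝ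
  | 0 => x
  | n + 1 => transferRest (κ n) (τ n) (transferSeq κ τ x n)

/-- The matrix whose `n`-th row holds the coefficients of the `n`-th removed combination. -/
def transferMatrix (κ : ℕ → ℕ) (τ : ℕ → ℝ) (n j : ℕ) : ℝ :=
  transferOut (κ n) (τ n) (transferSeq κ τ (Pi.single j 1) n)

variable {κ : ℕ → ℕ} {τ : ℕ → ℝ}

theorem transferSeq_nonneg (hτ0 : ∀ n, 0 ≤ τ n) (hτ1 : ∀ n, τ n ≤ 1) {x : ℕ → ℝ}
    (hx : ∀ i, 0 ≤ x i) (n i : ℕ) : 0 ≤ transferSeq κ τ x n i := by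
  induction n generalizing i with
  | zero => exact hx i
  | succ n ih => exact transferRest_nonneg _ (hτ0 n) (hτ1 n) ih i

theorem single_one_nonneg (j i : ℕ) : (0 : ℝ) ≤ (Pi.single j 1 : ℕ → ℝ) i := by
  rw [Pi.single_apply]; split_ifs <;> norm_num

theorem transferMatrix_nonneg (hτ0 : ∀ n, 0 ≤ τ n) (hτ1 : ∀ n, τ n ≤ 1) (n j : ℕ) :
    0 ≤ transferMatrix κ τ n j :=
  transferOut_nonneg _ (hτ0 n) (hτ1 n) (transferSeq_nonneg hτ0 hτ1 (single_one_nonneg j) n)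

theorem hasSum_transferSeq (x : ℕ → ℝ) (n i : ℕ) :
    HasSum (fun j => transferSeq κ τ (Pi.single j 1) n i * x j) (transferSeq κ τ x n i) := by
  induction n generalizing i with
  | zero =>
    have h : (fun j => transferSeq κ τ (Pi.single j 1) 0 i * x j) =
        fun j => if j = i then x i else 0 := by
      funext j
      rcases eq_or_ne j i with rfl | hj
      · simp [transferSeq]
      · simp [transferSeq, hj, hj.symm]
    rw [h]
    exact hasSum_ite_eq i (x i)
  | succ n ih =>
    have h := hasSum_transferRest_apply (κ n) (τ n) ih i
    simp only [transferRest_mul_const] at h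
    exact h

theorem hasSum_transferMatrix_mul (x : ℕ → ℝ) (n : ℕ) :
    HasSum (fun j => transferMatrix κ τ n j * x j)
      (transferOut (κ n) (τ n) (transferSeq κ τ x n)) := by
  have h := hasSum_transferOut (κ n) (τ n) (hasSum_transferSeq (κ := κ) (τ := τ) x n)
  simp only [transferOut_mul_const] at h
  exact h

theorem transferSeq_one (n : ℕ) : transferSeq κ τ (fun _ => 1) n = fun _ => 1 := by
  induction n with
  | zero => rfl
  | succ n ih =>
    funext i
    simp only [transferSeq, ih, transferRest]
    split_ifs <;> ring

theorem hasSum_transferMatrix_row (n : ℕ) : HasSum (transferMatrix κ τ n) 1 := by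
  have h := hasSum_transferMatrix_mul (κ := κ) (τ := τ) (fun _ => 1) n
  rw [transferSeq_one] at h
  simpa [transferOut] using h

theorem hasSum_transferSeq_single (j N : ℕ) :
    HasSum (transferSeq κ τ (Pi.single j 1) N)
      (1 - ∑ n ∈ range N, transferMatrix κ τ n j) := by
  induction N with
  | zero => simpa [transferSeq] using hasSum_pi_single j (1 : ℝ)
  | succ N ih =>
    have h := hasSum_transferRest (κ N) (τ N) ih
    rwa [sub_sub, ← transferMatrix, ← sum_range_succ] at h

theorem sum_range_transferMatrix_le (hτ0 : ∀ n, 0 ≤ τ n) (hτ1 : ∀ n, τ n ≤ 1) (j N : ℕ) :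
    ∑ n ∈ range N, transferMatrix κ τ n j ≤ 1 :=
  sub_nonneg.1 <| (hasSum_transferSeq_single j N).nonneg
    (transferSeq_nonneg hτ0 hτ1 (single_one_nonneg j) N)

end Transfer

section Majorization

/-- The nonincreasing sequence `r` dominates `q` in the order of weak majorization, and no entry
of `q` lies below all entries of `r`. -/
structure Dominates (q r : ℕ → ℝ) : Prop where
  antitone : Antitone r
  sum_le : ∀ S : Finset ℕ, ∑ n ∈ S, q n ≤ ∑ i ∈ range (#S), r i
  exists_le : ∀ n, ∃ k, r k ≤ q n

theorem Dominates.exists_transfer {q r : ℕ → ℝ} (h : Dominates q r) :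
    ∃ (k : ℕ) (t : ℝ), 0 ≤ t ∧ t ≤ 1 ∧ transferOut k t r = q 0 ∧
      Dominates (fun n => q (n + 1)) (transferRest k t r) := by
  classical
  obtain ⟨k, hk1, hk2⟩ : ∃ k, r (k + 1) ≤ q 0 ∧ q 0 ≤ r k := by
    have h0 : q 0 ≤ r 0 := by simpa using h.sum_le {0}
    obtain hz | ⟨j, hj⟩ := Nat.eq_zero_or_eq_succ_pred (Nat.find (h.exists_le 0)) |>.imp_right
      fun e => (⟨_, e⟩ : ∃ j, Nat.find (h.exists_le 0) = j + 1)
    · have hspec := Nat.find_spec (h.exists_le 0)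
      rw [hz] at hspec
      exact ⟨0, (h.antitone (Nat.zero_le 1)).trans hspec, h0⟩
    · have hspec := Nat.find_spec (h.exists_le 0)
      rw [hj] at hspec
      exact ⟨j, hspec,
        (not_le.1 (Nat.find_min (h.exists_le 0) (m := j) (by omega))).le⟩
  obtain ⟨b, t, hb, ht, hbt, hq⟩ : q 0 ∈ segment ℝ (r (k + 1)) (r k) :=
    Icc_subset_segment ⟨hk1, hk2⟩
  have ht1 : t ≤ 1 := by linarith
  have hout : transferOut k t r = q 0 := by
    rw [← hq, transferOut, ← hbt]
    simp only [smul_eq_mul]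
    ring
  refine ⟨k, t, ht, ht1, hout, antitone_transferRest k ht ht1 h.antitone, fun S => ?_, fun n => ?_⟩
  · have hmap : ∑ n ∈ S.map (addRightEmbedding 1), q n = ∑ n ∈ S, q (n + 1) := by
      rw [sum_map]; rfl
    rcases le_or_gt (#S) k with hS | hS
    · rw [sum_range_transferRest_of_le t r hS, ← hmap, ← card_map (addRightEmbedding 1)]
      exact h.sum_le _
    · have hmem : 0 ∉ S.map (addRightEmbedding 1) := by simp
      have := h.sum_le (insert 0 (S.map (addRightEmbedding 1)))
      rw [sum_insert hmem, card_insert_of_notMem hmem, card_map, hmap] at this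
      rw [sum_range_transferRest_of_lt t r hS, hout]
      linarith
  · obtain ⟨i, hi⟩ := h.exists_le (n + 1)
    exact ⟨i, (transferRest_le k ht h.antitone i).trans hi⟩

theorem Dominates.exists_transferSeq {q r : ℕ → ℝ} (h : Dominates q r) :
    ∃ (κ : ℕ → ℕ) (τ : ℕ → ℝ), (∀ n, 0 ≤ τ n) ∧ (∀ n, τ n ≤ 1) ∧
      ∀ n, transferOut (κ n) (τ n) (transferSeq κ τ r n) = q n := by
  have hex : ∀ q r : ℕ → ℝ, ∃ (k : ℕ) (t : ℝ), Dominates q r →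
      0 ≤ t ∧ t ≤ 1 ∧ transferOut k t r = q 0 ∧
      Dominates (fun n => q (n + 1)) (transferRest k t r) := fun q r => by
    by_cases hqr : Dominates q r
    · obtain ⟨k, t, hkt⟩ := hqr.exists_transfer
      exact ⟨k, t, fun _ => hkt⟩
    · exact ⟨0, 0, fun h => absurd h hqr⟩
  choose K T hKT using hex
  let R : ℕ → ℕ → ℝ := fun n => Nat.rec r
    (fun n x => transferRest (K (fun i => q (i + n)) x) (T (fun i => q (i + n)) x) x) n
  let κ : ℕ → ℕ := fun n => K (fun i => q (i + n)) (R n)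
  let τ : ℕ → ℝ := fun n => T (fun i => q (i + n)) (R n)
  have hR : ∀ n, transferSeq κ τ r n = R n := fun n => by
    induction n with
    | zero => rfl
    | succ n ih => rw [transferSeq, ih]
  have hdom : ∀ n, Dominates (fun i => q (i + n)) (R n) := fun n => by
    induction n with
    | zero => exact h
    | succ n ih =>
      have := (hKT _ _ ih).2.2.2
      simp only [Nat.add_right_comm _ 1 n] at this
      exact this
  refine ⟨κ, τ, fun n => (hKT _ _ (hdom n)).1, fun n => (hKT _ _ (hdom n)).2.1, fun n => ?_⟩
  rw [hR]
  simpa using (hKT _ _ (hdom n)).2.2.1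

/-- A dominated sequence with the same sum is the image of `r` under a row-stochastic matrix whose
columns have sum `1` wherever `r` is positive. -/
theorem Dominates.exists_rowStochastic {q r : ℕ → ℝ} {s : ℝ} (h : Dominates q r)
    (hr : ∀ k, 0 ≤ r k) (hqs : HasSum q s) (hrs : HasSum r s) :
    ∃ A : ℕ → ℕ → ℝ, (∀ n k, 0 ≤ A n k) ∧ (∀ n, HasSum (A n) 1) ∧
      (∀ n, HasSum (fun k => A n k * r k) (q n)) ∧
      ∀ k, 0 < r k → HasSum (fun n => A n k) 1 := by
  obtain ⟨κ, τ, hτ0, hτ1, hq⟩ := h.exists_transferSeq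
  have hA0 := transferMatrix_nonneg (κ := κ) hτ0 hτ1
  have hmul : ∀ n, HasSum (fun k => transferMatrix κ τ n k * r k) (q n) := fun n =>
    hq n ▸ hasSum_transferMatrix_mul r n
  have hcol : ∀ k, Summable fun n => transferMatrix κ τ n k := fun k =>
    summable_of_sum_range_le (fun n => hA0 n k) (sum_range_transferMatrix_le hτ0 hτ1 k)
  have hcol1 : ∀ k, ∑' n, transferMatrix κ τ n k ≤ 1 := fun k =>
    Real.tsum_le_of_sum_range_le (fun n => hA0 n k) (sum_range_transferMatrix_le hτ0 hτ1 k)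
  have hsum := (hasSum_tsum_of_nonneg (fun n k => mul_nonneg (hA0 n k) (hr k)) hmul hqs).2
  simp only [tsum_mul_right] at hsum
  have hdef := hrs.sub hsum
  rw [sub_self, hasSum_zero_iff_of_nonneg fun k => by
    simpa using mul_le_of_le_one_left (hr k) (hcol1 k)] at hdef
  refine ⟨_, hA0, hasSum_transferMatrix_row, hmul, fun k hk => ?_⟩
  have h1 : ∑' n, transferMatrix κ τ n k = 1 := by
    have : r k - (∑' n, transferMatrix κ τ n k) * r k = 0 := congrFun hdef k
    refine mul_right_cancel₀ hk.ne' ?_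
    linarith
  exact h1 ▸ (hcol k).hasSum

theorem Dominates.exists_doublyStochastic_of_pos {q r : ℕ → ℝ} {s : ℝ} (h : Dominates q r)
    (hr : ∀ k, 0 < r k) (hqs : HasSum q s) (hrs : HasSum r s) :
    ∃ A, DoublyStochastic A ∧ ∀ n, HasSum (fun k => A n k * r k) (q n) := by
  obtain ⟨A, h0, hrow, hmul, hcol⟩ := h.exists_rowStochastic (fun k => (hr k).le) hqs hrs
  exact ⟨A, ⟨h0, hrow, fun k => hcol k (hr k)⟩, hmul⟩

theorem Dominates.exists_doublyStochastic_of_eventually_zero {q r : ℕ → ℝ} {s : ℝ}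
    (h : Dominates q r) (hr : ∀ k, 0 ≤ r k) (hqs : HasSum q s) (hrs : HasSum r s) {L₀ : ℕ}
    (hq0 : ∀ n, L₀ ≤ n → q n = 0) (hr0 : ∀ n, L₀ ≤ n → r n = 0) :
    ∃ A, DoublyStochastic A ∧ ∀ n, HasSum (fun k => A n k * r k) (q n) := by
  classical
  obtain ⟨A, h0, hrow, hmul, hcol⟩ := h.exists_rowStochastic hr hqs hrs
  obtain ⟨m, hmL, hpos, hzero⟩ : ∃ m ≤ L₀, (∀ k < m, 0 < r k) ∧ ∀ k, m ≤ k → r k = 0 := by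
    have hex : ∃ m, r m = 0 := ⟨L₀, hr0 L₀ le_rfl⟩
    refine ⟨Nat.find hex, Nat.find_min' hex (hr0 L₀ le_rfl),
      fun k hk => (hr k).lt_of_ne' (Nat.find_min hex hk), fun k hk => ?_⟩
    exact le_antisymm ((h.antitone hk).trans_eq (Nat.find_spec hex)) (hr k)
  obtain ⟨L, hLdef⟩ : ∃ L, L = L₀ + 1 := ⟨_, rfl⟩
  have hAz : ∀ n, L ≤ n → ∀ k < m, A n k = 0 := fun n hn k hk => by
    have h1 := hmul n
    rw [hq0 n (by omega), hasSum_zero_iff_of_nonneg fun k => mul_nonneg (h0 n k) (hr k)] at h1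
    exact (mul_eq_zero.1 (congrFun h1 k)).resolve_right (hpos k hk).ne'
  have hcolL : ∀ k < m, ∑ n ∈ range L, A n k = 1 := fun k hk =>
    (hasSum_sum_of_ne_finset_zero fun n hn =>
      hAz n (by simpa using hn) k hk).unique (hcol k (hpos k hk))
  have hc : (0 : ℝ) < L - m := by
    have : m < L := by omega
    exact sub_pos.2 (by exact_mod_cast this)
  have hsplit : ∀ f : ℕ → ℝ, ∑ k ∈ range L, f k =
      ∑ k ∈ range m, f k + ∑ k ∈ Ico m L, f k := fun f => by
    rw [sum_range_add_sum_Ico f (by omega)]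
  have hcard : ((#(Ico m L) : ℕ) : ℝ) = L - m := by
    rw [Nat.card_Ico, Nat.cast_sub (by omega)]
  obtain ⟨d, hd⟩ : ∃ d : ℕ → ℝ, ∀ n, d n = (1 - ∑ k ∈ range m, A n k) / (L - m) :=
    ⟨_, fun _ => rfl⟩
  have hd0 : ∀ n, 0 ≤ d n := fun n => by
    rw [hd]
    exact div_nonneg (sub_nonneg.2 (sum_le_hasSum _ (fun k _ => h0 n k) (hrow n))) hc.le
  have hdsum : ∑ n ∈ range L, d n = 1 := by
    simp only [hd]
    rw [← sum_div, sum_sub_distrib, sum_comm, sum_congr rfl fun k hk => hcolL k (mem_range.1 hk)]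
    simp [hc.ne']
  let B : ℕ → ℕ → ℝ := fun n k =>
    if n < L then if k < m then A n k else if k < L then d n else 0 else if n = k then 1 else 0
  refine ⟨B, ⟨fun n k => ?_, fun n => ?_, fun k => ?_⟩, fun n => ?_⟩
  · simp only [B]
    split_ifs
    exacts [h0 n k, hd0 n, le_rfl, zero_le_one, le_rfl]
  · by_cases hn : n < L
    · have hsum : ∑ k ∈ range L, B n k = 1 := by
        rw [hsplit, sum_congr rfl (g := A n) fun k hk => by
          simp [B, hn, mem_range.1 hk], sum_congr (s₁ := Ico m L) rfl (g := fun _ => d n)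
          fun k hk => by simp [B, hn, not_lt.2 (mem_Ico.1 hk).1, (mem_Ico.1 hk).2]]
        rw [sum_const, nsmul_eq_mul, hcard, hd]
        field_simp
        ring
      rw [← hsum]
      refine hasSum_sum_of_ne_finset_zero fun k hk => ?_
      have hk' : L ≤ k := by simpa using hk
      have h1 : ¬ k < m := by omega
      simp [B, hn, h1, not_lt.2 hk']
    · simpa [B, hn, eq_comm] using hasSum_ite_eq n (1 : ℝ)
  · by_cases hk : k < L
    · have hsum : ∑ n ∈ range L, B n k = 1 := by
        by_cases hkm : k < m
        · rw [← hcolL k hkm]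
          exact sum_congr rfl fun n hn => by simp [B, mem_range.1 hn, hkm]
        · rw [← hdsum]
          exact sum_congr rfl fun n hn => by simp [B, mem_range.1 hn, hkm, hk]
      rw [← hsum]
      refine hasSum_sum_of_ne_finset_zero fun n hn => ?_
      have hn' : L ≤ n := by simpa using hn
      have h1 : n ≠ k := by omega
      simp [B, not_lt.2 hn', h1]
    · convert hasSum_ite_eq k (1 : ℝ) using 2 with n
      have h1 : ¬ k < m := by omega
      by_cases hn : n < L
      · have h2 : n ≠ k := by omega
        simp [B, hn, h1, hk, h2]
      · simp [B, hn]
  · by_cases hn : n < L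
    · convert hmul n using 2 with k
      by_cases hk : k < m
      · simp [B, hn, hk]
      · simp [hzero k (not_lt.1 hk)]
    · rw [hq0 n (by omega)]
      convert hasSum_zero (α := ℝ) using 2 with k
      by_cases hk : n = k
      · simp [hr0 k (by omega)]
      · simp [B, hn, hk]

end Majorization

section Thinning

/-- The probability that a thinned `k`-particle state holds `n` particles. -/
noncomputable def thinKernel (lam : ℝ) (k n : ℕ) : ℝ :=
  (k.choose n : ℝ) * lam ^ n * (1 - lam) ^ (k - n)

variable {lam : ℝ}

theorem thinKernel_nonneg (h0 : 0 ≤ lam) (h1 : lam ≤ 1) (k n : ℕ) : 0 ≤ thinKernel lam k n :=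
  mul_nonneg (mul_nonneg (Nat.cast_nonneg _) (pow_nonneg h0 _)) (pow_nonneg (sub_nonneg.2 h1) _)

theorem thinKernel_eq_zero {k n : ℕ} (h : k < n) : thinKernel lam k n = 0 := by
  simp [thinKernel, Nat.choose_eq_zero_of_lt h]

theorem thinKernel_self (n : ℕ) : thinKernel lam n n = lam ^ n := by
  simp [thinKernel]

theorem thinKernel_zero_zero : thinKernel lam 0 0 = 1 := by simp [thinKernel]

theorem thinKernel_succ_zero (k : ℕ) :
    thinKernel lam (k + 1) 0 = (1 - lam) * thinKernel lam k 0 := by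
  simp [thinKernel, pow_succ']

theorem thinKernel_succ_succ (k n : ℕ) : thinKernel lam (k + 1) (n + 1) =
    lam * thinKernel lam k n + (1 - lam) * thinKernel lam k (n + 1) := by
  rcases lt_or_ge n k with h | h
  · obtain ⟨j, rfl⟩ := Nat.exists_eq_add_of_lt h
    have h1 : n + j + 1 + 1 - (n + 1) = j + 1 := by omega
    have h2 : n + j + 1 - n = j + 1 := by omega
    have h3 : n + j + 1 - (n + 1) = j := by omega
    simp only [thinKernel, h1, h2, h3, Nat.choose_succ_succ' (n + j + 1) n, Nat.cast_add]
    ring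
  · rw [thinKernel_eq_zero (Nat.lt_succ_of_le h)]
    simp only [thinKernel, Nat.choose_succ_succ' k n, Nat.choose_eq_zero_of_lt (Nat.lt_succ_of_le h),
      Nat.add_sub_add_right, add_zero]
    ring

theorem hasSum_thinKernel (k : ℕ) : HasSum (thinKernel lam k) 1 := by
  have h : ∑ n ∈ range (k + 1), thinKernel lam k n = 1 := by
    have := add_pow lam (1 - lam) k
    rw [add_sub_cancel, one_pow] at this
    rw [this]
    exact sum_congr rfl fun n _ => by unfold thinKernel; ring
  rw [← h]
  exact hasSum_sum_of_ne_finset_zero fun n hn => thinKernel_eq_zero (by simpa using hn)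

/-- The set of predecessors of the positive elements of `S`. -/
noncomputable def predSet (S : Finset ℕ) : Finset ℕ := S.preimage Nat.succ Nat.succ_injective.injOn

theorem sum_eq_add_sum_predSet (S : Finset ℕ) (f : ℕ → ℝ) :
    ∑ k ∈ S, f k = (if 0 ∈ S then f 0 else 0) + ∑ k ∈ predSet S, f (k + 1) := by
  have hmap : (predSet S).map (addRightEmbedding 1) = S.erase 0 := by
    ext k
    cases k <;> simp [predSet]
  have hsum : ∑ k ∈ predSet S, f (k + 1) = ∑ k ∈ S.erase 0, f k := by
    rw [← hmap, sum_map]; rfl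
  rw [hsum]
  split_ifs with h
  · exact (add_sum_erase S f h).symm
  · rw [erase_eq_of_notMem h, zero_add]

theorem card_eq_add_card_predSet (S : Finset ℕ) :
    #S = (if 0 ∈ S then 1 else 0) + #(predSet S) := by
  have h := sum_eq_add_sum_predSet S fun _ => 1
  simp only [sum_const, nsmul_eq_mul, mul_one] at h
  split_ifs at h ⊢ <;> exact_mod_cast h

theorem sum_thinKernel_succ (R : Finset ℕ) (k : ℕ) : ∑ n ∈ R, thinKernel lam (k + 1) n =
    lam * ∑ n ∈ predSet R, thinKernel lam k n + (1 - lam) * ∑ n ∈ R, thinKernel lam k n := by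
  rw [sum_eq_add_sum_predSet R, sum_eq_add_sum_predSet R (thinKernel lam k)]
  simp only [thinKernel_succ_zero, thinKernel_succ_succ, sum_add_distrib, ← mul_sum]
  split_ifs <;> ring

theorem sum_thinKernel_zero (R : Finset ℕ) :
    ∑ n ∈ R, thinKernel lam 0 n = if 0 ∈ R then 1 else 0 := by
  rw [sum_eq_add_sum_predSet R, sum_eq_zero fun n _ => thinKernel_eq_zero n.succ_pos, add_zero,
    thinKernel_zero_zero]

theorem sum_sum_thinKernel_eq (S R : Finset ℕ) :
    ∑ k ∈ S, ∑ n ∈ R, thinKernel lam k n = (if 0 ∈ S then if 0 ∈ R then 1 else 0 else 0) +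
      (lam * ∑ k ∈ predSet S, ∑ n ∈ predSet R, thinKernel lam k n +
        (1 - lam) * ∑ k ∈ predSet S, ∑ n ∈ R, thinKernel lam k n) := by
  rw [sum_eq_add_sum_predSet S]
  simp only [sum_thinKernel_succ, sum_thinKernel_zero, sum_add_distrib, ← mul_sum]

theorem predSet_range_succ (N : ℕ) : predSet (range (N + 1)) = range N := by
  ext k; simp [predSet]

theorem sum_sum_thinKernel_le (h0 : 0 ≤ lam) (h1 : lam ≤ 1) (S R : Finset ℕ) :
    ∑ k ∈ S, ∑ n ∈ R, thinKernel lam k n ≤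
      ∑ k ∈ range (#S), ∑ n ∈ range (#R), thinKernel lam k n := by
  have hmono : ∀ {N N' M M' : ℕ}, N ≤ N' → M ≤ M' →
      ∑ k ∈ range N, ∑ n ∈ range M, thinKernel lam k n ≤
        ∑ k ∈ range N', ∑ n ∈ range M', thinKernel lam k n := fun hN hM => by
    refine (sum_le_sum fun k _ => sum_le_sum_of_subset_of_nonneg (range_subset_range.2 hM)
      fun n _ _ => thinKernel_nonneg h0 h1 k n).trans ?_
    exact sum_le_sum_of_subset_of_nonneg (range_subset_range.2 hN)
      fun k _ _ => sum_nonneg fun n _ => thinKernel_nonneg h0 h1 k n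
  obtain ⟨K, hK⟩ : ∃ K, S ⊆ range K := S.exists_nat_subset_range
  induction K generalizing S R with
  | zero =>
    obtain rfl : S = ∅ := by simpa using hK
    simp
  | succ K ih =>
    have hK' : predSet S ⊆ range K := fun k hk => by
      have := hK (mem_preimage.1 hk)
      simpa using this
    rw [sum_sum_thinKernel_eq]
    have hS := card_eq_add_card_predSet S
    have hR := card_eq_add_card_predSet R
    have i1 := mul_le_mul_of_nonneg_left (ih (predSet S) (predSet R) hK') h0
    have i2 := mul_le_mul_of_nonneg_left (ih (predSet S) R hK') (sub_nonneg.2 h1)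
    by_cases hS0 : 0 ∈ S
    · by_cases hR0 : 0 ∈ R
      · rw [if_pos hS0, add_comm] at hS
        rw [if_pos hR0, add_comm] at hR
        rw [hS, hR, sum_sum_thinKernel_eq (range _), predSet_range_succ, predSet_range_succ]
        rw [hR] at i2
        simp only [hS0, hR0, if_true, mem_range, Nat.succ_pos]
        linarith
      · have i3 := hmono (Nat.le.intro ((add_comm _ _).trans hS.symm)) (le_refl (#R))
        rw [if_neg hR0, zero_add] at hR
        rw [← hR] at i1
        simp only [hR0, if_false, ite_self]
        linarith
    · rw [if_neg hS0, zero_add] at hS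
      rw [← hS] at i1 i2
      have i3 := hmono (le_refl (#S)) (Nat.le.intro ((add_comm _ _).trans hR.symm))
      have i4 := mul_le_mul_of_nonneg_left i3 h0
      simp only [hS0, if_false]
      linarith

theorem mul_sum_range_le_sum_range_mul {a g : ℕ → ℝ} (ha : Antitone a)
    (hg : ∀ N, 0 ≤ ∑ j ∈ range N, g j) (N : ℕ) :
    a N * ∑ j ∈ range N, g j ≤ ∑ j ∈ range N, a j * g j := by
  induction N with
  | zero => simp
  | succ N ih =>
    have := mul_le_mul_of_nonneg_right (ha N.le_succ) (hg (N + 1))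
    rw [sum_range_succ (fun j => a j * g j)]
    rw [sum_range_succ] at this ⊢
    linarith

variable {p : ℕ → ℝ} {s : ℝ}

theorem summable_thinKernel_mul (h0 : 0 ≤ lam) (h1 : lam ≤ 1) (hp : ∀ n, 0 ≤ p n)
    (hs : HasSum p s) : (∀ n, Summable fun k => thinKernel lam k n * p k) ∧
      HasSum (thin lam p) s :=
  hasSum_tsum_of_nonneg (f := fun k n => thinKernel lam k n * p k)
    (fun k n => mul_nonneg (thinKernel_nonneg h0 h1 k n) (hp k))
    (fun k => by simpa using (hasSum_thinKernel (lam := lam) k).mul_right (p k)) hs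

theorem hasSum_thin_apply (h0 : 0 ≤ lam) (h1 : lam ≤ 1) (hp : ∀ n, 0 ≤ p n) (hs : HasSum p s)
    (n : ℕ) : HasSum (fun k => thinKernel lam k n * p k) (thin lam p n) :=
  ((summable_thinKernel_mul h0 h1 hp hs).1 n).hasSum

theorem thin_nonneg (h0 : 0 ≤ lam) (h1 : lam ≤ 1) (hp : ∀ n, 0 ≤ p n) (n : ℕ) :
    0 ≤ thin lam p n :=
  tsum_nonneg fun k => mul_nonneg (thinKernel_nonneg h0 h1 k n) (hp k)

theorem thin_pos (h0 : 0 < lam) (h1 : lam ≤ 1) (hp : ∀ n, 0 ≤ p n) (hs : HasSum p s) {n : ℕ}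
    (hn : 0 < p n) : 0 < thin lam p n := by
  refine lt_of_lt_of_le (mul_pos (pow_pos h0 n) hn) ?_
  rw [← thinKernel_self]
  exact le_hasSum (hasSum_thin_apply h0.le h1 hp hs n) n
    fun k _ => mul_nonneg (thinKernel_nonneg h0.le h1 k n) (hp k)

theorem thin_eq_zero {L n : ℕ} (hp : ∀ k, L ≤ k → p k = 0) (hn : L ≤ n) : thin lam p n = 0 := by
  change ∑' k, thinKernel lam k n * p k = 0
  rw [← tsum_zero (α := ℝ) (β := ℕ)]
  refine tsum_congr fun k => ?_
  rcases lt_or_ge k n with h | h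
  · rw [thinKernel_eq_zero h, zero_mul]
  · rw [hp k (hn.trans h), mul_zero]

theorem thin_zero (n : ℕ) : thin 0 p n = if n = 0 then ∑' k, p k else 0 := by
  rcases eq_or_ne n 0 with rfl | hn <;> simp [thin, *]

/-- Among all rearrangements, the nonincreasing one maximises the partial sums of the thinning. -/
theorem sum_thin_le (h0 : 0 ≤ lam) (h1 : lam ≤ 1) (hp : ∀ n, 0 ≤ p n) (hs : HasSum p s)
    {σ : ℕ → ℕ} (hσ : Function.Bijective σ) (hmono : Antitone fun n => p (σ n))
    (R : Finset ℕ) :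
    ∑ n ∈ R, thin lam p n ≤ ∑ n ∈ range (#R), thin lam (fun j => p (σ j)) n := by
  have hs' : HasSum (fun j => p (σ j)) s := (Equiv.ofBijective σ hσ).hasSum_iff.2 hs
  have hR : HasSum (fun j => ∑ n ∈ R, thinKernel lam (σ j) n * p (σ j))
      (∑ n ∈ R, thin lam p n) :=
    (Equiv.ofBijective σ hσ).hasSum_iff.2 (hasSum_sum fun n _ => hasSum_thin_apply h0 h1 hp hs n)
  have hM : HasSum (fun j => ∑ n ∈ range (#R), thinKernel lam j n * p (σ j))
      (∑ n ∈ range (#R), thin lam (fun j => p (σ j)) n) :=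
    hasSum_sum fun n _ => hasSum_thin_apply h0 h1 (fun j => hp (σ j)) hs' n
  refine le_of_tendsto_of_tendsto' hR.tendsto_sum_nat hM.tendsto_sum_nat fun N => ?_
  have hg : ∀ N, 0 ≤ ∑ j ∈ range N,
      (∑ n ∈ range (#R), thinKernel lam j n - ∑ n ∈ R, thinKernel lam (σ j) n) := fun N => by
    have := sum_sum_thinKernel_le h0 h1 ((range N).map ⟨σ, hσ.injective⟩) R
    rw [sum_map, card_map, card_range] at this
    rw [sum_sub_distrib]
    exact sub_nonneg.2 this
  have := (mul_nonneg (hp (σ N)) (hg N)).trans (mul_sum_range_le_sum_range_mul hmono hg N)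
  simp only [mul_sub, sum_sub_distrib] at this
  simpa only [← sum_mul, mul_comm _ (p _), ← mul_sum] using sub_nonneg.1 this

theorem antitone_thin (h0 : 0 ≤ lam) (h1 : lam ≤ 1) (hp : ∀ n, 0 ≤ p n) (hs : HasSum p s)
    (hmono : Antitone p) : Antitone (thin lam p) := by
  refine antitone_nat_of_succ_le fun n => ?_
  have hmem : n + 1 ∉ range n := by simp
  have h := sum_thin_le h0 h1 hp hs Function.bijective_id hmono (insert (n + 1) (range n))
  rw [sum_insert hmem, card_insert_of_notMem hmem, card_range, sum_range_succ, add_comm] at h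
  exact le_of_add_le_add_left h

theorem dominates_thin (h0 : 0 ≤ lam) (h1 : lam ≤ 1) (hp : ∀ n, 0 ≤ p n) (hs : HasSum p s)
    {σ : ℕ → ℕ} (hσ : Function.Bijective σ) (hmono : Antitone fun n => p (σ n))
    (hex : ∀ n, ∃ k, thin lam (fun j => p (σ j)) k ≤ thin lam p n) :
    Dominates (thin lam p) (thin lam fun j => p (σ j)) where
  antitone := antitone_thin h0 h1 (fun j => hp (σ j))
    ((Equiv.ofBijective σ hσ).hasSum_iff.2 hs) hmono
  sum_le := sum_thin_le h0 h1 hp hs hσ hmono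
  exists_le := hex

theorem exists_doublyStochastic_thin_of_pos (h0 : 0 ≤ lam) (h1 : lam ≤ 1)
    (hp : ∀ n, 0 < p n) (hs : HasSum p s) {σ : ℕ → ℕ} (hσ : Function.Bijective σ)
    (hmono : Antitone fun n => p (σ n)) :
    ∃ A : ℕ → ℕ → ℝ, DoublyStochastic A ∧
      ∀ n, HasSum (fun k => A n k * thin lam (fun j => p (σ j)) k) (thin lam p n) := by
  have hs' : HasSum (fun j => p (σ j)) s := (Equiv.ofBijective σ hσ).hasSum_iff.2 hs
  have hp0 : ∀ n, 0 ≤ p n := fun n => (hp n).le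
  have hr := (summable_thinKernel_mul h0 h1 (fun j => hp0 (σ j)) hs').2
  have hq := (summable_thinKernel_mul h0 h1 hp0 hs).2
  rcases h0.eq_or_lt with rfl | hlam
  · have hqr : thin 0 (fun j => p (σ j)) = thin 0 p := by
      funext n
      rw [thin_zero, thin_zero, hs.tsum_eq, hs'.tsum_eq]
    refine ⟨fun n k => if k = n then 1 else 0, ⟨fun n k => by dsimp only; split_ifs <;> norm_num,
      fun n => hasSum_ite_eq n 1, fun n => ?_⟩, fun n => ?_⟩
    · simpa only [eq_comm] using hasSum_ite_eq n (1 : ℝ)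
    · rw [hqr]
      simpa using hasSum_single (f := fun k => (if k = n then 1 else 0) * thin 0 p k) n
        fun k hk => by simp [hk]
  · refine (dominates_thin h0 h1 hp0 hs hσ hmono fun n => ?_).exists_doublyStochastic_of_pos
      (fun k => thin_pos hlam h1 (fun j => hp0 (σ j)) hs' (hp (σ k))) hq hr
    exact ((hr.summable.tendsto_atTop_zero.eventually_lt_const
      (thin_pos hlam h1 hp0 hs (hp n))).exists).imp fun _ => le_of_lt

theorem exists_doublyStochastic_thin_of_eventually_zero (h0 : 0 ≤ lam) (h1 : lam ≤ 1)
    (hp : ∀ n, 0 ≤ p n) (hs : HasSum p s) {σ : ℕ → ℕ} (hσ : Function.Bijective σ)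
    (hmono : Antitone fun n => p (σ n)) {m : ℕ} (hm : p (σ m) = 0) :
    ∃ A : ℕ → ℕ → ℝ, DoublyStochastic A ∧
      ∀ n, HasSum (fun k => A n k * thin lam (fun j => p (σ j)) k) (thin lam p n) := by
  have hs' : HasSum (fun j => p (σ j)) s := (Equiv.ofBijective σ hσ).hasSum_iff.2 hs
  have hz : ∀ k, m ≤ k → p (σ k) = 0 := fun k hk => le_antisymm ((hmono hk).trans_eq hm) (hp _)
  obtain ⟨L, hL⟩ : ∃ L, (range m).image σ ⊆ range L := Finset.exists_nat_subset_range _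
  have hpz : ∀ n, L ≤ n → p n = 0 := fun n hn => by
    obtain ⟨k, rfl⟩ := hσ.surjective n
    refine hz k (not_lt.1 fun hk => ?_)
    exact hn.not_gt (mem_range.1 (hL (mem_image_of_mem σ (mem_range.2 hk))))
  refine (dominates_thin h0 h1 hp hs hσ hmono fun n => ⟨m, ?_⟩)
    |>.exists_doublyStochastic_of_eventually_zero (L₀ := max L m)
      (thin_nonneg h0 h1 fun j => hp (σ j)) (summable_thinKernel_mul h0 h1 hp hs).2
      (summable_thinKernel_mul h0 h1 (fun j => hp (σ j)) hs').2
      (fun n hn => thin_eq_zero hpz ((le_max_left _ _).trans hn))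
      (fun n hn => thin_eq_zero hz ((le_max_right _ _).trans hn))
  exact (thin_eq_zero hz le_rfl).trans_le (thin_nonneg h0 h1 hp n)

end Thinning

end Preliminaries

/-- Majorization theorem for the thinning: for `0 ≤ λ ≤ 1` and a probability distribution
`p` on `ℕ`, the thinning `T_λ(p)` is majorized by `T_λ(p↓)`, where `p↓` is the decreasing
rearrangement of `p` given by a bijection `σ : ℕ → ℕ` with `p↓_n = p_{σ(n)}` nonincreasing:
there is a doubly stochastic infinite matrix `A` with
`(T_λ(p))_n = ∑_k A_{nk} (T_λ(p↓))_k` for every `n`. -/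
theorem thinning_majorization (lam : ℝ) (hlam0 : 0 ≤ lam) (hlam1 : lam ≤ 1)
    (p : ℕ → ℝ) (hp : ∀ n, 0 ≤ p n) (hpsum : HasSum p 1)
    (σ : ℕ → ℕ) (hσ : Function.Bijective σ) (hmono : Antitone fun n => p (σ n)) :
    ∃ A : ℕ → ℕ → ℝ, DoublyStochastic A ∧
      ∀ n, HasSum (fun k => A n k * thin lam (fun j => p (σ j)) k) (thin lam p n) := by
  by_cases h : ∃ m, p (σ m) = 0
  · obtain ⟨m, hm⟩ := h
    exact exists_doublyStochastic_thin_of_eventually_zero hlam0 hlam1 hp hpsum hσ hmono hm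
  · push Not at h
    refine exists_doublyStochastic_thin_of_pos hlam0 hlam1 (fun n => ?_) hpsum hσ hmono
    obtain ⟨k, rfl⟩ := hσ.surjective n
    exact (hp _).lt_of_ne' (h k)
end
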